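/- Let A_S be an Artin group of large type, let P be a parabolic subgroup of A_S, and let g ∈ A_S. If gⁿ ∈ P for some non-zero integer n, then g ∈ P. -/

import Mathlib

/-- The alternating word `sts⋯` of length `k` in the free group on `S`. -/
def braidWord {S : Type*} (k : ℕ) (s t : S) : FreeGroup S :=
  ((List.range k).map fun i => FreeGroup.of (if i % 2 = 0 then s else t)).prod

/-- The braid relations of the Artin group with Coxeter-type matrix `M`
(`M s t = ⊤` means no relation). -/
def artinRels {S : Type*} (M : S → S → ℕ∞) : Set (FreeGroup S) :=
  { r | ∃ s t : S, s ≠ t ∧ ∃ k : ℕ, M s t = (k : ℕ∞) ∧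
      r = braidWord k s t * (braidWord k t s)⁻¹ }

/-- The Artin group associated to the matrix `M`. -/
abbrev ArtinGroup {S : Type*} (M : S → S → ℕ∞) : Type _ := PresentedGroup (artinRels M)

/-- The standard parabolic subgroup `A_X` generated by the images of elements of `X ⊆ S`. -/
def StandardParabolic {S : Type*} (M : S → S → ℕ∞) (X : Set S) : Subgroup (ArtinGroup M) :=
  Subgroup.closure ((fun s => (PresentedGroup.of s : ArtinGroup M)) '' X)

/-- The conjugate `g H g⁻¹` of a subgroup. -/
def conjSubgroup {G : Type*} [Group G] (g : G) (H : Subgroup G) : Subgroup G :=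
  H.map (MulAut.conj g).toMonoidHom

/-- A parabolic subgroup: a conjugate of a standard parabolic subgroup. -/
def IsParabolic {S : Type*} (M : S → S → ℕ∞) (P : Subgroup (ArtinGroup M)) : Prop :=
  ∃ (g : ArtinGroup M) (X : Set S), P = conjSubgroup g (StandardParabolic M X)

open scoped Pointwise

universe u

/-- One layer of a layered graph over a vertex set `V`: its vertices, their images in `V`, the
adjacency inside the layer, and for each vertex the set of directions already covered. -/
structure Layer (V : Type u) where
  T : Type u
  f : T → V
  adj : T → T → Prop
  old : T → Set V

namespace Layer

variable {V : Type u} (Γ : SimpleGraph V)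

/-- The directions at `v` which are not yet covered. -/
def new (L : Layer V) (v : L.T) : Set V := {y | Γ.Adj (L.f v) y ∧ y ∉ L.old v}

/-- Vertices together with an uncovered direction. -/
abbrev Pre (L : Layer V) : Type u := {p : L.T × V // p.2 ∈ L.new Γ p.1}

/-- The identification of uncovered directions. -/
def rel (L : Layer V) (p q : L.Pre Γ) : Prop :=
  p.1.2 = q.1.2 ∧ (p.1.1 = q.1.1 ∨ L.adj p.1.1 q.1.1)

/-- The vertices of the following layer. -/
abbrev NextT (L : Layer V) : Type u := Quot (L.rel Γ)

/-- The projection of the following layer. -/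
def nextF (L : Layer V) : L.NextT Γ → V := Quot.lift (fun p => p.1.2) fun _ _ h => h.1

/-- The vertex `u` of a layer lies immediately below the vertex `x` of the following layer. -/
def low (L : Layer V) (u : L.T) (x : L.NextT Γ) : Prop :=
  ∃ (y : V) (h : y ∈ L.new Γ u), x = Quot.mk _ ⟨(u, y), h⟩

/-- Adjacency in the following layer. -/
def nextAdj (L : Layer V) (x x' : L.NextT Γ) : Prop :=
  Γ.Adj (L.nextF Γ x) (L.nextF Γ x') ∧ ∃ u, L.low Γ u x ∧ L.low Γ u x'

/-- The following layer. -/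
def next (L : Layer V) : Layer V where
  T := L.NextT Γ
  f := L.nextF Γ
  adj := L.nextAdj Γ
  old x := {z | (∃ u, L.low Γ u x ∧ L.f u = z) ∨ ∃ x', L.nextAdj Γ x x' ∧ L.nextF Γ x' = z}

/-- The inductive invariant of layers. -/
structure Inv (L : Layer V) : Prop where
  symm : ∀ {v w}, L.adj v w → L.adj w v
  hom : ∀ {v w}, L.adj v w → Γ.Adj (L.f v) (L.f w)
  adj_old : ∀ {v w}, L.adj v w → L.f w ∈ L.old v
  old_step : ∀ {v y z}, y ∈ L.new Γ v → z ∈ L.old v → Γ.Adj z y →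
    ∃ w, L.adj v w ∧ L.f w = z ∧ y ∈ L.new Γ w
  new_adj : ∀ {v w y}, L.adj v w → y ∈ L.new Γ v → Γ.Adj y (L.f w) → y ∈ L.new Γ w
  new_trans : ∀ {u v w y}, L.adj u v → L.adj v w → y ∈ L.new Γ u → y ∈ L.new Γ v →
    y ∈ L.new Γ w → u = w ∨ L.adj u w
  inj : ∀ {v w w'}, L.adj v w → L.adj v w' → L.f w = L.f w' → w = w'
  tri : ∀ {v w w'}, L.adj v w → L.adj v w' → Γ.Adj (L.f w) (L.f w') → L.adj w w'

variable {Γ}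
variable {L : Layer V}

theorem low_exists (x : L.NextT Γ) : ∃ u, L.low Γ u x := by
  induction x using Quot.ind with
  | mk p => exact ⟨p.1.1, p.1.2, p.2, rfl⟩

theorem low_new {u : L.T} {x : L.NextT Γ} (h : L.low Γ u x) : L.nextF Γ x ∈ L.new Γ u := by
  obtain ⟨y, hy, rfl⟩ := h
  exact hy

theorem low_hom {u : L.T} {x : L.NextT Γ} (h : L.low Γ u x) : Γ.Adj (L.f u) (L.nextF Γ x) :=
  (low_new h).1

theorem low_mk {u : L.T} {y : V} (h : y ∈ L.new Γ u) :
    L.low Γ u (Quot.mk _ ⟨(u, y), h⟩) := ⟨y, h, rfl⟩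

theorem low_inj {u : L.T} {x x' : L.NextT Γ} (h : L.low Γ u x) (h' : L.low Γ u x')
    (e : L.nextF Γ x = L.nextF Γ x') : x = x' := by
  obtain ⟨y, hy, rfl⟩ := h
  obtain ⟨y', hy', rfl⟩ := h'
  have : y = y' := e
  subst this
  rfl

theorem low_inj_adj {u w : L.T} {x x' : L.NextT Γ} (h : L.low Γ u x) (h' : L.low Γ w x')
    (huw : L.adj u w) (e : L.nextF Γ x = L.nextF Γ x') : x = x' := by
  obtain ⟨y, hy, rfl⟩ := h
  obtain ⟨y', hy', rfl⟩ := h'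
  exact Quot.sound ⟨e, Or.inr huw⟩

theorem low_transfer {u w : L.T} {x : L.NextT Γ} (h : L.low Γ u x) (huw : L.adj u w)
    (hn : L.nextF Γ x ∈ L.new Γ w) : L.low Γ w x :=
  ⟨_, hn, low_inj_adj h (low_mk hn) huw rfl⟩

theorem Inv.low_low (I : L.Inv Γ) {u w : L.T} {x : L.NextT Γ} (h : L.low Γ u x)
    (h' : L.low Γ w x) : u = w ∨ L.adj u w := by
  have eqv : Equivalence (L.rel Γ) := by
    refine ⟨fun p => ⟨rfl, Or.inl rfl⟩, ?_, ?_⟩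
    · rintro p q ⟨h1, h2⟩
      exact ⟨h1.symm, h2.imp Eq.symm I.symm⟩
    · rintro ⟨⟨p, y⟩, hp⟩ ⟨⟨q, y'⟩, hq⟩ ⟨⟨r, y''⟩, hr⟩ ⟨h1, h2⟩ ⟨h3, h4⟩
      dsimp only at h1 h2 h3 h4 hp hq hr
      subst h1 h3
      refine ⟨rfl, ?_⟩
      dsimp only
      rcases h2 with rfl | h2
      · exact h4
      · rcases h4 with rfl | h4
        · exact Or.inr h2
        · exact I.new_trans h2 h4 hp hq hr
  obtain ⟨y, hy, rfl⟩ := h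
  obtain ⟨y', hy', e⟩ := h'
  exact (eqv.eqvGen_iff.1 (Quot.eqvGen_exact e)).2

theorem Inv.low_old (I : L.Inv Γ) {u : L.T} {v : L.NextT Γ} {z : V} (h : L.low Γ u v)
    (h1 : Γ.Adj z (L.nextF Γ v)) (h2 : Γ.Adj z (L.f u)) : z ∈ (L.next Γ).old v := by
  by_cases hz : z ∈ L.old u
  · obtain ⟨w, a, b, c⟩ := I.old_step (low_new h) hz h1
    exact Or.inl ⟨w, low_transfer h a c, b⟩
  · have hz' : z ∈ L.new Γ u := ⟨h2.symm, hz⟩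
    exact Or.inr ⟨Quot.mk _ ⟨(u, z), hz'⟩, ⟨h1.symm, u, h, low_mk hz'⟩, rfl⟩

theorem Inv.next_inj (I : L.Inv Γ) {v w w' : L.NextT Γ} (h : L.nextAdj Γ v w)
    (h' : L.nextAdj Γ v w') (e : L.nextF Γ w = L.nextF Γ w') : w = w' := by
  obtain ⟨-, u, a, b⟩ := h
  obtain ⟨-, u', a', b'⟩ := h'
  rcases I.low_low a a' with rfl | h
  · exact low_inj b b' e
  · exact low_inj_adj b b' h e

theorem Inv.adj_low_ne (I : L.Inv Γ) {v w : L.NextT Γ} {u : L.T} (h : L.nextAdj Γ v w)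
    (h' : L.low Γ u v) :
    L.nextF Γ w ≠ L.f u := by
  intro e
  obtain ⟨-, u', a, b⟩ := h
  have := low_new b
  rw [e] at this
  rcases I.low_low a h' with rfl | h
  · exact this.1.ne rfl
  · exact this.2 (I.adj_old h)

theorem Inv.adj_low (I : L.Inv Γ) {v w : L.NextT Γ} {u : L.T} (h : L.nextAdj Γ v w)
    (h' : L.low Γ u v)
    (hu : Γ.Adj (L.f u) (L.nextF Γ w)) : L.low Γ u w := by
  obtain ⟨-, u', a, b⟩ := h
  rcases I.low_low a h' with rfl | h
  · exact b
  · exact low_transfer b h (I.new_adj h (low_new b) hu.symm)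

theorem nextAdj_symm {v w : L.NextT Γ} (h : L.nextAdj Γ v w) : L.nextAdj Γ w v := by
  obtain ⟨a, u, b, c⟩ := h
  exact ⟨a.symm, u, c, b⟩

theorem Inv.next_tri (I : L.Inv Γ)
    (h4 : ∀ z a b c d, Γ.Adj z a → Γ.Adj z b → Γ.Adj z c → Γ.Adj z d → Γ.Adj a b →
    Γ.Adj b c → Γ.Adj c d → Γ.Adj d a → a = c ∨ b = d ∨ Γ.Adj a c ∨ Γ.Adj b d)
    {v w w' : L.NextT Γ} (h : L.nextAdj Γ v w) (h' : L.nextAdj Γ v w')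
    (e : Γ.Adj (L.nextF Γ w) (L.nextF Γ w')) : L.nextAdj Γ w w' := by
  obtain ⟨h1, u, a, b⟩ := id h
  obtain ⟨h1', u', a', b'⟩ := id h'
  rcases I.low_low a a' with rfl | hu
  · exact ⟨e, u, b, b'⟩
  rcases h4 (L.nextF Γ v) (L.nextF Γ w) (L.f u) (L.f u') (L.nextF Γ w') h1 (low_hom a).symm
    (low_hom a').symm h1' (low_hom b).symm (I.hom hu) (low_hom b') e.symm with h5 | h5 | h5 | h5
  · exact absurd h5 (I.adj_low_ne h a')
  · exact absurd h5.symm (I.adj_low_ne h' a)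
  · exact ⟨e, u', I.adj_low h a' h5.symm, b'⟩
  · exact ⟨e, u, b, I.adj_low h' a h5⟩

theorem Inv.next_new_trans (I : L.Inv Γ)
    (h4 : ∀ z a b c d, Γ.Adj z a → Γ.Adj z b → Γ.Adj z c → Γ.Adj z d → Γ.Adj a b →
    Γ.Adj b c → Γ.Adj c d → Γ.Adj d a → a = c ∨ b = d ∨ Γ.Adj a c ∨ Γ.Adj b d)
    (h5 : ∀ z a b c d e, Γ.Adj z a → Γ.Adj z b → Γ.Adj z c → Γ.Adj z d → Γ.Adj z e →
    Γ.Adj a b → Γ.Adj b c → Γ.Adj c d → Γ.Adj d e → Γ.Adj e a →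
    (a = c ∨ Γ.Adj a c) ∨ (b = d ∨ Γ.Adj b d) ∨ (c = e ∨ Γ.Adj c e) ∨ (d = a ∨ Γ.Adj d a) ∨
      (e = b ∨ Γ.Adj e b))
    {v w w' : L.NextT Γ} {z : V} (h : L.nextAdj Γ v w)
    (h' : L.nextAdj Γ w w') (hv : z ∈ (L.next Γ).new Γ v) (hw : z ∈ (L.next Γ).new Γ w)
    (hw' : z ∈ (L.next Γ).new Γ w') : v = w' ∨ L.nextAdj Γ v w' := by
  have fin : L.nextF Γ v = L.nextF Γ w' ∨ Γ.Adj (L.nextF Γ v) (L.nextF Γ w') →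
      v = w' ∨ L.nextAdj Γ v w' := by
    rintro (e | e)
    · exact Or.inl (I.next_inj (nextAdj_symm h) h' e)
    · exact Or.inr (I.next_tri h4 (nextAdj_symm h) h' e)
  have noeq : ∀ {x : L.NextT Γ} {u}, z ∈ (L.next Γ).new Γ x → L.low Γ u x → L.f u ≠ z :=
    fun hz hu e => hz.2 (Or.inl ⟨_, hu, e⟩)
  have noadj : ∀ {x : L.NextT Γ} {u}, z ∈ (L.next Γ).new Γ x → L.low Γ u x → ¬ Γ.Adj z (L.f u) :=
    fun hz hu e => hz.2 (I.low_old hu hz.1.symm e)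
  have common : ∀ u, L.low Γ u v → L.low Γ u w → L.low Γ u w' → v = w' ∨ L.nextAdj Γ v w' := by
    intro u a b c
    rcases h4 (L.nextF Γ w) (L.nextF Γ v) (L.f u) (L.nextF Γ w') z h.1.symm (low_hom b).symm h'.1
      hw.1 (low_hom a).symm (low_hom c) hw'.1 hv.1.symm with e | e | e | e
    · exact fin (Or.inl e)
    · exact absurd e (noeq hv a)
    · exact fin (Or.inr e)
    · exact absurd e.symm (noadj hv a)
  obtain ⟨h1, u, a, b⟩ := id h
  obtain ⟨h1', u', b', c'⟩ := id h'
  rcases I.low_low b b' with rfl | hu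
  · exact common u a b c'
  rcases h5 (L.nextF Γ w) (L.nextF Γ v) (L.f u) (L.f u') (L.nextF Γ w') z h.1.symm (low_hom b).symm
    (low_hom b').symm h'.1 hw.1 (low_hom a).symm (I.hom hu) (low_hom c') hw'.1 hv.1.symm with
    (e | e) | (e | e) | (e | e) | (e | e) | (e | e)
  · exact absurd e (I.adj_low_ne (nextAdj_symm h) b')
  · exact common u' (I.adj_low (nextAdj_symm h) b' e.symm) b' c'
  · exact absurd e.symm (I.adj_low_ne h' b)
  · exact common u a b (I.adj_low h' b e)
  · exact absurd e (noeq hw' c')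
  · exact absurd e.symm (noadj hw' c')
  · exact fin (Or.inl e.symm)
  · exact fin (Or.inr e.symm)
  · exact absurd e.symm (noeq hv a)
  · exact absurd e (noadj hv a)

theorem Inv.next (I : L.Inv Γ)
    (h4 : ∀ z a b c d, Γ.Adj z a → Γ.Adj z b → Γ.Adj z c → Γ.Adj z d → Γ.Adj a b →
    Γ.Adj b c → Γ.Adj c d → Γ.Adj d a → a = c ∨ b = d ∨ Γ.Adj a c ∨ Γ.Adj b d)
    (h5 : ∀ z a b c d e, Γ.Adj z a → Γ.Adj z b → Γ.Adj z c → Γ.Adj z d → Γ.Adj z e →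
    Γ.Adj a b → Γ.Adj b c → Γ.Adj c d → Γ.Adj d e → Γ.Adj e a →
    (a = c ∨ Γ.Adj a c) ∨ (b = d ∨ Γ.Adj b d) ∨ (c = e ∨ Γ.Adj c e) ∨ (d = a ∨ Γ.Adj d a) ∨
      (e = b ∨ Γ.Adj e b)) : (L.next Γ).Inv Γ := by
  have new_adj : ∀ {v w : L.NextT Γ} {y}, L.nextAdj Γ v w → y ∈ (L.next Γ).new Γ v →
      Γ.Adj y (L.nextF Γ w) → y ∈ (L.next Γ).new Γ w := by
    rintro v w y h hy hyw
    refine ⟨hyw.symm, ?_⟩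
    rintro (⟨u, hu, rfl⟩ | ⟨x, hx, rfl⟩)
    · exact hy.2 (Or.inl ⟨u, I.adj_low (nextAdj_symm h) hu hy.1.symm, rfl⟩)
    · exact hy.2 (Or.inr ⟨x, I.next_tri h4 (nextAdj_symm h) hx hy.1, rfl⟩)
  refine ⟨nextAdj_symm, fun h => h.1, fun {v w} h => Or.inr ⟨w, h, rfl⟩, ?_, new_adj,
    I.next_new_trans h4 h5, I.next_inj, I.next_tri h4⟩
  rintro v y z hy (⟨u, hu, rfl⟩ | ⟨x, hx, rfl⟩) hzy
  · exact absurd (I.low_old hu hy.1.symm hzy.symm) hy.2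
  · exact ⟨x, hx, rfl, new_adj hx hy hzy.symm⟩

end Layer

/-- A layered covering of a graph, with prescribed bottom layer `C`. -/
structure LayeredCover {V : Type u} (Γ : SimpleGraph V) (C : Set V) where
  T : Type u
  F : T → V
  adj : T → T → Prop
  lev : T → ℕ
  base : C → T
  symm : ∀ {v w}, adj v w → adj w v
  hom : ∀ {v w}, adj v w → Γ.Adj (F v) (F w)
  lift : ∀ v y, Γ.Adj (F v) y → ∃ w, adj v w ∧ F w = y
  inj : ∀ {v w w'}, adj v w → adj v w' → F w = F w' → w = w'
  tri : ∀ {v w w'}, adj v w → adj v w' → Γ.Adj (F w) (F w') → adj w w'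
  F_base : ∀ c, F (base c) = c
  lev_base : ∀ c, lev (base c) = 0
  eq_base : ∀ v, lev v = 0 → ∃ c, v = base c
  adj_base : ∀ c c' : C, Γ.Adj (c : V) c' → adj (base c) (base c')
  lev_le : ∀ {v w}, adj v w → lev v ≤ lev w + 1
  lower : ∀ v n, lev v = n + 1 → ∃ w, adj v w ∧ lev w = n
  lower_unique : ∀ {v w w'}, adj v w → adj v w' → lev v = lev w + 1 → lev v = lev w' + 1 →
    w = w' ∨ adj w w'
  common : ∀ {v w n}, adj v w → lev v = n + 1 → lev w = n + 1 →
    ∃ u, adj v u ∧ adj w u ∧ lev u = n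

section Construction

variable {V : Type u} (Γ : SimpleGraph V) (C : Set V)

/-- The bottom layer. -/
def Layer.bot : Layer V where
  T := C
  f := Subtype.val
  adj c c' := Γ.Adj (c : V) c'
  old c := {z | Γ.Adj (c : V) z ∧ z ∈ C}

/-- The layers over `C`. -/
def Layer.seq : ℕ → Layer V
  | 0 => Layer.bot Γ C
  | n + 1 => (Layer.seq n).next Γ

/-- Adjacency in the union of all layers. -/
inductive Layer.SAdj : (Σ n, (Layer.seq Γ C n).T) → (Σ n, (Layer.seq Γ C n).T) → Prop
  | same (n : ℕ) (a b : (Layer.seq Γ C n).T) : (Layer.seq Γ C n).adj a b →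
      Layer.SAdj ⟨n, a⟩ ⟨n, b⟩
  | up (n : ℕ) (a : (Layer.seq Γ C n).T) (b : (Layer.seq Γ C (n + 1)).T) :
      (Layer.seq Γ C n).low Γ a b → Layer.SAdj ⟨n, a⟩ ⟨n + 1, b⟩
  | down (n : ℕ) (a : (Layer.seq Γ C n).T) (b : (Layer.seq Γ C (n + 1)).T) :
      (Layer.seq Γ C n).low Γ a b → Layer.SAdj ⟨n + 1, b⟩ ⟨n, a⟩

variable {Γ C}

theorem Layer.bot_inv (h0 : ∀ c c' c'' y, c ∈ C → c' ∈ C → c'' ∈ C → y ∉ C → Γ.Adj c c' →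
    Γ.Adj c' c'' → Γ.Adj c y → Γ.Adj c' y → Γ.Adj c'' y → c = c'' ∨ Γ.Adj c c'') :
    (Layer.bot Γ C).Inv Γ where
  symm h := h.symm
  hom h := h
  adj_old {_ w} h := ⟨h, w.2⟩
  old_step {_ _ z} h1 h2 h3 :=
    ⟨⟨z, h2.2⟩, h2.1, rfl, h3, fun h => h1.2 ⟨h1.1, h.2⟩⟩
  new_adj _ h2 h3 := ⟨h3.symm, fun h => h2.2 ⟨h2.1, h.2⟩⟩
  new_trans {u v w y} h1 h2 h3 h4 h5 :=
    (h0 u.1 v.1 w.1 y u.2 v.2 w.2 (fun h => h3.2 ⟨h3.1, h⟩) h1 h2 h3.1 h4.1 h5.1).imp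
      Subtype.ext id
  inj _ _ h := Subtype.ext h
  tri _ _ h := h

theorem nonempty_layeredCover
    (h4 : ∀ z a b c d, Γ.Adj z a → Γ.Adj z b → Γ.Adj z c → Γ.Adj z d → Γ.Adj a b →
      Γ.Adj b c → Γ.Adj c d → Γ.Adj d a → a = c ∨ b = d ∨ Γ.Adj a c ∨ Γ.Adj b d)
    (h5 : ∀ z a b c d e, Γ.Adj z a → Γ.Adj z b → Γ.Adj z c → Γ.Adj z d → Γ.Adj z e →
      Γ.Adj a b → Γ.Adj b c → Γ.Adj c d → Γ.Adj d e → Γ.Adj e a →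
      (a = c ∨ Γ.Adj a c) ∨ (b = d ∨ Γ.Adj b d) ∨ (c = e ∨ Γ.Adj c e) ∨ (d = a ∨ Γ.Adj d a) ∨
        (e = b ∨ Γ.Adj e b))
    (h0 : ∀ c c' c'' y, c ∈ C → c' ∈ C → c'' ∈ C → y ∉ C → Γ.Adj c c' →
      Γ.Adj c' c'' → Γ.Adj c y → Γ.Adj c' y → Γ.Adj c'' y → c = c'' ∨ Γ.Adj c c'') :
    Nonempty (LayeredCover Γ C) := by
  have I : ∀ n, (Layer.seq Γ C n).Inv Γ := by
    intro n
    induction n with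
    | zero => exact Layer.bot_inv h0
    | succ n ih => exact ih.next h4 h5
  have hsymm : ∀ {v w}, Layer.SAdj Γ C v w → Layer.SAdj Γ C w v := by
    rintro _ _ (⟨n, a, b, h⟩ | ⟨n, a, b, h⟩ | ⟨n, a, b, h⟩)
    · exact .same _ _ _ ((I n).symm h)
    · exact .down _ _ _ h
    · exact .up _ _ _ h
  refine ⟨⟨_, fun v => (Layer.seq Γ C v.1).f v.2, Layer.SAdj Γ C, fun v => v.1, fun c => ⟨0, c⟩,
    hsymm, ?_, ?_, ?_, ?_, fun _ => rfl, fun _ => rfl, ?_, ?_, ?_, ?_, ?_, ?_⟩⟩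
  · rintro _ _ (⟨n, a, b, h⟩ | ⟨n, a, b, h⟩ | ⟨n, a, b, h⟩)
    · exact (I n).hom h
    · exact Layer.low_hom h
    · exact (Layer.low_hom h).symm
  · rintro ⟨n, v⟩ y hy
    by_cases hn : y ∈ (Layer.seq Γ C n).new Γ v
    · exact ⟨_, .up n v _ (Layer.low_mk hn), rfl⟩
    have ho : y ∈ (Layer.seq Γ C n).old v := by
      by_contra h
      exact hn ⟨hy, h⟩
    cases n with
    | zero => exact ⟨⟨0, ⟨y, ho.2⟩⟩, .same 0 _ _ ho.1, rfl⟩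
    | succ n =>
      rcases ho with ⟨u, hu, e⟩ | ⟨x, hx, e⟩
      · exact ⟨_, .down n _ _ hu, e⟩
      · exact ⟨_, .same (n + 1) _ _ hx, e⟩
  · rintro _ _ _ (⟨n, a, b, h⟩ | ⟨n, a, b, h⟩ | ⟨n, a, b, h⟩) h' e
    · rcases h' with (⟨_, _, b', h'⟩ | ⟨_, _, b', h'⟩ | ⟨m, b', _, h'⟩)
      · rw [(I n).inj h h' e]
      · have hh := (I n).adj_old h
        rw [show (Layer.seq Γ C n).f b = _ from e] at hh
        exact absurd hh (Layer.low_new h').2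
      · exact absurd e ((I m).adj_low_ne h h')
    · rcases h' with (⟨_, _, b', h'⟩ | ⟨_, _, b', h'⟩ | ⟨m, b', _, h'⟩)
      · have hh := (I n).adj_old h'
        rw [show (Layer.seq Γ C n).f b' = _ from e.symm] at hh
        exact absurd hh (Layer.low_new h).2
      · rw [Layer.low_inj h h' e]
      · exact absurd (Or.inl ⟨_, h', e.symm⟩) (Layer.low_new h).2
    · rcases h' with (⟨_, _, b', h'⟩ | ⟨_, _, b', h'⟩ | ⟨m, b', _, h'⟩)
      · exact absurd e.symm ((I n).adj_low_ne h' h)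
      · exact absurd (Or.inl ⟨_, h, e⟩) (Layer.low_new h').2
      · rcases (I n).low_low h h' with rfl | hh
        · rfl
        · exact absurd e ((I n).hom hh).ne
  · rintro _ _ _ (⟨n, a, b, h⟩ | ⟨n, a, b, h⟩ | ⟨n, a, b, h⟩) h' e
    · rcases h' with (⟨_, _, b', h'⟩ | ⟨_, _, b', h'⟩ | ⟨m, b', _, h'⟩)
      · exact .same _ _ _ ((I n).tri h h' e)
      · exact .up _ _ _ (Layer.low_transfer h' h ((I n).new_adj h (Layer.low_new h') e.symm))
      · exact .down _ _ _ ((I m).adj_low h h' e.symm)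
    · rcases h' with (⟨_, _, b', h'⟩ | ⟨_, _, b', h'⟩ | ⟨m, b', _, h'⟩)
      · exact .down _ _ _ (Layer.low_transfer h h' ((I n).new_adj h' (Layer.low_new h) e))
      · exact .same _ _ _ ⟨e, _, h, h'⟩
      · exact absurd ((I m).low_old h' (Layer.low_hom h).symm e) (Layer.low_new h).2
    · rcases h' with (⟨_, _, b', h'⟩ | ⟨_, _, b', h'⟩ | ⟨m, b', _, h'⟩)
      · exact .up _ _ _ ((I n).adj_low h' h e)
      · exact absurd ((I n).low_old h (Layer.low_hom h').symm e.symm) (Layer.low_new h').2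
      · rcases (I n).low_low h h' with rfl | hh
        · exact absurd rfl e.ne
        · exact .same _ _ _ hh
  · rintro ⟨n, v⟩ (rfl : n = 0)
    exact ⟨v, rfl⟩
  · intro c c' h
    exact .same 0 _ _ h
  · rintro _ _ (⟨n, a, b, h⟩ | ⟨n, a, b, h⟩ | ⟨n, a, b, h⟩) <;> dsimp only <;> omega
  · rintro ⟨_, v⟩ n (rfl : _ = n + 1)
    obtain ⟨u, hu⟩ := Layer.low_exists v
    exact ⟨_, .down n u v hu, rfl⟩
  · rintro _ _ _ (⟨n, a, b, h⟩ | ⟨n, a, b, h⟩ | ⟨n, a, b, h⟩) h' e e'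
    · dsimp only at e; omega
    · dsimp only at e; omega
    · rcases h' with (⟨_, _, b', h'⟩ | ⟨_, _, b', h'⟩ | ⟨m, b', _, h'⟩)
      · dsimp only at e'; omega
      · dsimp only at e'; omega
      · rcases (I n).low_low h h' with rfl | hh
        · exact Or.inl rfl
        · exact Or.inr (.same _ _ _ hh)
  · rintro _ _ m (⟨n, a, b, h⟩ | ⟨n, a, b, h⟩ | ⟨n, a, b, h⟩) e e'
    · obtain rfl : n = m + 1 := e
      obtain ⟨-, u, hu, hu'⟩ := h
      exact ⟨_, .down _ _ _ hu, .down _ _ _ hu', rfl⟩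
    · dsimp only at e e'; omega
    · dsimp only at e e'; omega

end Construction

/-- A group with a generating family satisfying the combinatorial properties of large type Artin
groups which are used below. -/
structure LargeGroup (G S : Type u) [Group G] where
  gen : S → G
  fin : S → S → Prop
  fin_symm : ∀ {a b}, fin a b → fin b a
  fin_ne : ∀ {a b}, fin a b → a ≠ b
  closure_eq : Subgroup.closure (Set.range gen) = ⊤
  pow_mem : ∀ {a : S} {X : Set S} {k : ℤ}, gen a ^ k ∈ Subgroup.closure (gen '' X) → k ≠ 0 → a ∈ X
  alternating : ∀ {a b : S} {i j k l : ℤ}, a ≠ b →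
    gen a ^ i * gen b ^ j * gen a ^ k * gen b ^ l = 1 → i = 0 ∨ j = 0 ∨ k = 0 ∨ l = 0
  pair_root : ∀ {a b : S} {g : G} {n : ℕ}, fin a b → g ∈ Subgroup.closure (gen '' {a, b}) →
    n ≠ 0 → g ^ n ∈ Subgroup.zpowers (gen a) → g ∈ Subgroup.zpowers (gen a)
  exists_degree : ∃ d : G →* Multiplicative ℤ, ∀ s, d (gen s) = Multiplicative.ofAdd 1
  exists_hom : ∀ (Ω : Type u) (π : Ω → G) (τ : S → Equiv.Perm Ω),
    (∀ s ω, π (τ s ω) = π ω * (gen s)⁻¹) →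
    (∀ a b, fin a b → ∃ E : Ω → Ω → Prop, (∀ ω, E ω ω) ∧
      (∀ ω ω' s, s = a ∨ s = b → E ω ω' → E ω (τ s ω') ∧ E ω ((τ s).symm ω')) ∧
      (∀ ω ω', E ω ω' → π ω = π ω' → ω = ω')) →
    ∃ φ : G →* Equiv.Perm Ω, ∀ s, φ (gen s) = τ s

namespace LargeGroup

variable {G S : Type u} [Group G] (D : LargeGroup G S)

/-- Standard parabolic subgroups. -/
def H (X : Set S) : Subgroup G := Subgroup.closure (D.gen '' X)

variable {D}

theorem gen_mem {X : Set S} {a : S} (h : a ∈ X) : D.gen a ∈ D.H X :=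
  Subgroup.subset_closure ⟨a, h, rfl⟩

theorem gen_zpow_mem {X : Set S} {a : S} (h : a ∈ X) (k : ℤ) : D.gen a ^ k ∈ D.H X :=
  zpow_mem (gen_mem h) k

theorem H_mono {X Y : Set S} (h : X ⊆ Y) : D.H X ≤ D.H Y :=
  Subgroup.closure_mono (Set.image_mono h)

theorem mem_of_zpow {X : Set S} {a : S} {k : ℤ} (h : D.gen a ^ k ∈ D.H X) (hk : k ≠ 0) : a ∈ X :=
  D.pow_mem h hk

theorem zpow_ne_one {a : S} {k : ℤ} (hk : k ≠ 0) : D.gen a ^ k ≠ 1 := fun h =>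
  (mem_of_zpow (D := D) (X := ∅) (k := k) (h ▸ one_mem _) hk).elim

theorem letter_eq {a b : S} {k l : ℤ} (h : D.gen a ^ k = D.gen b ^ l) (hk : k ≠ 0) : a = b :=
  mem_of_zpow (D := D) (X := {b}) (by rw [h]; exact gen_zpow_mem (Set.mem_singleton b) l) hk

theorem triangle {a b c : S} {i j k : ℤ} (hi : i ≠ 0) (hj : j ≠ 0) (hk : k ≠ 0)
    (h : D.gen a ^ i * D.gen b ^ j = D.gen c ^ k) : a = b := by
  by_contra hab
  have hc : c = a ∨ c = b := by
    refine mem_of_zpow (D := D) (X := {a, b}) (k := k) ?_ hk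
    rw [← h]
    exact mul_mem (gen_zpow_mem (by simp) _) (gen_zpow_mem (by simp) _)
  rcases hc with rfl | rfl
  · refine hab (letter_eq (D := D) (k := j) (l := k - i) ?_ hj).symm
    rw [sub_eq_neg_add, zpow_add, ← h]
    group
  · refine hab (letter_eq (D := D) (k := i) (l := k - j) ?_ hi)
    rw [zpow_sub, ← h]
    group

variable (D)

/-- Translates of standard parabolic subgroups on two letters generating a dihedral group. -/
abbrev Block : Type u :=
  {B : Set G // ∃ (g : G) (a b : S), D.fin a b ∧ B = g • (D.H {a, b} : Set G)}

/-- Vertices of the graph: group elements and blocks. -/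
abbrev Vert : Type u := G ⊕ D.Block

/-- Adjacency of group elements. -/
def gAdj (g h : G) : Prop := ∃ (a : S) (k : ℤ), k ≠ 0 ∧ h = g * D.gen a ^ k

variable {D}

theorem gAdj_symm {g h : G} (hgh : D.gAdj g h) : D.gAdj h g := by
  obtain ⟨a, k, hk, rfl⟩ := hgh
  exact ⟨a, -k, neg_ne_zero.2 hk, by group⟩

theorem gAdj_ne {g h : G} (hgh : D.gAdj g h) : g ≠ h := by
  obtain ⟨a, k, hk, rfl⟩ := hgh
  intro h
  exact zpow_ne_one hk (mul_eq_left.1 h.symm)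

theorem gAdj_or {g h : G} {a : S} {k : ℤ} (e : h = g * D.gen a ^ k) : g = h ∨ D.gAdj g h := by
  by_cases hk : k = 0
  · left; simp [e, hk]
  · exact Or.inr ⟨a, k, hk, e⟩

theorem mem_coset_iff {g h : G} {X : Set S} : h ∈ g • (D.H X : Set G) ↔ g⁻¹ * h ∈ D.H X := by
  rw [Set.mem_smul_set_iff_inv_smul_mem]; rfl

theorem coset_eq {g h : G} {X : Set S} (hh : h ∈ g • (D.H X : Set G)) :
    g • (D.H X : Set G) = h • (D.H X : Set G) := by
  ext x
  rw [mem_coset_iff] at *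
  rw [mem_coset_iff]
  constructor
  · intro h1
    have := mul_mem (inv_mem hh) h1
    simpa [mul_assoc] using this
  · intro h1
    have := mul_mem hh h1
    simpa [mul_assoc] using this

theorem self_mem_coset {g : G} {X : Set S} : g ∈ g • (D.H X : Set G) := by
  rw [mem_coset_iff]; simp

theorem block_eq (B : D.Block) {g : G} (hg : g ∈ B.1) :
    ∃ a b, D.fin a b ∧ B.1 = g • (D.H {a, b} : Set G) := by
  obtain ⟨_, h, a, b, hab, rfl⟩ := B
  exact ⟨a, b, hab, coset_eq hg⟩

theorem block_nonempty (B : D.Block) : ∃ g, g ∈ B.1 := by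
  obtain ⟨_, h, a, b, hab, rfl⟩ := B
  exact ⟨h, self_mem_coset⟩

variable (D)

/-- The block through an element. -/
def blk (g : G) {a b : S} (hab : D.fin a b) : D.Block :=
  ⟨g • (D.H {a, b} : Set G), g, a, b, hab, rfl⟩

/-- Adjacency of vertices. -/
def vAdj : D.Vert → D.Vert → Prop
  | .inl g, .inl h => D.gAdj g h
  | .inl g, .inr B => g ∈ B.1
  | .inr B, .inl g => g ∈ B.1
  | .inr _, .inr _ => False

/-- The graph of group elements and blocks. -/
def graph : SimpleGraph D.Vert where
  Adj := D.vAdj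
  symm := ⟨by
    rintro (g | g) (h | h) H
    · exact gAdj_symm H
    · exact H
    · exact H
    · exact H⟩
  loopless := ⟨by
    rintro (g | g) H
    · exact gAdj_ne H rfl
    · exact H⟩

/-- The vertices of the subgraph of a standard parabolic subgroup. -/
def base (X : Set S) : Set D.Vert :=
  {v | match v with
    | .inl g => g ∈ D.H X
    | .inr B => B.1 ⊆ D.H X}

variable {D}

theorem adj_gb {g : G} {B : D.Block} : D.graph.Adj (.inl g) (.inr B) ↔ g ∈ B.1 := Iff.rfl
theorem adj_bg {g : G} {B : D.Block} : D.graph.Adj (.inr B) (.inl g) ↔ g ∈ B.1 := Iff.rfl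
theorem adj_bb {B B' : D.Block} : ¬ D.graph.Adj (.inr B) (.inr B') := id

/-- Membership of a power in a block through the base point determines the letter. -/
theorem letter_of_mem {g : G} {a b c : S} {k : ℤ} (hk : k ≠ 0)
    (h : g * D.gen c ^ k ∈ g • (D.H {a, b} : Set G)) : c = a ∨ c = b := by
  rw [mem_coset_iff] at h
  exact mem_of_zpow (X := {a, b}) (k := k) (by simpa using h) hk

theorem mul_mem_coset {g : G} {X : Set S} {c : S} (hc : c ∈ X) (k : ℤ) :
    g * D.gen c ^ k ∈ g • (D.H X : Set G) := by
  rw [mem_coset_iff]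
  simpa using gen_zpow_mem hc k

/-- Elements of a common coset of a cyclic subgroup lie in the same blocks. -/
theorem mem_block_of {B : D.Block} {g : G} {c : S} {k : ℤ} (hg : g ∈ B.1) (hk : k ≠ 0)
    (h : g * D.gen c ^ k ∈ B.1) (l : ℤ) : g * D.gen c ^ l ∈ B.1 := by
  obtain ⟨a, b, hab, e⟩ := block_eq B hg
  rw [e] at h ⊢
  exact mul_mem_coset (D := D) (X := {a, b}) (letter_of_mem hk h) l

/-- Two blocks sharing two different cosets of cyclic subgroups coincide. -/
theorem block_unique {B B' : D.Block} {g : G} {s t : S} {i j : ℤ} (hst : s ≠ t) (hi : i ≠ 0)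
    (hj : j ≠ 0) (hg : g ∈ B.1) (hg' : g ∈ B'.1) (h1 : g * D.gen s ^ i ∈ B.1)
    (h1' : g * D.gen s ^ i ∈ B'.1) (h2 : g * D.gen t ^ j ∈ B.1) (h2' : g * D.gen t ^ j ∈ B'.1) :
    B = B' := by
  obtain ⟨a, b, hab, e⟩ := block_eq B hg
  obtain ⟨a', b', hab', e'⟩ := block_eq B' hg'
  have aux : ∀ a b : S, s = a ∨ s = b → t = a ∨ t = b → ({a, b} : Set S) = {s, t} := by
    rintro a b (rfl | rfl) (rfl | rfl)
    · exact absurd rfl hst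
    · rfl
    · exact Set.pair_comm _ _
    · exact absurd rfl hst
  rw [e] at h1 h2
  rw [e'] at h1' h2'
  apply Subtype.ext
  rw [e, e', aux a b (letter_of_mem hi h1) (letter_of_mem hj h2),
    aux a' b' (letter_of_mem hi h1') (letter_of_mem hj h2')]

theorem same_letter {z p q : G} {s t : S} {i j : ℤ} (hi : i ≠ 0) (hj : j ≠ 0)
    (hp : p = z * D.gen s ^ i) (hq : q = z * D.gen t ^ j) (h : D.gAdj p q) : s = t := by
  obtain ⟨c, k, hk, e⟩ := h
  rw [hp, hq, mul_assoc] at e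
  have e := mul_left_cancel e
  refine triangle (D := D) (i := -i) (j := j) (c := c) (k := k) (neg_ne_zero.2 hi) hj hk ?_
  rw [e]
  group

theorem eq_or_adj_of_same {z p q : G} {s : S} {i j : ℤ} (hp : p = z * D.gen s ^ i)
    (hq : q = z * D.gen s ^ j) : p = q ∨ D.gAdj p q := by
  refine gAdj_or (a := s) (k := j - i) ?_
  rw [hp, hq]
  group

/-- Two adjacent group elements in the link of a group element have the same neighbours there. -/
theorem link_elt {z p q : G} {r : D.Vert} (hp : D.gAdj z p) (hq : D.gAdj z q)
    (hr : D.graph.Adj (.inl z) r) (hpq : D.gAdj p q) (hqr : D.graph.Adj (.inl q) r) :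
    .inl p = r ∨ D.graph.Adj (.inl p) r := by
  obtain ⟨s, i, hi, ep⟩ := hp
  obtain ⟨t, j, hj, eq⟩ := hq
  obtain rfl := same_letter hi hj ep eq hpq
  rcases r with r | B
  · obtain ⟨t, k, hk, er⟩ := hr
    obtain rfl := same_letter hj hk eq er hqr
    exact (eq_or_adj_of_same ep er).imp (congrArg _) id
  · right
    change p ∈ B.1
    change q ∈ B.1 at hqr
    rw [eq] at hqr
    rw [ep]
    exact mem_block_of hr hj hqr i

theorem link_block_letter {B : D.Block} {p q : G} {a b : S} {z : G}
    (e : B.1 = z • (D.H {a, b} : Set G)) (hp : p ∈ B.1) (hq : q ∈ B.1)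
    (h : D.gAdj p q) : ∃ i : ℤ, i ≠ 0 ∧ (q = p * D.gen a ^ i ∨ q = p * D.gen b ^ i) := by
  obtain ⟨c, k, hk, rfl⟩ := h
  rw [e, coset_eq (e ▸ hp : p ∈ z • (D.H {a, b} : Set G))] at hq
  rcases letter_of_mem hk hq with rfl | rfl
  · exact ⟨k, hk, Or.inl rfl⟩
  · exact ⟨k, hk, Or.inr rfl⟩

theorem graph_four (z a b c d : D.Vert) (za : D.graph.Adj z a) (zb : D.graph.Adj z b)
    (zc : D.graph.Adj z c) (zd : D.graph.Adj z d) (ab : D.graph.Adj a b) (bc : D.graph.Adj b c)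
    (cd : D.graph.Adj c d) (da : D.graph.Adj d a) :
    a = c ∨ b = d ∨ D.graph.Adj a c ∨ D.graph.Adj b d := by
  rcases z with z | Z
  · have key : ∀ {a b c : D.Vert}, D.graph.Adj (.inl z) a → D.graph.Adj (.inl z) b →
        D.graph.Adj (.inl z) c → D.graph.Adj a b → D.graph.Adj b c → a.isLeft → b.isLeft →
        a = c ∨ D.graph.Adj a c := by
      rintro (a | a) (b | b) c za zb zc ab bc ha hb
      · exact link_elt za zb zc ab bc
      · cases hb
      · cases ha
      · cases ha
    have alt : ∀ {p r : G} {B B' : D.Block}, D.gAdj z p → D.gAdj z r → z ∈ B.1 → z ∈ B'.1 →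
        p ∈ B.1 → p ∈ B'.1 → r ∈ B.1 → r ∈ B'.1 → (p = r ∨ D.gAdj p r) ∨ B = B' := by
      rintro p r B B' ⟨s, i, hi, rfl⟩ ⟨t, j, hj, rfl⟩ h1 h2 h3 h4 h5 h6
      by_cases hst : s = t
      · subst hst
        exact Or.inl (eq_or_adj_of_same rfl rfl)
      · exact Or.inr (block_unique hst hi hj h1 h2 h3 h4 h5 h6)
    by_cases h1 : a.isLeft ∧ b.isLeft
    · rcases key za zb zc ab bc h1.1 h1.2 with h | h <;> simp [h]
    by_cases h2 : b.isLeft ∧ c.isLeft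
    · rcases key zb zc zd bc cd h2.1 h2.2 with h | h <;> simp [h]
    rcases a with a | a <;> rcases b with b | b
    · simp at h1
    · rcases c with c | c
      · rcases d with d | d
        · rcases key zc zd za cd da rfl rfl with h | h
          · exact Or.inl h.symm
          · exact Or.inr (Or.inr (Or.inl h.symm))
        · rcases alt za zc zb zd ab da bc cd with (h | h) | h
          · exact Or.inl (congrArg _ h)
          · exact Or.inr (Or.inr (Or.inl h))
          · exact Or.inr (Or.inl (congrArg _ h))
      · exact bc.elim
    · rcases c with c | c
      · simp at h2
      · rcases d with d | d
        · rcases alt zb zd za zc ab bc da cd with (h | h) | h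
          · exact Or.inr (Or.inl (congrArg _ h))
          · exact Or.inr (Or.inr (Or.inr h))
          · exact Or.inl (congrArg _ h)
        · exact cd.elim
    · exact ab.elim
  · rcases a with a | a
    swap
    · exact za.elim
    rcases b with b | b
    swap
    · exact zb.elim
    rcases c with c | c
    swap
    · exact zc.elim
    rcases d with d | d
    swap
    · exact zd.elim
    obtain ⟨_, g, s, t, hst, e⟩ := id Z
    obtain ⟨s, t, hst, e⟩ := block_eq Z za
    have same : ∀ {x y z : G} {c : S} {i j : ℤ}, y = x * D.gen c ^ i → z = y * D.gen c ^ j →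
        (.inl x : D.Vert) = .inl z ∨ D.graph.Adj (.inl x) (.inl z) := by
      intro x y z c i j h1 h2
      refine (gAdj_or (D := D) (g := x) (h := z) (a := c) (k := i + j) ?_).imp (congrArg _) id
      rw [h2, h1, zpow_add, mul_assoc]
    obtain ⟨i, hi, h1⟩ := link_block_letter e za zb ab
    obtain ⟨j, hj, h2⟩ := link_block_letter e zb zc bc
    obtain ⟨k, hk, h3⟩ := link_block_letter e zc zd cd
    obtain ⟨l, hl, h4⟩ := link_block_letter e zd za da
    have no : ∀ {s t : S}, s ≠ t → b = a * D.gen s ^ i → c = b * D.gen t ^ j →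
        d = c * D.gen s ^ k → a = d * D.gen t ^ l → False := by
      intro s t hst h1 h2 h3 h4
      have : D.gen s ^ i * D.gen t ^ j * D.gen s ^ k * D.gen t ^ l = 1 := by
        rw [h3, h2, h1] at h4
        have h5 : a * (D.gen s ^ i * D.gen t ^ j * D.gen s ^ k * D.gen t ^ l) = a := by
          simpa [mul_assoc] using h4.symm
        exact mul_eq_left.1 h5
      rcases D.alternating hst this with h | h | h | h <;> contradiction
    rcases h1 with h1 | h1 <;> rcases h2 with h2 | h2
    · rcases same h1 h2 with h | h <;> simp [h]
    · rcases h3 with h3 | h3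
      · rcases h4 with h4 | h4
        · rcases same h3 h4 with h | h
          · exact Or.inl h.symm
          · exact Or.inr (Or.inr (Or.inl h.symm))
        · exact (no (D.fin_ne hst) h1 h2 h3 h4).elim
      · rcases same h2 h3 with h | h <;> simp [h]
    · rcases h3 with h3 | h3
      · rcases same h2 h3 with h | h <;> simp [h]
      · rcases h4 with h4 | h4
        · exact (no (D.fin_ne hst).symm h1 h2 h3 h4).elim
        · rcases same h3 h4 with h | h
          · exact Or.inl h.symm
          · exact Or.inr (Or.inr (Or.inl h.symm))
    · rcases same h1 h2 with h | h <;> simp [h]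

theorem graph_five (z a b c d e : D.Vert) (za : D.graph.Adj z a) (zb : D.graph.Adj z b)
    (zc : D.graph.Adj z c) (zd : D.graph.Adj z d) (ze : D.graph.Adj z e) (ab : D.graph.Adj a b)
    (bc : D.graph.Adj b c) (cd : D.graph.Adj c d) (de : D.graph.Adj d e) (ea : D.graph.Adj e a) :
    (a = c ∨ D.graph.Adj a c) ∨ (b = d ∨ D.graph.Adj b d) ∨ (c = e ∨ D.graph.Adj c e) ∨
      (d = a ∨ D.graph.Adj d a) ∨ (e = b ∨ D.graph.Adj e b) := by
  rcases z with z | Z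
  · have key : ∀ {a b c : D.Vert}, D.graph.Adj (.inl z) a → D.graph.Adj (.inl z) b →
        D.graph.Adj (.inl z) c → D.graph.Adj a b → D.graph.Adj b c → a.isLeft → b.isLeft →
        a = c ∨ D.graph.Adj a c := by
      rintro (a | a) (b | b) c za zb zc ab bc ha hb
      · exact link_elt za zb zc ab bc
      · cases hb
      · cases ha
      · cases ha
    by_cases h1 : a.isLeft ∧ b.isLeft
    · exact Or.inl (key za zb zc ab bc h1.1 h1.2)
    by_cases h2 : b.isLeft ∧ c.isLeft
    · exact Or.inr (Or.inl (key zb zc zd bc cd h2.1 h2.2))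
    by_cases h3 : c.isLeft ∧ d.isLeft
    · exact Or.inr (Or.inr (Or.inl (key zc zd ze cd de h3.1 h3.2)))
    by_cases h4 : d.isLeft ∧ e.isLeft
    · exact Or.inr (Or.inr (Or.inr (Or.inl (key zd ze za de ea h4.1 h4.2))))
    by_cases h5 : e.isLeft ∧ a.isLeft
    · exact Or.inr (Or.inr (Or.inr (Or.inr (key ze za zb ea ab h5.1 h5.2))))
    exfalso
    rcases a with a | a <;> rcases b with b | b <;> rcases c with c | c <;> rcases d with d | d <;>
      rcases e with e | e <;> first
        | exact ab.elim
        | exact bc.elim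
        | exact cd.elim
        | exact de.elim
        | exact ea.elim
        | simp at h1 h2 h3 h4 h5
  · rcases a with a | a
    swap
    · exact za.elim
    rcases b with b | b
    swap
    · exact zb.elim
    rcases c with c | c
    swap
    · exact zc.elim
    rcases d with d | d
    swap
    · exact zd.elim
    rcases e with e | e
    swap
    · exact ze.elim
    obtain ⟨s, t, hst, he⟩ := block_eq Z za
    have same : ∀ {x y z : G} {c : S} {i j : ℤ}, y = x * D.gen c ^ i → z = y * D.gen c ^ j →
        (.inl x : D.Vert) = .inl z ∨ D.graph.Adj (.inl x) (.inl z) := by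
      intro x y z c i j h1 h2
      refine (gAdj_or (D := D) (g := x) (h := z) (a := c) (k := i + j) ?_).imp (congrArg _) id
      rw [h2, h1, zpow_add, mul_assoc]
    obtain ⟨i, hi, h1⟩ := link_block_letter he za zb ab
    obtain ⟨j, hj, h2⟩ := link_block_letter he zb zc bc
    obtain ⟨k, hk, h3⟩ := link_block_letter he zc zd cd
    obtain ⟨l, hl, h4⟩ := link_block_letter he zd ze de
    obtain ⟨m, hm, h5⟩ := link_block_letter he ze za ea
    rcases h1 with h1 | h1 <;> rcases h2 with h2 | h2
    · exact Or.inl (same h1 h2)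
    · rcases h3 with h3 | h3
      · rcases h4 with h4 | h4
        · exact Or.inr (Or.inr (Or.inl (same h3 h4)))
        · rcases h5 with h5 | h5
          · exact Or.inr (Or.inr (Or.inr (Or.inr (same h5 h1))))
          · exact Or.inr (Or.inr (Or.inr (Or.inl (same h4 h5))))
      · exact Or.inr (Or.inl (same h2 h3))
    · rcases h3 with h3 | h3
      · exact Or.inr (Or.inl (same h2 h3))
      · rcases h4 with h4 | h4
        · rcases h5 with h5 | h5
          · exact Or.inr (Or.inr (Or.inr (Or.inl (same h4 h5))))
          · exact Or.inr (Or.inr (Or.inr (Or.inr (same h5 h1))))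
        · exact Or.inr (Or.inr (Or.inl (same h3 h4)))
    · exact Or.inl (same h1 h2)

theorem letter_mem_of_base {X : Set S} {g : G} {a : S} {k : ℤ} (hg : g ∈ D.H X) (hk : k ≠ 0)
    (h : g * D.gen a ^ k ∈ D.H X) : a ∈ X :=
  mem_of_zpow ((Subgroup.mul_mem_cancel_left _ hg).1 h) hk

theorem graph_base {X : Set S} (c c' c'' y : D.Vert) (hc : c ∈ D.base X) (hc' : c' ∈ D.base X)
    (hc'' : c'' ∈ D.base X) (hy : y ∉ D.base X) (h1 : D.graph.Adj c c') (h2 : D.graph.Adj c' c'')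
    (e1 : D.graph.Adj c y) (e2 : D.graph.Adj c' y) (e3 : D.graph.Adj c'' y) :
    c = c'' ∨ D.graph.Adj c c'' := by
  have two : ∀ p q r : G, p ∈ D.H X → q ∈ D.H X → r ∉ D.H X → D.gAdj p q → D.gAdj p r →
      ¬ D.gAdj q r := by
    rintro p q r hp hq hr ⟨a, i, hi, h⟩ ⟨b, j, hj, h'⟩ hqr
    obtain rfl := same_letter hi hj h h' hqr
    refine hr ?_
    rw [h'] at *
    exact mul_mem hp (gen_zpow_mem (letter_mem_of_base hp hi (h ▸ hq)) j)
  rcases y with y | Y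
  · exfalso
    rcases c' with c' | c'
    · rcases c with c | c
      · exact two c c' y hc hc' hy h1 e1 e2
      · exact hy (hc e1)
    · exact hy (hc' e2)
  · rcases c with c | c
    swap
    · exact e1.elim
    rcases c' with c' | c'
    swap
    · exact e2.elim
    rcases c'' with c'' | c''
    swap
    · exact e3.elim
    obtain ⟨a, b, hab, e⟩ := block_eq Y e2
    obtain ⟨s, i, hi, es⟩ := gAdj_symm h1
    obtain ⟨t, j, hj, et⟩ := h2
    have hs : s ∈ X := letter_mem_of_base hc' hi (es ▸ hc)
    have ht : t ∈ X := letter_mem_of_base hc' hj (et ▸ hc'')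
    by_cases hst : s = t
    · subst hst
      exact (eq_or_adj_of_same es et).imp (congrArg _) id
    · exfalso
      have h3 := letter_of_mem hi (es ▸ e ▸ e1 : c' * D.gen s ^ i ∈ c' • (D.H {a, b} : Set G))
      have h4 := letter_of_mem hj (et ▸ e ▸ e3 : c' * D.gen t ^ j ∈ c' • (D.H {a, b} : Set G))
      have hsub : ({a, b} : Set S) ⊆ X := by
        rintro x (rfl | rfl)
        · rcases h3 with rfl | rfl
          · exact hs
          · rcases h4 with rfl | rfl
            · exact ht
            · exact absurd rfl hst
        · rcases h3 with rfl | rfl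
          · rcases h4 with rfl | rfl
            · exact absurd rfl hst
            · exact ht
          · exact hs
      refine hy ?_
      change Y.1 ⊆ _
      rw [e]
      rintro x hx
      rw [mem_coset_iff] at hx
      have := mul_mem hc' (H_mono hsub hx)
      simpa using this

variable (D) in
theorem nonempty_cover (X : Set S) : Nonempty (LayeredCover D.graph (D.base X)) :=
  nonempty_layeredCover graph_four graph_five graph_base

end LargeGroup

namespace LargeGroup

variable {G S : Type u} [Group G] {D : LargeGroup G S}

/-- A distance-like function on the graph, vanishing on the subgraph of `X`. -/
structure Level (D : LargeGroup G S) (X : Set S) where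
  lev : D.Vert → ℕ
  zero_iff : ∀ v, lev v = 0 ↔ v ∈ D.base X
  le_succ : ∀ {v w}, D.graph.Adj v w → lev v ≤ lev w + 1
  lower : ∀ v n, lev v = n + 1 → ∃ w, D.graph.Adj v w ∧ lev w = n
  lower_unique : ∀ {v w w'}, D.graph.Adj v w → D.graph.Adj v w' → lev v = lev w + 1 →
    lev v = lev w' + 1 → w = w' ∨ D.graph.Adj w w'
  common : ∀ {v w n}, D.graph.Adj v w → lev v = n + 1 → lev w = n + 1 →
    ∃ u, D.graph.Adj v u ∧ D.graph.Adj w u ∧ lev u = n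

section Cover

variable {X : Set S} (K : LayeredCover D.graph (D.base X))

/-- The vertices of the cover above group elements. -/
abbrev Elts : Type u := {p : K.T × G // K.F p.1 = .inl p.2}

theorem exists_perm : ∃ τ : S → Equiv.Perm (Elts K), (∀ s ω, (τ s ω).1.2 = ω.1.2 * (D.gen s)⁻¹) ∧
    ∀ s ω, K.adj ω.1.1 (τ s ω).1.1 := by
  have step : ∀ (ε : ℤ) (s : S) (ω : Elts K), ε ≠ 0 →
      ∃ ω' : Elts K, ω'.1.2 = ω.1.2 * D.gen s ^ ε ∧ K.adj ω.1.1 ω'.1.1 := by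
    rintro ε s ⟨⟨t, g⟩, h⟩ hε
    obtain ⟨w, h1, h2⟩ := K.lift t (.inl (g * D.gen s ^ ε)) (by
      rw [h]; exact ⟨s, ε, hε, rfl⟩)
    exact ⟨⟨(w, _), h2⟩, rfl, h1⟩
  have uniq : ∀ (ω a b : Elts K), K.adj ω.1.1 a.1.1 → K.adj ω.1.1 b.1.1 → a.1.2 = b.1.2 →
      a = b := by
    rintro ω ⟨⟨a, g⟩, ha⟩ ⟨⟨b, h⟩, hb⟩ h1 h2 (rfl : g = h)
    have : a = b := K.inj h1 h2 (ha.trans hb.symm)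
    subst this
    rfl
  choose up hup1 hup2 using fun s ω => step (-1) s ω (by norm_num)
  choose dn hdn1 hdn2 using fun s ω => step 1 s ω one_ne_zero
  refine ⟨fun s => ⟨up s, dn s, fun ω => ?_, fun ω => ?_⟩, fun s ω => ?_, fun s ω => hup2 s ω⟩
  · exact uniq _ _ _ (hdn2 s (up s ω)) (K.symm (hup2 s ω)) (by rw [hdn1, hup1]; group)
  · exact uniq _ _ _ (hup2 s (dn s ω)) (K.symm (hdn2 s ω)) (by rw [hup1, hdn1]; group)
  · change (up s ω).1.2 = _
    rw [hup1, zpow_neg_one]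

theorem exists_action : ∃ φ : G →* Equiv.Perm (Elts K), (∀ g ω, (φ g ω).1.2 = ω.1.2 * g⁻¹) ∧
    (∀ s ω (k : ℤ), k ≠ 0 → K.adj ω.1.1 (φ (D.gen s ^ k) ω).1.1) ∧
    ∀ (a b : S) (hab : D.fin a b) (ω : Elts K) (q : K.T), K.adj ω.1.1 q →
      K.F q = .inr (D.blk ω.1.2 hab) → ∀ h ∈ D.H {a, b}, K.adj (φ h ω).1.1 q := by
  obtain ⟨τ, h1, h2⟩ := exists_perm K
  have h1' : ∀ s ω, ((τ s).symm ω).1.2 = ω.1.2 * D.gen s := by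
    intro s ω
    have := h1 s ((τ s).symm ω)
    rw [Equiv.apply_symm_apply] at this
    rw [this]
    group
  have h2' : ∀ s ω, K.adj ω.1.1 ((τ s).symm ω).1.1 := by
    intro s ω
    have := h2 s ((τ s).symm ω)
    rw [Equiv.apply_symm_apply] at this
    exact K.symm this
  have stepE : ∀ (q : K.T) (B : D.Block) (ω ω' : Elts K), K.F q = .inr B → K.adj ω.1.1 q →
      K.adj ω.1.1 ω'.1.1 → ω'.1.2 ∈ B.1 → K.adj ω'.1.1 q := by
    intro q B ω ω' hq h h' hB
    refine K.symm (K.tri h h' ?_)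
    rw [hq, ω'.2]
    exact hB
  obtain ⟨φ, hφ⟩ := D.exists_hom (Elts K) (fun ω => ω.1.2) τ h1 (by
    intro a b hab
    refine ⟨fun ω ω' => ∃ q, K.adj ω.1.1 q ∧ K.adj ω'.1.1 q ∧ K.F q = .inr (D.blk ω.1.2 hab),
      ?_, ?_, ?_⟩
    · intro ω
      obtain ⟨w, hw1, hw2⟩ := K.lift ω.1.1 (.inr (D.blk ω.1.2 hab)) (by
        rw [ω.2]; exact self_mem_coset)
      exact ⟨w, hw1, hw1, hw2⟩
    · rintro ω ω' s hs ⟨q, hq1, hq2, hq3⟩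
      have hm : ω'.1.2 ∈ ω.1.2 • (D.H {a, b} : Set G) := by
        have := K.hom hq2
        rw [ω'.2, hq3] at this
        exact this
      have hs' : D.gen s ∈ D.H {a, b} := gen_mem hs
      rw [mem_coset_iff] at hm
      refine ⟨⟨q, hq1, ?_, hq3⟩, ⟨q, hq1, ?_, hq3⟩⟩
      · refine stepE q _ ω' _ hq3 hq2 (h2 s ω') ?_
        change _ ∈ ω.1.2 • (D.H {a, b} : Set G)
        rw [mem_coset_iff, h1, ← mul_assoc]
        exact mul_mem hm (inv_mem hs')
      · refine stepE q _ ω' _ hq3 hq2 (h2' s ω') ?_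
        change _ ∈ ω.1.2 • (D.H {a, b} : Set G)
        rw [mem_coset_iff, h1', ← mul_assoc]
        exact mul_mem hm hs'
    · rintro ⟨⟨ω, g⟩, hω⟩ ⟨⟨ω', g'⟩, hω'⟩ ⟨q, hq1, hq2, hq3⟩ (rfl : g = g')
      have : ω = ω' := K.inj (K.symm hq1) (K.symm hq2) (hω.trans hω'.symm)
      subst this
      rfl)
  have hπ : ∀ g ω, (φ g ω).1.2 = ω.1.2 * g⁻¹ := by
    intro g
    have hg : g ∈ Subgroup.closure (Set.range D.gen) := by rw [D.closure_eq]; trivial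
    induction hg using Subgroup.closure_induction with
    | mem x hx =>
      obtain ⟨s, rfl⟩ := hx
      intro ω
      rw [hφ, h1]
    | one => simp
    | mul x y _ _ hx hy =>
      intro ω
      rw [map_mul, Equiv.Perm.mul_apply, hx, hy, mul_inv_rev, mul_assoc]
    | inv x _ hx =>
      intro ω
      have := hx (φ x⁻¹ ω)
      rw [← Equiv.Perm.mul_apply, ← map_mul, mul_inv_cancel, map_one, Equiv.Perm.one_apply] at this
      rw [this]
      group
  have hpos : ∀ s (k : ℕ) ω, K.adj ω.1.1 (φ (D.gen s ^ (k + 1)) ω).1.1 := by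
    intro s k
    induction k with
    | zero =>
      intro ω
      rw [zero_add, pow_one, hφ]
      exact h2 s ω
    | succ k ih =>
      intro ω
      have e : φ (D.gen s ^ (k + 1 + 1)) ω = τ s (φ (D.gen s ^ (k + 1)) ω) := by
        rw [pow_succ', map_mul, Equiv.Perm.mul_apply, hφ]
      rw [e]
      refine K.symm (K.tri (K.symm (ih ω)) (h2 s _) ?_) |> K.symm
      rw [ω.2, (τ s _).2]
      rw [← e, hπ]
      refine ⟨s, -((k + 1 + 1 : ℕ) : ℤ), by omega, ?_⟩
      rw [zpow_neg, zpow_natCast]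
  refine ⟨φ, hπ, ?_, ?_⟩
  · intro s ω k hk
    rcases Int.lt_or_lt_of_ne hk with h | h
    · obtain ⟨m, rfl⟩ : ∃ m : ℕ, k = -((m + 1 : ℕ) : ℤ) := ⟨(-k).toNat - 1, by omega⟩
      have := hpos s m (φ (D.gen s ^ (-((m + 1 : ℕ) : ℤ))) ω)
      rw [← Equiv.Perm.mul_apply, ← map_mul, zpow_neg, zpow_natCast, mul_inv_cancel, map_one,
        Equiv.Perm.one_apply] at this
      rw [zpow_neg, zpow_natCast]
      exact K.symm this
    · obtain ⟨m, rfl⟩ : ∃ m : ℕ, k = ((m + 1 : ℕ) : ℤ) := ⟨k.toNat - 1, by omega⟩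
      rw [zpow_natCast]
      exact hpos s m ω
  · intro a b hab ω q₀ hq hF₀ h hh
    have main : ∀ h ∈ D.H {a, b}, ∀ (ω' : Elts K) (q : K.T), K.F q = .inr (D.blk ω.1.2 hab) →
        ω'.1.2 ∈ ω.1.2 • (D.H {a, b} : Set G) →
        K.adj ω'.1.1 q → K.adj (φ h ω').1.1 q := by
      intro h hh
      induction hh using Subgroup.closure_induction with
      | mem x hx =>
        obtain ⟨s, hs, rfl⟩ := hx
        intro ω' q hF hω' hadj
        rw [hφ]
        refine stepE q _ ω' _ hF hadj (h2 s ω') ?_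
        change _ ∈ ω.1.2 • (D.H {a, b} : Set G)
        rw [mem_coset_iff] at *
        rw [h1, ← mul_assoc]
        exact mul_mem hω' (inv_mem (gen_mem hs))
      | one => simp +contextual
      | mul x y hx' hy' hx hy =>
        intro ω' q hF hω' hadj
        rw [map_mul, Equiv.Perm.mul_apply]
        refine hx _ q hF ?_ (hy _ q hF hω' hadj)
        rw [mem_coset_iff] at *
        rw [hπ, ← mul_assoc]
        exact mul_mem hω' (inv_mem hy')
      | inv x hx' hx =>
        intro ω' q hF hω' hadj
        have hmem : (φ x⁻¹ ω').1.2 ∈ ω.1.2 • (D.H {a, b} : Set G) := by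
          rw [mem_coset_iff] at *
          rw [hπ, ← mul_assoc, inv_inv]
          exact mul_mem hω' hx'
        obtain ⟨q', hq1, hq2⟩ := K.lift (φ x⁻¹ ω').1.1 (.inr (D.blk ω.1.2 hab)) (by
          rw [(φ x⁻¹ ω').2]; exact hmem)
        have h3 := hx _ q' hq2 hmem hq1
        rw [← Equiv.Perm.mul_apply, ← map_mul, mul_inv_cancel, map_one,
          Equiv.Perm.one_apply] at h3
        rwa [K.inj hadj h3 (hF.trans hq2.symm)]
    exact main h hh ω q₀ hF₀ self_mem_coset hq

theorem cover_bijective : Function.Bijective K.F := by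
  obtain ⟨φ, h1, h2, h3⟩ := exists_action K
  let x₀ : Elts K := ⟨(K.base ⟨.inl 1, one_mem (D.H X)⟩, 1), K.F_base _⟩
  let R : K.T → Prop := fun t => (∃ g, t = (φ g x₀).1.1) ∨ ∃ B, K.F t = .inr B ∧
    ∃ g, K.adj (φ g x₀).1.1 t
  have sameF : ∀ (ω : Elts K) (t : K.T) (B : D.Block) (g : G), K.F t = .inr B → K.adj ω.1.1 t →
      g ∈ B.1 → ∃ h, K.adj (φ h ω).1.1 t ∧ (φ h ω).1.2 = g := by
    intro ω t B g hB hadj hg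
    have hω : ω.1.2 ∈ B.1 := by
      have := K.hom hadj
      rw [ω.2, hB] at this
      exact this
    obtain ⟨a, b, hab, e⟩ := block_eq B hω
    obtain rfl : B = D.blk ω.1.2 hab := Subtype.ext e
    rw [e, mem_coset_iff] at hg
    refine ⟨(ω.1.2⁻¹ * g)⁻¹, h3 a b hab ω t hadj hB _ (inv_mem hg), ?_⟩
    rw [h1]
    group
  have hR : ∀ t t', R t → K.adj t t' → R t' := by
    rintro t t' (⟨g, rfl⟩ | ⟨B, hB, g, hadj⟩) ht
    · rcases hF : K.F t' with x | B
      · left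
        have := K.hom ht
        rw [(φ g x₀).2, hF] at this
        obtain ⟨s, k, hk, e⟩ := this
        refine ⟨D.gen s ^ (-k) * g, ?_⟩
        rw [map_mul, Equiv.Perm.mul_apply]
        refine K.inj ht (h2 s _ (-k) (neg_ne_zero.2 hk)) ?_
        rw [(φ (D.gen s ^ (-k)) _).2, hF, e, h1 (D.gen s ^ (-k))]
        congr 2
        group
      · exact Or.inr ⟨B, hF, g, ht⟩
    · left
      have := K.hom ht
      rw [hB] at this
      rcases hF : K.F t' with x | B'
      · rw [hF] at this
        obtain ⟨h, h4, h5⟩ := sameF (φ g x₀) t B x hB hadj this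
        refine ⟨h * g, ?_⟩
        rw [map_mul, Equiv.Perm.mul_apply]
        refine K.inj ht (K.symm h4) ?_
        rw [hF, (φ h _).2, h5]
      · rw [hF] at this
        exact this.elim
  have hbase : ∀ g (hg : g ∈ D.H X), R (K.base ⟨.inl g, hg⟩) := by
    intro g hg
    have hstep : ∀ (x : G) (hx : x ∈ D.H X) (s : S) (hs : s ∈ X) (k : ℤ), k ≠ 0 →
        R (K.base ⟨.inl x, hx⟩) →
        R (K.base ⟨.inl (x * D.gen s ^ k), mul_mem hx (gen_zpow_mem hs k)⟩) := by
      intro x hx s hs k hk h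
      exact hR _ _ h (K.adj_base _ _ ⟨s, k, hk, rfl⟩)
    induction hg using Subgroup.closure_induction_right with
    | one => exact Or.inl ⟨1, by simp [x₀]⟩
    | mul_right x hx y hy ih =>
      obtain ⟨s, hs, rfl⟩ := hy
      simpa using hstep x hx s hs 1 one_ne_zero ih
    | mul_inv_cancel x hx y hy ih =>
      obtain ⟨s, hs, rfl⟩ := hy
      simpa using hstep x hx s hs (-1) (by norm_num) ih
  have all : ∀ n t, K.lev t = n → R t := by
    intro n
    induction n with
    | zero =>
      intro t ht
      obtain ⟨⟨c, hc⟩, rfl⟩ := K.eq_base t ht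
      rcases c with g | B
      · exact hbase g hc
      · obtain ⟨g, hg⟩ := block_nonempty B
        exact hR _ _ (hbase g (hc hg)) (K.adj_base _ _ hg)
    | succ n ih =>
      intro t ht
      obtain ⟨w, hw1, hw2⟩ := K.lower t n ht
      exact hR _ _ (ih w hw2) (K.symm hw1)
  have elt : ∀ g g', (φ g x₀).1.2 = (φ g' x₀).1.2 → g = g' := by
    intro g g' h
    rw [h1, h1] at h
    exact inv_injective (mul_left_cancel h)
  constructor
  · intro t t' htt
    rcases all _ t rfl with ⟨g, rfl⟩ | ⟨B, hB, g, hg⟩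
    · rcases all _ t' rfl with ⟨g', rfl⟩ | ⟨B', hB', -⟩
      · rw [(φ g x₀).2, (φ g' x₀).2] at htt
        rw [elt g g' (Sum.inl_injective htt)]
      · rw [(φ g x₀).2, hB'] at htt
        cases htt
    · rcases all _ t' rfl with ⟨g', rfl⟩ | ⟨B', hB', g', hg'⟩
      · rw [(φ g' x₀).2, hB] at htt
        cases htt
      · obtain rfl : B = B' := Sum.inr_injective (hB.symm.trans (htt.trans hB'))
        have hm := K.hom hg'
        rw [(φ g' x₀).2, hB'] at hm
        obtain ⟨h, h4, h5⟩ := sameF _ t B _ hB hg hm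
        rw [← Equiv.Perm.mul_apply, ← map_mul] at h4 h5
        rw [← elt _ _ h5.symm] at h4
        exact K.inj h4 hg' htt
  · have surj : ∀ g, ∃ t, K.F t = .inl g := fun g => ⟨(φ g⁻¹ x₀).1.1, by
      rw [(φ g⁻¹ x₀).2, h1]; simp [x₀]⟩
    rintro (g | B)
    · exact surj g
    · obtain ⟨g, hg⟩ := block_nonempty B
      obtain ⟨t, ht⟩ := surj g
      obtain ⟨w, -, hw⟩ := K.lift t (.inr B) (by rw [ht]; exact hg)
      exact ⟨w, hw⟩

end Cover

variable (D) in
theorem nonempty_level (X : Set S) : Nonempty (Level D X) := by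
  obtain ⟨K⟩ := nonempty_cover D X
  let e := Equiv.ofBijective _ (cover_bijective K)
  have he : ∀ t, e t = K.F t := fun _ => rfl
  have hes : ∀ v, K.F (e.symm v) = v := fun v => e.apply_symm_apply v
  have hadj : ∀ {v w}, D.graph.Adj v w → K.adj (e.symm v) (e.symm w) := by
    intro v w h
    obtain ⟨t, ht1, ht2⟩ := K.lift (e.symm v) w (by rwa [hes])
    rwa [← ht2, ← he, e.symm_apply_apply]
  have hadj' : ∀ {v t}, K.adj (e.symm v) t → D.graph.Adj v (K.F t) := by
    intro v t h
    simpa [hes] using K.hom h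
  refine ⟨⟨fun v => K.lev (e.symm v), ?_, fun h => K.lev_le (hadj h), ?_, ?_, ?_⟩⟩
  · intro v
    constructor
    · intro h
      obtain ⟨c, hc⟩ := K.eq_base _ h
      have := hes v
      rw [hc, K.F_base] at this
      rw [← this]
      exact c.2
    · intro h
      have : e.symm v = K.base ⟨v, h⟩ := by
        rw [Equiv.symm_apply_eq, he, K.F_base]
      rw [this, K.lev_base]
  · intro v n h
    obtain ⟨w, hw1, hw2⟩ := K.lower _ _ h
    exact ⟨K.F w, hadj' hw1, by rwa [← he, e.symm_apply_apply]⟩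
  · intro v w w' h h' e1 e2
    rcases K.lower_unique (hadj h) (hadj h') e1 e2 with h3 | h3
    · exact Or.inl (e.symm.injective h3)
    · right
      simpa [hes] using K.hom h3
  · intro v w n h e1 e2
    obtain ⟨u, hu1, hu2, hu3⟩ := K.common (hadj h) e1 e2
    exact ⟨K.F u, hadj' hu1, hadj' hu2, by rwa [← he, e.symm_apply_apply]⟩

end LargeGroup

theorem reflTransGen_mono {α : Type*} {r p : α → α → Prop} (H : ∀ a b, r a b → p a b) {a b : α}
    (h : Relation.ReflTransGen r a b) : Relation.ReflTransGen p a b := by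
  induction h with
  | refl => exact .refl
  | tail _ h ih => exact ih.tail (H _ _ h)

namespace LargeGroup

variable {G S : Type u} [Group G] {D : LargeGroup G S}

/-- Left translation of blocks. -/
def actB (p : G) (B : D.Block) : D.Block :=
  ⟨p • B.1, by
    obtain ⟨g, a, b, hab, e⟩ := B.2
    exact ⟨p * g, a, b, hab, by rw [e, mul_smul]⟩⟩

/-- Left translation of vertices. -/
def act (p : G) : D.Vert → D.Vert := Sum.map (p * ·) (actB p)

theorem mem_actB {p g : G} {B : D.Block} : g ∈ (actB p B).1 ↔ p⁻¹ * g ∈ B.1 :=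
  Set.mem_smul_set_iff_inv_smul_mem

theorem mul_mem_actB {p g : G} {B : D.Block} : p * g ∈ (actB p B).1 ↔ g ∈ B.1 := by
  rw [mem_actB, inv_mul_cancel_left]

@[simp] theorem actB_one (B : D.Block) : actB 1 B = B := Subtype.ext (one_smul _ _)

theorem actB_mul (p q : G) (B : D.Block) : actB (p * q) B = actB p (actB q B) :=
  Subtype.ext (mul_smul _ _ _)

theorem act_one (v : D.Vert) : act 1 v = v := by
  rcases v with g | B <;> simp [act]

theorem act_mul (p q : G) (v : D.Vert) : act (p * q) v = act p (act q v) := by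
  rcases v with g | B
  · simp [act, mul_assoc]
  · simp [act, actB_mul]

theorem act_injective (p : G) : Function.Injective (act p : D.Vert → D.Vert) := by
  intro v w h
  rw [← act_one v, ← act_one w, ← inv_mul_cancel p, act_mul, act_mul, h]

theorem gAdj_mul_left {p g h : G} : D.gAdj (p * g) (p * h) ↔ D.gAdj g h := by
  constructor
  · rintro ⟨a, k, hk, e⟩
    exact ⟨a, k, hk, mul_left_cancel (a := p) (by rw [e, mul_assoc])⟩
  · rintro ⟨a, k, hk, rfl⟩
    exact ⟨a, k, hk, by rw [mul_assoc]⟩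

theorem adj_act {p : G} {v w : D.Vert} :
    D.graph.Adj (act p v) (act p w) ↔ D.graph.Adj v w := by
  rcases v with v | v <;> rcases w with w | w
  · exact gAdj_mul_left
  · exact mul_mem_actB
  · exact mul_mem_actB
  · exact Iff.rfl

theorem act_mem_base {X : Set S} {p : G} (hp : p ∈ D.H X) {v : D.Vert} :
    act p v ∈ D.base X ↔ v ∈ D.base X := by
  have key : ∀ {p : G} (_ : p ∈ D.H X) {v : D.Vert}, v ∈ D.base X → act p v ∈ D.base X := by
    rintro p hp (g | B) h
    · exact mul_mem hp h
    · intro g hg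
      rw [mem_actB] at hg
      simpa using mul_mem hp (h hg)
  refine ⟨fun h => ?_, key hp⟩
  have := key (inv_mem hp) h
  rwa [← act_mul, inv_mul_cancel, act_one] at this

namespace Level

variable {X : Set S} (Λ : Level D X)

theorem le_of_level (lev' : D.Vert → ℕ) (h0 : ∀ v ∈ D.base X, lev' v = 0)
    (hle : ∀ {v w}, D.graph.Adj v w → lev' v ≤ lev' w + 1) (v : D.Vert) :
    lev' v ≤ Λ.lev v := by
  generalize hn : Λ.lev v = n
  induction n generalizing v with
  | zero => rw [h0 v ((Λ.zero_iff v).1 hn)]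
  | succ n ih =>
    obtain ⟨w, hw, hw'⟩ := Λ.lower v n hn
    exact (hle hw).trans (Nat.succ_le_succ (ih w hw'))

theorem lev_act {p : G} (hp : p ∈ D.H X) (v : D.Vert) : Λ.lev (act p v) = Λ.lev v := by
  have key : ∀ {p : G} (_ : p ∈ D.H X) (v : D.Vert), Λ.lev (act p v) ≤ Λ.lev v := by
    intro p hp v
    refine Λ.le_of_level (fun v => Λ.lev (act p v)) (fun v hv => ?_) (fun h => ?_) v
    · exact (Λ.zero_iff _).2 ((act_mem_base hp).2 hv)
    · exact Λ.le_succ (adj_act.2 h)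
  refine le_antisymm (key hp v) ?_
  have := key (inv_mem hp) (act p v)
  rwa [← act_mul, inv_mul_cancel, act_one] at this

theorem lev_mul {p : G} (hp : p ∈ D.H X) (g : G) : Λ.lev (.inl (p * g)) = Λ.lev (.inl g) :=
  Λ.lev_act hp (.inl g)

theorem lev_actB {p : G} (hp : p ∈ D.H X) (B : D.Block) :
    Λ.lev (.inr (actB p B)) = Λ.lev (.inr B) :=
  Λ.lev_act hp (.inr B)

/-- Two blocks which are lower neighbours of the same vertex coincide. -/
theorem lower_block_unique {v : D.Vert} {B B' : D.Block} (h : D.graph.Adj v (.inr B))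
    (h' : D.graph.Adj v (.inr B')) (e : Λ.lev v = Λ.lev (.inr B) + 1)
    (e' : Λ.lev v = Λ.lev (.inr B') + 1) : B = B' := by
  rcases Λ.lower_unique h h' e e' with h | h
  · exact Sum.inr_injective h
  · exact h.elim

theorem lower_block_fixed {p h : G} {s : S} {k : ℤ} (hp : p ∈ D.H X) (e : p * h = h * D.gen s ^ k)
    {B : D.Block} (hB : h ∈ B.1) (hB' : h * D.gen s ^ k ∈ B.1)
    (hl : Λ.lev (.inl h) = Λ.lev (.inr B) + 1) : actB p B = B := by
  have h1 : p * h ∈ (actB p B).1 := mul_mem_actB.2 hB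
  rw [← e] at hB'
  exact Λ.lower_block_unique (v := .inl (p * h)) h1 hB' (by rw [lev_mul Λ hp, lev_actB Λ hp, hl])
    (by rw [lev_mul Λ hp, hl])

theorem conj_of_edge {p h : G} {s : S} {k : ℤ} (hp : p ∈ D.H X) (h1 : p ≠ 1)
    (e : p * h = h * D.gen s ^ k) :
    ∃ a ∈ D.H X, ∃ s ∈ X, ∃ k : ℤ, p = a * D.gen s ^ k * a⁻¹ := by
  obtain ⟨Λ⟩ := nonempty_level D X
  generalize hn : Λ.lev (.inl h) = n
  induction n using Nat.strong_induction_on generalizing h s k with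
  | _ n ih =>
  have hk : k ≠ 0 := by
    rintro rfl
    simp at e
    exact h1 e
  rcases n with _ | n
  · have hh : h ∈ D.H X := (Λ.zero_iff _).1 hn
    refine ⟨h, hh, s, letter_mem_of_base (g := h) hh hk ?_, k, eq_mul_inv_of_mul_eq e⟩
    rw [← e]
    exact mul_mem hp hh
  have hadj : D.graph.Adj (.inl h) (.inl (h * D.gen s ^ k)) := ⟨s, k, hk, rfl⟩
  have hn' : Λ.lev (.inl (h * D.gen s ^ k)) = n + 1 := by rw [← e, Λ.lev_mul hp, hn]
  obtain ⟨u | B, hu1, hu2, hu3⟩ := Λ.common hadj hn hn'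
  · obtain ⟨t, j, hj, rfl⟩ := hu1
    obtain rfl : s = t := same_letter hk hj rfl rfl hu2
    refine ih n (by omega) (s := s) (k := k) ?_ hu3
    rw [← mul_assoc, e, mul_assoc, mul_assoc, ← zpow_add, ← zpow_add, add_comm]
  · have hfix : actB p B = B := Λ.lower_block_fixed hp e hu1 hu2 (by rw [hu3, hn])
    rcases n with _ | n
    · exfalso
      have hB : B.1 ⊆ D.H X := (Λ.zero_iff _).1 hu3
      have := (Λ.zero_iff (.inl h)).2 (hB hu1)
      omega
    obtain ⟨x | B', hx1, hx2⟩ := Λ.lower _ _ hu3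
    · have hadj' : D.graph.Adj (.inr B) (.inl (p * x)) := by
        have : p * x ∈ (actB p B).1 := mul_mem_actB.2 hx1
        rwa [hfix] at this
      rcases Λ.lower_unique hx1 hadj' (by rw [hu3, hx2])
        (by rw [Λ.lev_mul hp, hx2, hu3]) with h' | h'
      · exact absurd (mul_eq_right.1 (Sum.inl_injective h').symm) h1
      · obtain ⟨t, j, -, e'⟩ := h'
        exact ih n (by omega) e' hx2
    · exact hx1.elim

section Coset

variable (g : G)

/-- The translate of the subgraph of `X`. -/
def coset (X : Set S) : Set D.Vert := {v | act g⁻¹ v ∈ D.base X}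

variable {g}

/-- Adjacency inside a translate, below a given level. -/
def bAdj (g : G) (N : ℕ) (v w : D.Vert) : Prop :=
  D.graph.Adj v w ∧ v ∈ coset g X ∧ w ∈ coset g X ∧ Λ.lev v ≤ N ∧ Λ.lev w ≤ N

variable {Λ}

theorem coset_tri {c c' c'' y : D.Vert} (hc : c ∈ coset g X) (hc' : c' ∈ coset g X)
    (hc'' : c'' ∈ coset g X) (hy : y ∉ coset g X) (h1 : D.graph.Adj c c')
    (h2 : D.graph.Adj c' c'') (e1 : D.graph.Adj c y) (e2 : D.graph.Adj c' y)
    (e3 : D.graph.Adj c'' y) : c = c'' ∨ D.graph.Adj c c'' := by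
  have := graph_base _ _ _ _ hc hc' hc'' hy (adj_act.2 h1) (adj_act.2 h2) (adj_act.2 e1)
    (adj_act.2 e2) (adj_act.2 e3)
  exact this.imp (fun h => act_injective _ h) adj_act.1

theorem peak {N : ℕ} {v y : D.Vert} (hv : v ∈ coset g X) (hN : Λ.lev v ≤ N)
    (h : Relation.ReflTransGen (Λ.bAdj g (N + 1)) v y) :
    ∃ w ∈ coset g X, Relation.ReflTransGen (Λ.bAdj g N) v w ∧ (w = y ∧ Λ.lev w ≤ N ∨
      Λ.lev y = N + 1 ∧ Λ.lev w = N ∧ D.graph.Adj y w) := by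
  induction h with
  | refl => exact ⟨v, hv, .refl, Or.inl ⟨rfl, hN⟩⟩
  | @tail y y' _ h ih =>
    obtain ⟨hadj, hy, hy', l, l'⟩ := h
    obtain ⟨w, hw, hvw, ⟨rfl, hwN⟩ | ⟨e1, e2, hyw⟩⟩ := ih
    · by_cases hc : Λ.lev y' ≤ N
      · exact ⟨y', hy', hvw.tail ⟨hadj, hy, hy', hwN, hc⟩, Or.inl ⟨rfl, hc⟩⟩
      · have := Λ.le_succ hadj.symm
        exact ⟨w, hw, hvw, Or.inr ⟨by omega, by omega, hadj.symm⟩⟩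
    · have step : ∀ u ∈ coset g X, D.graph.Adj y u → Λ.lev u = N →
          Relation.ReflTransGen (Λ.bAdj g N) v u := by
        intro u hu hyu hl
        rcases Λ.lower_unique hyw hyu (by omega) (by omega) with rfl | h
        · exact hvw
        · exact hvw.tail ⟨h, hw, hu, e2.le, hl.le⟩
      by_cases hc : Λ.lev y' ≤ N
      · have := Λ.le_succ hadj
        exact ⟨y', hy', step y' hy' hadj (by omega), Or.inl ⟨rfl, hc⟩⟩
      · have hl' : Λ.lev y' = N + 1 := by omega
        obtain ⟨u, hu1, hu2, hu3⟩ := Λ.common hadj e1 hl'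
        by_cases hu : u ∈ coset g X
        · exact ⟨u, hu, step u hu hu1 hu3, Or.inr ⟨hl', hu3, hu2⟩⟩
        · rcases Λ.lower_unique hyw hu1 (by omega) (by omega) with rfl | h
          · exact absurd hw hu
          · rcases coset_tri hw hy hy' hu hyw.symm hadj h hu1 hu2 with rfl | h'
            · omega
            · exact ⟨w, hw, hvw, Or.inr ⟨hl', e2, h'.symm⟩⟩

theorem peak_iterate {n k : ℕ} {v y : D.Vert} (hv : v ∈ coset g X) (hn : Λ.lev v ≤ n)
    (hy : Λ.lev y ≤ n) (h : Relation.ReflTransGen (Λ.bAdj g (n + k)) v y) :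
    Relation.ReflTransGen (Λ.bAdj g n) v y := by
  induction k with
  | zero => exact h
  | succ k ih =>
    obtain ⟨w, hw, hvw, ⟨rfl, -⟩ | ⟨e1, -⟩⟩ := peak hv (hn.trans (Nat.le_add_right n k)) h
    · exact ih hvw
    · omega

theorem mem_coset {x : G} : (.inl x : D.Vert) ∈ coset g X ↔ g⁻¹ * x ∈ D.H X := Iff.rfl

theorem mul_gen_mem_coset {x : G} {s : S} {k : ℤ} (h : (.inl x : D.Vert) ∈ coset g X)
    (hs : s ∈ X) : (.inl (x * D.gen s ^ k) : D.Vert) ∈ coset g X := by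
  rw [mem_coset] at *
  rw [← mul_assoc]
  exact mul_mem h (gen_zpow_mem hs k)

theorem letter_mem_of_coset {x : G} {s : S} {k : ℤ} (hk : k ≠ 0)
    (h : (.inl x : D.Vert) ∈ coset g X)
    (h' : (.inl (x * D.gen s ^ k) : D.Vert) ∈ coset g X) : s ∈ X := by
  rw [mem_coset] at *
  rw [← mul_assoc] at h'
  exact letter_mem_of_base h hk h'

theorem coset_connected {x y : G} (hx : (.inl x : D.Vert) ∈ coset g X)
    (hy : (.inl y : D.Vert) ∈ coset g X) :
    ∃ N, Relation.ReflTransGen (Λ.bAdj g N) (.inl x) (.inl y) := by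
  have mono : ∀ {N M : ℕ} {v w}, N ≤ M → Relation.ReflTransGen (Λ.bAdj g N) v w →
      Relation.ReflTransGen (Λ.bAdj g M) v w := by
    intro N M v w hNM h
    exact reflTransGen_mono
      (fun a b h => ⟨h.1, h.2.1, h.2.2.1, h.2.2.2.1.trans hNM, h.2.2.2.2.trans hNM⟩) h
  have hxy : x⁻¹ * y ∈ D.H X := by
    have := mul_mem (inv_mem (mem_coset.1 hx)) (mem_coset.1 hy)
    simpa [mul_assoc] using this
  have main : ∀ z ∈ D.H X, (.inl (x * z) : D.Vert) ∈ coset g X ∧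
      ∃ N, Relation.ReflTransGen (Λ.bAdj g N) (.inl x) (.inl (x * z)) := by
    have stp : ∀ z s (k : ℤ), k ≠ 0 → s ∈ X → ((.inl (x * z) : D.Vert) ∈ coset g X ∧
      ∃ N, Relation.ReflTransGen (Λ.bAdj g N) (.inl x) (.inl (x * z))) →
      ((.inl (x * (z * D.gen s ^ k)) : D.Vert) ∈ coset g X ∧
      ∃ N, Relation.ReflTransGen (Λ.bAdj g N) (.inl x) (.inl (x * (z * D.gen s ^ k)))) := by
      rintro z s k hk hs ⟨h1, N, h2⟩
      have h3 := mul_gen_mem_coset (k := k) h1 hs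
      rw [← mul_assoc]
      refine ⟨h3, max N (max (Λ.lev (.inl (x * z))) (Λ.lev (.inl (x * z * D.gen s ^ k)))),
        (mono (le_max_left _ _) h2).tail ⟨⟨s, k, hk, rfl⟩, h1, h3, by simp, by simp⟩⟩
    intro z hz
    induction hz using Subgroup.closure_induction_right with
    | one => exact ⟨by simpa using hx, 0, by rw [mul_one]⟩
    | mul_right z _ y hy ih =>
      obtain ⟨s, hs, rfl⟩ := hy
      simpa using stp z s 1 one_ne_zero hs ih
    | mul_inv_cancel z _ y hy ih =>
      obtain ⟨s, hs, rfl⟩ := hy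
      simpa using stp z s (-1) (by norm_num) hs ih
  obtain ⟨-, N, h⟩ := main _ hxy
  exact ⟨N, by simpa using h⟩

end Coset

theorem conj_of_coset {p g : G} (hp : p ∈ D.H X) (h1 : p ≠ 1) (hg : g ∉ D.H X)
    (hpg : g⁻¹ * p * g ∈ D.H X) :
    ∃ a ∈ D.H X, ∃ s ∈ X, ∃ k : ℤ, p = a * D.gen s ^ k * a⁻¹ := by
  obtain ⟨Λ⟩ := nonempty_level D X
  obtain ⟨h, hh, hmin⟩ : ∃ h : G, (.inl h : D.Vert) ∈ coset g X ∧
      ∀ x, (.inl x : D.Vert) ∈ coset g X → Λ.lev (.inl h) ≤ Λ.lev (.inl x) := by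
    have hne : {h : G | (.inl h : D.Vert) ∈ coset g X}.Nonempty := ⟨g, by
      change g⁻¹ * g ∈ D.H X; simp⟩
    obtain ⟨m, hm⟩ := exists_minimal_of_wellFoundedLT
      (fun n => ∃ h, (.inl h : D.Vert) ∈ coset g X ∧ Λ.lev (.inl h) = n)
      ⟨_, hne.choose, hne.choose_spec, rfl⟩
    obtain ⟨⟨h, hh, rfl⟩, hm⟩ := hm
    refine ⟨h, hh, fun x hx => ?_⟩
    by_contra hc
    exact hc (hm ⟨x, hx, rfl⟩ (by omega))
  have notbase : ∀ x : G, (.inl x : D.Vert) ∈ coset g X → x ∉ D.H X := by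
    intro x hx hx'
    refine hg ?_
    have := mul_mem hx' (inv_mem (mem_coset.1 hx))
    simpa using this
  obtain ⟨n, hn⟩ : ∃ n, Λ.lev (.inl h) = n + 1 := by
    refine Nat.exists_eq_succ_of_ne_zero fun h0 => ?_
    exact notbase h hh ((Λ.zero_iff _).1 h0)
  have noblock : ∀ B : D.Block, (.inr B : D.Vert) ∈ coset g X → n + 1 < Λ.lev (.inr B) := by
    intro B hB
    have hsub : ∀ x ∈ B.1, (.inl x : D.Vert) ∈ coset g X := by
      intro x hx
      exact hB (mul_mem_actB.2 hx)
    by_contra hc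
    have hpos : Λ.lev (.inr B) ≠ 0 := by
      intro h0
      obtain ⟨x, hx⟩ := block_nonempty B
      exact notbase x (hsub x hx) ((Λ.zero_iff _).1 h0 hx)
    obtain ⟨m, hm⟩ := Nat.exists_eq_succ_of_ne_zero hpos
    obtain ⟨x | B', hx, hx'⟩ := Λ.lower _ _ hm
    · have := hmin x (hsub x hx)
      omega
    · exact hx.elim
  have key : ∀ y, Relation.ReflTransGen (Λ.bAdj g (n + 1)) (.inl h) y →
      ∃ x, y = .inl x ∧ (h = x ∨ D.gAdj h x) := by
    intro y hy
    induction hy with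
    | refl => exact ⟨h, rfl, Or.inl rfl⟩
    | @tail y y' _ hyy ih =>
      obtain ⟨x, rfl, hx⟩ := ih
      obtain ⟨hadj, hy, hy', l, l'⟩ := hyy
      rcases y' with x' | B
      swap
      · have := noblock B hy'
        omega
      refine ⟨x', rfl, ?_⟩
      rcases hx with rfl | hx
      · exact Or.inr hadj
      obtain ⟨s, i, hi, e⟩ := gAdj_symm hx
      obtain ⟨t, j, hj, e'⟩ := hadj
      by_cases hst : s = t
      · subst hst
        exact eq_or_adj_of_same e e'
      exfalso
      have lx : Λ.lev (.inl x) = n + 1 := by have := hmin x hy; omega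
      have lx' : Λ.lev (.inl x') = n + 1 := by have := hmin x' hy'; omega
      have hs : s ∈ X := letter_mem_of_coset hi hy (e ▸ hh)
      have ht : t ∈ X := letter_mem_of_coset hj hy (e' ▸ hy')
      have lower : ∀ (x' : G) (r : S) (i : ℤ), i ≠ 0 → r ∈ X → x' = x * D.gen r ^ i →
          Λ.lev (.inl x') = n + 1 → ∃ B : D.Block, Λ.lev (.inr B) = n ∧ x ∈ B.1 ∧ x' ∈ B.1 := by
        intro x' r i hi hr e hx'
        obtain ⟨u | B, hu1, hu2, hu3⟩ := Λ.common (v := .inl x) (w := .inl x') ⟨r, i, hi, e⟩ lx hx'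
        · exfalso
          obtain ⟨q, m, hm, e2⟩ := hu1
          obtain rfl := same_letter hi hm e e2 hu2
          have := hmin u (e2 ▸ mul_gen_mem_coset hy hr)
          omega
        · exact ⟨B, hu3, hu1, hu2⟩
      obtain ⟨B, hB, hB1, hB2⟩ := lower h s i hi hs e hn
      obtain ⟨B', hB', hB1', hB2'⟩ := lower x' t j hj ht e' lx'
      obtain rfl : B = B' := Λ.lower_block_unique (v := .inl x) hB1 hB1' (by omega) (by omega)
      have hBc : (.inr B : D.Vert) ∈ coset g X := by
        obtain ⟨a, b, hab, eB⟩ := block_eq B hB1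
        rw [e, eB] at hB2
        rw [e', eB] at hB2'
        have h3 := letter_of_mem hi hB2
        have h4 := letter_of_mem hj hB2'
        have hsub : ({a, b} : Set S) ⊆ X := by
          rintro z (rfl | rfl)
          · rcases h3 with rfl | rfl
            · exact hs
            · rcases h4 with rfl | rfl
              · exact ht
              · exact absurd rfl hst
          · rcases h3 with rfl | rfl
            · rcases h4 with rfl | rfl
              · exact absurd rfl hst
              · exact ht
            · exact hs
        intro z hz
        rw [mem_actB, inv_inv, eB, mem_coset_iff] at hz
        have := mul_mem (mem_coset.1 hy) (H_mono hsub hz)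
        simpa [mul_assoc] using this
      have := noblock B hBc
      omega
  have hph : (.inl (p * h) : D.Vert) ∈ coset g X := by
    rw [mem_coset] at *
    have := mul_mem hpg hh
    simpa [mul_assoc] using this
  obtain ⟨N, hN⟩ := coset_connected (Λ := Λ) hh hph
  have hlp := Λ.lev_mul hp h
  obtain ⟨x, hx, hx'⟩ := key (.inl (p * h)) (peak_iterate (k := N) hh hn.le (by omega)
    (reflTransGen_mono (fun a b h => ⟨h.1, h.2.1, h.2.2.1, by have := h.2.2.2.1; omega,
      by have := h.2.2.2.2; omega⟩) hN))
  obtain rfl := Sum.inl_injective hx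
  rcases hx' with hx' | ⟨s, k, -, e⟩
  · exact absurd (mul_eq_right.1 hx'.symm) h1
  · exact conj_of_edge hp h1 e

end Level

end LargeGroup

open Finset in
theorem endo_range_sum {C : Type*} [AddCommGroup C] {n : ℕ} {t : AddMonoid.End C} (ht : t ^ n = 1) :
    ∑ i ∈ range n, t ^ (n - i) = ∑ i ∈ range n, t ^ i := by
  rcases n with - | n
  · simp
  rw [sum_range_succ', sum_range_succ', ← sum_range_reflect (fun i => t ^ (i + 1))]
  rw [Nat.sub_zero, ht, pow_zero]
  congr 1
  refine sum_congr rfl fun i hi => ?_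
  have := mem_range.1 hi
  congr 1
  omega

/-- The endomorphism of the free abelian group induced by a self-map of the basis. -/
noncomputable def pushEnd {V : Type*} (σ : V → V) : AddMonoid.End (V →₀ ℤ) :=
  Finsupp.mapDomain.addMonoidHom σ

/-- An endomorphism of order dividing `n` making the group an induced module. -/
def InducedEnd {C : Type*} [AddCommGroup C] (t : AddMonoid.End C) (n : ℕ) : Prop :=
  t ^ n = 1 ∧ ∃ e : AddMonoid.End C, ∑ i ∈ Finset.range n, t ^ i * e * t ^ (n - i) = 1

namespace InducedEnd

open Finset

variable {C : Type*} [AddCommGroup C] {t : AddMonoid.End C} {n : ℕ}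

theorem mul_apply' (f g : AddMonoid.End C) (c : C) : (f * g) c = f (g c) := rfl

theorem one_apply' (c : C) : (1 : AddMonoid.End C) c = c := rfl

theorem pow_apply_of_fixed {c : C} (hc : t c = c) (k : ℕ) : (t ^ k) c = c := by
  induction k with
  | zero => simp
  | succ k ih => rw [pow_succ, mul_apply', hc, ih]

theorem sum_apply' {s : Finset ℕ} (f : ℕ → AddMonoid.End C) (c : C) :
    (∑ i ∈ s, f i) c = ∑ i ∈ s, f i c := AddMonoidHom.finsetSum_apply _ _ _

theorem exists_norm (h : InducedEnd t n) {c : C} (hc : t c = c) :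
    ∃ d, c = (∑ i ∈ range n, t ^ i) d := by
  obtain ⟨-, e, he⟩ := h
  refine ⟨e c, ?_⟩
  have := congrArg (fun f : AddMonoid.End C => f c) he
  simp only [sum_apply', mul_apply', one_apply',
    pow_apply_of_fixed hc] at this
  rw [sum_apply', this]

theorem exists_sub (h : InducedEnd t n) {c : C} (hc : (∑ i ∈ range n, t ^ i) c = 0) :
    ∃ d, c = d - t d := by
  obtain ⟨ht, e, he⟩ := h
  have h1 := congrArg (fun f : AddMonoid.End C => f c) he
  have h2 := congrArg e hc
  rw [← endo_range_sum ht] at h2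
  simp only [sum_apply', mul_apply', one_apply', map_sum, map_zero]
    at h1 h2
  have key : ∀ (k : ℕ) (x : C), ∃ d, (t ^ k) x - x = d - t d := by
    intro k x
    induction k with
    | zero => exact ⟨0, by simp⟩
    | succ k ih =>
      obtain ⟨d, hd⟩ := ih
      refine ⟨d - (t ^ k) x, ?_⟩
      rw [pow_succ', mul_apply', map_sub, sub_sub_sub_comm, ← hd]
      abel
  choose d hd using key
  refine ⟨∑ i ∈ range n, d i (e ((t ^ (n - i)) c)), ?_⟩
  rw [map_sum, ← sum_sub_distrib]
  simp only [← hd]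
  rw [sum_sub_distrib, h1, h2, sub_zero]

theorem ofFree {V : Type*} {σ : V → V} {n : ℕ} (hn : 0 < n) (h1 : ∀ x, σ^[n] x = x)
    (h2 : ∀ x i, 0 < i → i < n → σ^[i] x ≠ x) :
    InducedEnd (pushEnd σ) n := by
  classical
  have pw : ∀ (k : ℕ) (x : V), ((pushEnd σ) ^ k)
      (Finsupp.single x 1) = Finsupp.single (σ^[k] x) 1 := by
    intro k x
    induction k with
    | zero => rfl
    | succ k ih =>
      rw [pow_succ', mul_apply', ih, Function.iterate_succ_apply']
      exact Finsupp.mapDomain_single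
  have hmod : ∀ k x, σ^[k] x = σ^[k % n] x := by
    intro k x
    conv_lhs => rw [← Nat.mod_add_div k n, Function.iterate_add_apply, Function.iterate_mul]
    congr 1
    exact Function.iterate_fixed (h1 x) _
  have inj : ∀ i j x, i < n → j < n → σ^[i] x = σ^[j] x → i = j := by
    have : ∀ i j x, i ≤ j → j < n → σ^[i] x = σ^[j] x → i = j := by
      intro i j x hij hj h
      by_contra hne
      refine h2 (σ^[i] x) (j - i) (by omega) (by omega) ?_
      rw [← Function.iterate_add_apply, Nat.sub_add_cancel hij, h]
    intro i j x hi hj h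
    rcases le_total i j with hij | hij
    · exact this i j x hij hj h
    · exact (this j i x hij hi h.symm).symm
  let r : Setoid V := ⟨fun x y => ∃ k, y = σ^[k] x, fun x => ⟨0, rfl⟩, by
    rintro x y ⟨k, rfl⟩
    refine ⟨n * k - k, ?_⟩
    rw [← Function.iterate_add_apply, Nat.sub_add_cancel (Nat.le_mul_of_pos_left _ hn),
      Function.iterate_mul, Function.iterate_fixed (h1 x)], by
    rintro x y z ⟨k, rfl⟩ ⟨l, rfl⟩
    exact ⟨l + k, (Function.iterate_add_apply _ _ _ _).symm⟩⟩
  let dom : Set V := Set.range (Quotient.out : Quotient r → V)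
  have hdom : ∀ x, ∃ i, i < n ∧ ∀ j < n, σ^[n - j] x ∈ dom ↔ j = i := by
    intro x
    obtain ⟨k, hk⟩ : ∃ k, (Quotient.mk r x).out = σ^[k] x :=
      r.symm (Quotient.mk_out (s := r) x)
    have hk' : k % n < n := Nat.mod_lt _ hn
    have hd : ∀ l, σ^[l] x ∈ dom ↔ l % n = k % n := by
      intro l
      constructor
      · rintro ⟨q, hq⟩
        have : q = Quotient.mk r x := by
          rw [← Quotient.out_eq q, hq]
          exact Quotient.sound (r.symm ⟨l, rfl⟩)
        rw [this, hk, hmod, hmod l] at hq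
        exact (inj _ _ x hk' (Nat.mod_lt _ hn) hq).symm
      · intro h
        refine ⟨Quotient.mk r x, ?_⟩
        rw [hk, hmod, hmod l, h]
    refine ⟨if k % n = 0 then 0 else n - k % n, by split_ifs <;> omega, fun j hj => ?_⟩
    rw [hd]
    rcases Nat.eq_zero_or_pos j with rfl | hj0
    · rw [Nat.sub_zero, Nat.mod_self]
      split_ifs <;> omega
    · rw [Nat.mod_eq_of_lt (by omega : n - j < n)]
      split_ifs <;> omega
  let e : AddMonoid.End (V →₀ ℤ) := Finsupp.filterAddHom (· ∈ dom)
  refine ⟨?_, e, ?_⟩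
  · refine Finsupp.addHom_ext' fun x => AddMonoidHom.ext_int ?_
    change ((pushEnd σ) ^ n)
      (Finsupp.single x 1) = Finsupp.single x 1
    rw [pw, h1]
  · refine Finsupp.addHom_ext' fun x => AddMonoidHom.ext_int ?_
    change (∑ i ∈ range n, (pushEnd σ) ^ i *
      e * (pushEnd σ) ^ (n - i))
      (Finsupp.single x 1) = Finsupp.single x 1
    obtain ⟨i, hi, hd⟩ := hdom x
    rw [sum_apply', Finset.sum_eq_single_of_mem i (mem_range.2 hi)]
    · rw [mul_apply', mul_apply', pw]
      change (pushEnd σ ^ i) (Finsupp.filter (· ∈ dom) _) = _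
      rw [Finsupp.filter_single_of_pos _ ((hd i hi).2 rfl), pw, ← Function.iterate_add_apply,
        Nat.add_sub_cancel' hi.le, h1]
    · intro j hj hne
      rw [mul_apply', mul_apply', pw]
      change (pushEnd σ ^ j) (Finsupp.filter (· ∈ dom) _) = _
      rw [Finsupp.filter_single_of_neg _ (fun h => hne ((hd j (mem_range.1 hj)).1 h)), map_zero]

/-- There is no free action of a finite cyclic group on an acyclic complex of dimension two. -/
theorem no_acyclic {C₀ C₁ C₂ : Type*} [AddCommGroup C₀] [AddCommGroup C₁] [AddCommGroup C₂]
    {t₀ : AddMonoid.End C₀} {t₁ : AddMonoid.End C₁} {t₂ : AddMonoid.End C₂} {n : ℕ} (hn : n ≠ 1)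
    (h₀ : InducedEnd t₀ n) (h₁ : InducedEnd t₁ n) (h₂ : InducedEnd t₂ n)
    (δ₂ : C₂ →+ C₁) (δ₁ : C₁ →+ C₀) (ε : C₀ →+ ℤ) (e₂ : ∀ c, δ₂ (t₂ c) = t₁ (δ₂ c))
    (e₁ : ∀ c, δ₁ (t₁ c) = t₀ (δ₁ c)) (e₀ : ∀ c, ε (t₀ c) = ε c)
    (inj : ∀ c, δ₂ c = 0 → c = 0) (z₁ : ∀ c, δ₁ (δ₂ c) = 0) (z₀ : ∀ c, ε (δ₁ c) = 0)
    (c₀ : C₀) (c₁ : C₁) (c₂ : C₂) (hc₀ : ε c₀ = 1) (hc₁ : δ₁ c₁ = c₀ - t₀ c₀)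
    (hc₂ : (∑ i ∈ range n, t₁ ^ i) c₁ = δ₂ c₂) : False := by
  have hT : ∀ c, t₁ ((∑ i ∈ range n, t₁ ^ i) c) = (∑ i ∈ range n, t₁ ^ i) c := by
    intro c
    have : t₁ * ∑ i ∈ range n, t₁ ^ i = ∑ i ∈ range n, t₁ ^ i := by
      have := mul_geom_sum t₁ n
      rw [h₁.1, sub_self, sub_mul, one_mul] at this
      exact sub_eq_zero.1 this
    rw [← mul_apply', this]
  have hpow : ∀ (i : ℕ) c, δ₂ ((t₂ ^ i) c) = (t₁ ^ i) (δ₂ c) := by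
    intro i c
    induction i with
    | zero => rfl
    | succ i ih => rw [pow_succ', pow_succ', mul_apply', e₂, ih]; rfl
  have hpow0 : ∀ (i : ℕ) c, ε ((t₀ ^ i) c) = ε c := by
    intro i c
    induction i with
    | zero => rfl
    | succ i ih => rw [pow_succ', mul_apply', e₀, ih]
  have h : t₂ c₂ = c₂ := by
    refine sub_eq_zero.1 (inj _ ?_)
    rw [map_sub, e₂, ← hc₂, hT, sub_self]
  obtain ⟨d, rfl⟩ := h₂.exists_norm h
  obtain ⟨e, he⟩ := h₁.exists_sub (c := c₁ - δ₂ d) (by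
    rw [map_sub, hc₂, sum_apply', sum_apply', map_sum]
    simp only [hpow, sub_self])
  have he' := congrArg δ₁ he
  rw [map_sub, hc₁, z₁, sub_zero, map_sub, e₁] at he'
  obtain ⟨b, hb⟩ := h₀.exists_norm (c := c₀ - δ₁ e) (by
    rw [map_sub, sub_eq_sub_iff_add_eq_add]
    rw [sub_eq_sub_iff_add_eq_add] at he'
    rw [add_comm, ← he'])
  have := congrArg ε hb
  rw [map_sub, hc₀, z₀, sub_zero, sum_apply', map_sum] at this
  simp only [hpow0, sum_const, card_range, nsmul_eq_mul] at this
  have h1 : (n : ℤ) ∣ 1 := ⟨_, this⟩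
  exact hn (by exact_mod_cast Int.eq_one_of_dvd_one (by positivity) h1)

end InducedEnd

theorem InducedEnd.ofAction {G V : Type*} [Group G] (σ : G → V → V) (one : ∀ x, σ 1 x = x)
    (mul : ∀ p q x, σ (p * q) x = σ p (σ q x)) {g : G} {n : ℕ} (hn : 0 < n)
    (hg : ∀ x, σ (g ^ n) x = x) (free : ∀ i, 0 < i → i < n → ∀ x, σ (g ^ i) x ≠ x) :
    InducedEnd (pushEnd (σ g)) n := by
  have key : ∀ k x, (σ g)^[k] x = σ (g ^ k) x := by
    intro k x
    induction k generalizing x with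
    | zero => simp [one]
    | succ k ih => rw [Function.iterate_succ_apply, ih, pow_succ, mul]
  refine InducedEnd.ofFree hn (fun x => ?_) (fun x i h h' => ?_)
  · rw [key, hg]
  · rw [key]
    exact free i h h' x

theorem InducedEnd.ofAction_of_pow_eq_one {G V : Type*} [Group G] (σ : G → V → V)
    (one : ∀ x, σ 1 x = x) (mul : ∀ p q x, σ (p * q) x = σ p (σ q x)) {g : G} {n : ℕ}
    (hn : 0 < n) (hg : g ^ n = 1) (free : ∀ i, 0 < i → i < n → ∀ x, σ (g ^ i) x ≠ x) :
    InducedEnd (pushEnd (σ g)) n :=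
  .ofAction σ one mul hn (fun x => by rw [hg, one]) free

/-- A vanishing pushforward forces a second support point in each fibre. -/
theorem exists_ne_of_mapDomain {V W : Type*} {f : V → W} {c : V →₀ ℤ} {x : V} (hx : c x ≠ 0)
    (h : Finsupp.mapDomain f c (f x) = 0) : ∃ y, y ≠ x ∧ f y = f x ∧ c y ≠ 0 := by
  classical
  by_contra! hc
  rw [← Finsupp.single_add_erase x c, Finsupp.mapDomain_add, Finsupp.mapDomain_single,
    Finsupp.add_apply, Finsupp.single_eq_same] at h
  have h0 : Finsupp.mapDomain f (Finsupp.erase x c) (f x) ≠ 0 := by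
    intro h0
    rw [h0, add_zero] at h
    exact hx h
  have := Finsupp.mapDomain_support (Finsupp.mem_support_iff.2 h0)
  obtain ⟨y, hy, e⟩ := Finset.mem_image.1 this
  rw [Finsupp.support_erase, Finset.mem_erase] at hy
  exact Finsupp.mem_support_iff.1 hy.2 (hc y hy.1 e)

/-- The sum of the coefficients. -/
noncomputable def augmentation (V : Type*) : (V →₀ ℤ) →+ ℤ :=
  Finsupp.liftAddHom fun _ => AddMonoidHom.id ℤ

theorem augmentation_single {V : Type*} (v : V) (k : ℤ) :
    augmentation V (Finsupp.single v k) = k := by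
  simp [augmentation]

theorem augmentation_mapDomain {V W : Type*} (f : V → W) (c : V →₀ ℤ) :
    augmentation W (Finsupp.mapDomain f c) = augmentation V c := by
  induction c using Finsupp.induction_linear with
  | zero => simp
  | add a b ha hb => rw [Finsupp.mapDomain_add, map_add, map_add, ha, hb]
  | single v k => rw [Finsupp.mapDomain_single, augmentation_single, augmentation_single]

namespace LargeGroup

variable {G S : Type u} [Group G] (D : LargeGroup G S)

/-- Translates of the cyclic subgroups generated by the generators. -/
abbrev Line : Type u := {R : Set G // ∃ (g : G) (s : S), R = g • (D.H {s} : Set G)}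

variable {D}

theorem mem_H_singleton {s : S} {g : G} : g ∈ D.H {s} ↔ ∃ k : ℤ, g = D.gen s ^ k := by
  rw [H, Set.image_singleton, ← Subgroup.zpowers_eq_closure, Subgroup.mem_zpowers_iff]
  exact exists_congr fun k => eq_comm

theorem line_eq (R : D.Line) {g : G} (hg : g ∈ R.1) : ∃ s, R.1 = g • (D.H {s} : Set G) := by
  obtain ⟨_, h, s, rfl⟩ := R
  exact ⟨s, coset_eq hg⟩

theorem line_nonempty (R : D.Line) : ∃ g, g ∈ R.1 := by
  obtain ⟨_, h, s, rfl⟩ := R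
  exact ⟨h, self_mem_coset⟩

theorem mem_line_iff {g h : G} {s : S} :
    h ∈ g • (D.H {s} : Set G) ↔ ∃ k : ℤ, h = g * D.gen s ^ k := by
  rw [mem_coset_iff, mem_H_singleton]
  simp only [inv_mul_eq_iff_eq_mul]

variable (D) in
/-- The line through an element. -/
def line (g : G) (s : S) : D.Line := ⟨g • (D.H {s} : Set G), g, s, rfl⟩

theorem line_mul_gen (g : G) (s : S) (k : ℤ) : D.line (g * D.gen s ^ k) s = D.line g s :=
  Subtype.ext (coset_eq (mem_line_iff.2 ⟨k, rfl⟩)).symm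

theorem self_mem_line (g : G) (s : S) : g ∈ (D.line g s).1 := self_mem_coset

theorem line_subset_block {R : D.Line} {B : D.Block} {g : G} {s : S} {k : ℤ}
    (e : R.1 = g • (D.H {s} : Set G)) (hg : g ∈ B.1) (hk : k ≠ 0) (h : g * D.gen s ^ k ∈ B.1) :
    R.1 ⊆ B.1 := by
  intro x hx
  rw [e, mem_line_iff] at hx
  obtain ⟨l, rfl⟩ := hx
  exact mem_block_of hg hk h l

/-- Left translation of lines. -/
def actL (p : G) (R : D.Line) : D.Line :=
  ⟨p • R.1, by
    obtain ⟨g, s, e⟩ := R.2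
    exact ⟨p * g, s, by rw [e, mul_smul]⟩⟩

theorem mem_actL {p g : G} {R : D.Line} : g ∈ (actL p R).1 ↔ p⁻¹ * g ∈ R.1 :=
  Set.mem_smul_set_iff_inv_smul_mem

theorem mul_mem_actL {p g : G} {R : D.Line} : p * g ∈ (actL p R).1 ↔ g ∈ R.1 := by
  rw [mem_actL, inv_mul_cancel_left]

@[simp] theorem actL_one (R : D.Line) : actL 1 R = R := Subtype.ext (one_smul _ _)

theorem actL_mul (p q : G) (R : D.Line) : actL (p * q) R = actL p (actL q R) :=
  Subtype.ext (mul_smul _ _ _)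

theorem actL_line (p g : G) (s : S) : actL p (D.line g s) = D.line (p * g) s :=
  Subtype.ext (mul_smul _ _ _).symm

theorem act_subset_iff {p : G} {R : D.Line} {B : D.Block} :
    (actL p R).1 ⊆ (actB p B).1 ↔ R.1 ⊆ B.1 := Set.smul_set_subset_smul_set_iff

theorem eq_one_of_conj_gen {p h : G} {s : S} {k : ℤ} {n : ℕ} (hn : n ≠ 0) (hp : p ^ n = 1)
    (e : h⁻¹ * p * h = D.gen s ^ k) : p = 1 := by
  have h1 : (h⁻¹ * p * h) ^ n = 1 := by
    have := conj_pow (a := h⁻¹) (b := p) (i := n)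
    rw [inv_inv] at this
    rw [this, hp]; group
  rw [e, ← zpow_natCast, ← zpow_mul] at h1
  have hk : k = 0 := by
    by_contra hk
    exact zpow_ne_one (mul_ne_zero hk (by exact_mod_cast hn)) h1
  rw [hk, zpow_zero, mul_assoc, inv_mul_eq_one] at e
  exact mul_eq_right.1 e.symm

theorem eq_one_of_actL {p : G} {n : ℕ} (hn : n ≠ 0) (hp : p ^ n = 1) {R : D.Line}
    (h : actL p R = R) : p = 1 := by
  obtain ⟨x, hx⟩ := line_nonempty R
  obtain ⟨s, e⟩ := line_eq R hx
  have h1 : p * x ∈ R.1 := by rw [← h]; exact mul_mem_actL.2 hx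
  rw [e, mem_line_iff] at h1
  obtain ⟨k, hk⟩ := h1
  exact eq_one_of_conj_gen (D := D) hn hp (h := x) (s := s) (k := k) (by rw [mul_assoc, hk]; group)

theorem eq_one_of_actB {p : G} {n : ℕ} (hn : n ≠ 0) (hp : p ^ n = 1) {B : D.Block}
    (h : actB p B = B) : p = 1 := by
  obtain ⟨x, hx⟩ := block_nonempty B
  obtain ⟨a, b, hab, e⟩ := block_eq B hx
  have h1 : p * x ∈ B.1 := by rw [← h]; exact mul_mem_actB.2 hx
  rw [e, mem_coset_iff, ← mul_assoc] at h1
  have h2 : (x⁻¹ * p * x) ^ n = 1 := by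
    have := conj_pow (a := x⁻¹) (b := p) (i := n)
    rw [inv_inv] at this
    rw [this, hp]; group
  have h3 := D.pair_root hab h1 hn (by rw [h2]; exact one_mem _)
  obtain ⟨k, hk⟩ := Subgroup.mem_zpowers_iff.1 h3
  exact eq_one_of_conj_gen hn hp hk.symm

theorem Level.few_letters (Λ : Level D ∅) {h : G} {a b c : S} {i j k : ℤ} (hab : a ≠ b)
    (hac : a ≠ c) (hbc : b ≠ c) (hi : i ≠ 0) (hj : j ≠ 0) (hk : k ≠ 0)
    (h1 : Λ.lev (.inl (h * D.gen a ^ i)) ≤ Λ.lev (.inl h))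
    (h2 : Λ.lev (.inl (h * D.gen b ^ j)) ≤ Λ.lev (.inl h))
    (h3 : Λ.lev (.inl (h * D.gen c ^ k)) ≤ Λ.lev (.inl h)) : False := by
  generalize hn : Λ.lev (.inl h) = n at h1 h2 h3
  rcases n with - | n
  · have e1 : h ∈ D.H ∅ := (Λ.zero_iff _).1 hn
    have e2 : h * D.gen a ^ i ∈ D.H ∅ := (Λ.zero_iff _).1 (Nat.le_zero.1 h1)
    exact letter_mem_of_base e1 hi e2
  have low : ∀ (a : S) (i : ℤ), i ≠ 0 → Λ.lev (.inl (h * D.gen a ^ i)) ≤ n + 1 →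
      ∃ u, D.graph.Adj (.inl h) u ∧ Λ.lev u = n ∧ ((∃ l : ℤ, l ≠ 0 ∧ u = .inl (h * D.gen a ^ l)) ∨
        ∃ B : D.Block, u = .inr B ∧ ∃ l : ℤ, l ≠ 0 ∧ h * D.gen a ^ l ∈ B.1) := by
    intro a i hi hl
    have hadj : D.graph.Adj (.inl h) (.inl (h * D.gen a ^ i)) := ⟨a, i, hi, rfl⟩
    have := Λ.le_succ hadj
    rcases (by omega : Λ.lev (.inl (h * D.gen a ^ i)) = n ∨
      Λ.lev (.inl (h * D.gen a ^ i)) = n + 1) with h4 | h4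
    · exact ⟨_, hadj, h4, Or.inl ⟨i, hi, rfl⟩⟩
    · obtain ⟨u, hu1, hu2, hu3⟩ := Λ.common hadj hn h4
      refine ⟨u, hu1, hu3, ?_⟩
      rcases u with g | B
      · obtain ⟨t, l, hl, rfl⟩ := hu1
        obtain rfl := same_letter hi hl rfl rfl hu2
        exact Or.inl ⟨l, hl, rfl⟩
      · exact Or.inr ⟨B, rfl, i, hi, hu2⟩
  have two : ∀ (a b : S) (i j : ℤ), a ≠ b → i ≠ 0 → j ≠ 0 →
      Λ.lev (.inl (h * D.gen a ^ i)) ≤ n + 1 → Λ.lev (.inl (h * D.gen b ^ j)) ≤ n + 1 →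
      ∃ B : D.Block, D.graph.Adj (.inl h) (.inr B) ∧ Λ.lev (.inr B) = n ∧
        (∃ l : ℤ, l ≠ 0 ∧ h * D.gen a ^ l ∈ B.1) ∧ ∃ l : ℤ, l ≠ 0 ∧ h * D.gen b ^ l ∈ B.1 := by
    intro a b i j hab hi hj h1 h2
    obtain ⟨u, hu1, hu2, hu3⟩ := low a i hi h1
    obtain ⟨v, hv1, hv2, hv3⟩ := low b j hj h2
    have := Λ.lower_unique hu1 hv1 (by omega) (by omega)
    rcases hu3 with ⟨l, hl, rfl⟩ | ⟨B, rfl, l, hl, hB⟩ <;>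
      rcases hv3 with ⟨m, hm, rfl⟩ | ⟨B', rfl, m, hm, hB'⟩
    · rcases this with h5 | h5
      · exact absurd (letter_eq (mul_left_cancel (Sum.inl_injective h5)) hl) hab
      · exact absurd (same_letter hl hm rfl rfl h5) hab
    · rcases this with h5 | h5
      · cases h5
      · exact ⟨B', hv1, hv2, ⟨l, hl, h5⟩, m, hm, hB'⟩
    · rcases this with h5 | h5
      · cases h5
      · exact ⟨B, hu1, hu2, ⟨l, hl, hB⟩, m, hm, h5⟩
    · rcases this with h5 | h5
      · cases h5
        exact ⟨B, hu1, hu2, ⟨l, hl, hB⟩, m, hm, hB'⟩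
      · exact absurd h5 adj_bb
  obtain ⟨B, hB1, hB2, ⟨l, hl, hBa⟩, m, hm, hBb⟩ := two a b i j hab hi hj h1 h2
  obtain ⟨B', hB1', hB2', -, m', hm', hBc⟩ := two a c i k hac hi hk h1 h3
  obtain rfl := Λ.lower_block_unique hB1 hB1' (by omega) (by omega)
  obtain ⟨x, y, hxy, e⟩ := block_eq B hB1
  rw [e] at hBa hBb hBc
  have ha := letter_of_mem hl hBa
  have hb := letter_of_mem hm hBb
  have hc := letter_of_mem hm' hBc
  rcases ha with rfl | rfl <;> rcases hb with rfl | rfl <;> rcases hc with rfl | rfl <;> tauto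

end LargeGroup

namespace LargeGroup

variable {G S : Type u} [Group G] (D : LargeGroup G S)

/-- Vertices of the complex of cosets. -/
abbrev Cell₀ : Type u := G ⊕ D.Line ⊕ D.Block

/-- Edges of the complex of cosets, together with degenerate ones. -/
abbrev Cell₁ : Type u := (G × D.Line) ⊕ (D.Line × D.Block) ⊕ (G × D.Block)

/-- Triangles of the complex of cosets. -/
abbrev Cell₂ : Type u := {x : G × D.Line × D.Block // x.1 ∈ x.2.1.1 ∧ x.2.1.1 ⊆ x.2.2.1}

variable {D}

/-- Translation of vertices. -/
def act₀ (p : G) : D.Cell₀ → D.Cell₀ := Sum.map (p * ·) (Sum.map (actL p) (actB p))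

/-- Translation of edges. -/
def act₁ (p : G) : D.Cell₁ → D.Cell₁ :=
  Sum.map (Prod.map (p * ·) (actL p)) (Sum.map (Prod.map (actL p) (actB p))
    (Prod.map (p * ·) (actB p)))

/-- Translation of triangles. -/
def act₂ (p : G) : D.Cell₂ → D.Cell₂ :=
  Subtype.map (Prod.map (p * ·) (Prod.map (actL p) (actB p)))
    fun _ h => ⟨mul_mem_actL.2 h.1, act_subset_iff.2 h.2⟩

theorem inducedEnd_act₀ {g : G} {n : ℕ} (hn : 0 < n) (hg : g ^ n = 1)
    (h : ∀ i, 0 < i → i < n → g ^ i ≠ 1) : InducedEnd (pushEnd (act₀ (D := D) g)) n := by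
  refine InducedEnd.ofAction_of_pow_eq_one _ ?_ ?_ hn hg ?_
  · rintro (x | x | x) <;> simp [act₀]
  · rintro p q (x | x | x) <;> simp [act₀, mul_assoc, actL_mul, actB_mul]
  · have hp : ∀ i, (g ^ i) ^ n = 1 := fun i => by rw [pow_right_comm, hg, one_pow]
    rintro i h1 h2 (x | x | x) e
    · exact h i h1 h2 (mul_eq_right.1 (Sum.inl_injective e))
    · exact h i h1 h2 (eq_one_of_actL hn.ne' (hp i) (Sum.inl_injective (Sum.inr_injective e)))
    · exact h i h1 h2 (eq_one_of_actB hn.ne' (hp i) (Sum.inr_injective (Sum.inr_injective e)))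

theorem inducedEnd_act₁ {g : G} {n : ℕ} (hn : 0 < n) (hg : g ^ n = 1)
    (h : ∀ i, 0 < i → i < n → g ^ i ≠ 1) : InducedEnd (pushEnd (act₁ (D := D) g)) n := by
  refine InducedEnd.ofAction_of_pow_eq_one _ ?_ ?_ hn hg ?_
  · rintro (⟨x, y⟩ | ⟨x, y⟩ | ⟨x, y⟩) <;> simp [act₁]
  · rintro p q (⟨x, y⟩ | ⟨x, y⟩ | ⟨x, y⟩) <;> simp [act₁, mul_assoc, actL_mul, actB_mul]
  · have hp : ∀ i, (g ^ i) ^ n = 1 := fun i => by rw [pow_right_comm, hg, one_pow]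
    rintro i h1 h2 (⟨x, y⟩ | ⟨x, y⟩ | ⟨x, y⟩) e
    · exact h i h1 h2 (mul_eq_right.1 (congrArg Prod.fst (Sum.inl_injective e)))
    · exact h i h1 h2 (eq_one_of_actB hn.ne' (hp i)
        (congrArg Prod.snd (Sum.inl_injective (Sum.inr_injective e))))
    · exact h i h1 h2 (mul_eq_right.1
        (congrArg Prod.fst (Sum.inr_injective (Sum.inr_injective e))))

theorem inducedEnd_act₂ {g : G} {n : ℕ} (hn : 0 < n) (hg : g ^ n = 1)
    (h : ∀ i, 0 < i → i < n → g ^ i ≠ 1) : InducedEnd (pushEnd (act₂ (D := D) g)) n := by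
  refine InducedEnd.ofAction_of_pow_eq_one _ ?_ ?_ hn hg ?_
  · rintro ⟨⟨x, y, z⟩, h⟩
    simp [act₂, Subtype.map]
  · rintro p q ⟨⟨x, y, z⟩, h⟩
    simp [act₂, Subtype.map, mul_assoc, actL_mul, actB_mul]
  · rintro i h1 h2 ⟨⟨x, y, z⟩, h'⟩ e
    exact h i h1 h2 (mul_eq_right.1 (congrArg (fun x => x.1.1) e))

/-- The first edge of a triangle. -/
def Cell₂.fst (x : D.Cell₂) : G × D.Line := (x.1.1, x.1.2.1)

/-- The second edge of a triangle. -/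
def Cell₂.snd (x : D.Cell₂) : D.Line × D.Block := x.1.2

/-- The long edge of a triangle. -/
def Cell₂.long (x : D.Cell₂) : G × D.Block := (x.1.1, x.1.2.2)

/-- The source of an edge. -/
def Cell₁.src : D.Cell₁ → D.Cell₀ :=
  Sum.elim (fun e => .inl e.1) (Sum.elim (fun e => .inr (.inl e.1)) fun e => .inl e.1)

/-- The target of an edge. -/
def Cell₁.tgt : D.Cell₁ → D.Cell₀ :=
  Sum.elim (fun e => .inr (.inl e.2)) (Sum.elim (fun e => .inr (.inr e.2)) fun e => .inr (.inr e.2))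

/-- The boundary of triangles. -/
noncomputable def bd₂ : (D.Cell₂ →₀ ℤ) →+ (D.Cell₁ →₀ ℤ) :=
  Finsupp.mapDomain.addMonoidHom (fun x => Sum.inl (Cell₂.fst x)) +
    Finsupp.mapDomain.addMonoidHom (fun x => Sum.inr (Sum.inl (Cell₂.snd x))) -
    Finsupp.mapDomain.addMonoidHom (fun x => Sum.inr (Sum.inr (Cell₂.long x)))

/-- The boundary of edges. -/
noncomputable def bd₁ : (D.Cell₁ →₀ ℤ) →+ (D.Cell₀ →₀ ℤ) :=
  Finsupp.mapDomain.addMonoidHom Cell₁.tgt - Finsupp.mapDomain.addMonoidHom Cell₁.src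

theorem bd₂_apply (c : D.Cell₂ →₀ ℤ) : bd₂ c =
    Finsupp.mapDomain (fun x => Sum.inl (Cell₂.fst x)) c +
    Finsupp.mapDomain (fun x => Sum.inr (Sum.inl (Cell₂.snd x))) c -
    Finsupp.mapDomain (fun x => Sum.inr (Sum.inr (Cell₂.long x))) c := rfl

theorem bd₁_apply (c : D.Cell₁ →₀ ℤ) : bd₁ c =
    Finsupp.mapDomain Cell₁.tgt c - Finsupp.mapDomain Cell₁.src c := rfl

theorem pushEnd_apply {V : Type*} (σ : V → V) (c : V →₀ ℤ) :
    pushEnd σ c = Finsupp.mapDomain σ c := rfl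

theorem bd₂_act (g : G) (c : D.Cell₂ →₀ ℤ) :
    bd₂ (pushEnd (act₂ g) c) = pushEnd (act₁ g) (bd₂ c) := by
  rw [bd₂_apply, bd₂_apply, map_sub, map_add]
  simp only [pushEnd_apply, ← Finsupp.mapDomain_comp]
  rfl

theorem bd₁_act (g : G) (c : D.Cell₁ →₀ ℤ) :
    bd₁ (pushEnd (act₁ g) c) = pushEnd (act₀ g) (bd₁ c) := by
  have h1 : (Cell₁.tgt ∘ act₁ g : D.Cell₁ → D.Cell₀) = act₀ g ∘ Cell₁.tgt := by
    ext (x | x | x) <;> rfl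
  have h2 : (Cell₁.src ∘ act₁ g : D.Cell₁ → D.Cell₀) = act₀ g ∘ Cell₁.src := by
    ext (x | x | x) <;> rfl
  rw [bd₁_apply, bd₁_apply, map_sub]
  simp only [pushEnd_apply, ← Finsupp.mapDomain_comp, h1, h2]

theorem bd₁_bd₂ (c : D.Cell₂ →₀ ℤ) : bd₁ (bd₂ c) = 0 := by
  rw [bd₂_apply, map_sub, map_add]
  simp only [bd₁_apply, ← Finsupp.mapDomain_comp]
  change Finsupp.mapDomain (fun x : D.Cell₂ => (.inr (.inl x.1.2.1) : D.Cell₀)) c -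
    Finsupp.mapDomain (fun x : D.Cell₂ => (.inl x.1.1 : D.Cell₀)) c +
    (Finsupp.mapDomain (fun x : D.Cell₂ => (.inr (.inr x.1.2.2) : D.Cell₀)) c -
    Finsupp.mapDomain (fun x : D.Cell₂ => (.inr (.inl x.1.2.1) : D.Cell₀)) c) -
    (Finsupp.mapDomain (fun x : D.Cell₂ => (.inr (.inr x.1.2.2) : D.Cell₀)) c -
    Finsupp.mapDomain (fun x : D.Cell₂ => (.inl x.1.1 : D.Cell₀)) c) = 0
  abel

theorem augmentation_bd₁ (c : D.Cell₁ →₀ ℤ) : augmentation _ (bd₁ c) = 0 := by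
  rw [bd₁_apply, map_sub, augmentation_mapDomain, augmentation_mapDomain, sub_self]

theorem bd₂_components {c : D.Cell₂ →₀ ℤ} (h : bd₂ c = 0) :
    Finsupp.mapDomain Cell₂.fst c = 0 ∧ Finsupp.mapDomain Cell₂.snd c = 0 ∧
      Finsupp.mapDomain Cell₂.long c = 0 := by
  have e1 : Finsupp.mapDomain (fun x => Sum.inl (Cell₂.fst x) : D.Cell₂ → D.Cell₁) c =
    Finsupp.mapDomain Sum.inl (Finsupp.mapDomain Cell₂.fst c) := by
    rw [← Finsupp.mapDomain_comp]; rfl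
  have e2 : Finsupp.mapDomain (fun x => Sum.inr (Sum.inl (Cell₂.snd x)) : D.Cell₂ → D.Cell₁) c =
    Finsupp.mapDomain (fun y => Sum.inr (Sum.inl y)) (Finsupp.mapDomain Cell₂.snd c) := by
    rw [← Finsupp.mapDomain_comp]; rfl
  have e3 : Finsupp.mapDomain (fun x => Sum.inr (Sum.inr (Cell₂.long x)) : D.Cell₂ → D.Cell₁) c =
    Finsupp.mapDomain (fun y => Sum.inr (Sum.inr y)) (Finsupp.mapDomain Cell₂.long c) := by
    rw [← Finsupp.mapDomain_comp]; rfl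
  have i1 : Function.Injective (Sum.inl : G × D.Line → D.Cell₁) := Sum.inl_injective
  have i2 : Function.Injective (fun y => Sum.inr (Sum.inl y) : D.Line × D.Block → D.Cell₁) :=
    Sum.inr_injective.comp Sum.inl_injective
  have i3 : Function.Injective (fun y => Sum.inr (Sum.inr y) : G × D.Block → D.Cell₁) :=
    Sum.inr_injective.comp Sum.inr_injective
  rw [bd₂_apply, e1, e2, e3] at h
  generalize Finsupp.mapDomain Cell₂.fst c = u at h ⊢
  generalize Finsupp.mapDomain Cell₂.snd c = v at h ⊢
  generalize Finsupp.mapDomain Cell₂.long c = w at h ⊢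
  refine ⟨?_, ?_, ?_⟩ <;> ext y
  · have := DFunLike.congr_fun h (.inl y)
    rw [Finsupp.sub_apply, Finsupp.add_apply, Finsupp.mapDomain_apply i1,
      Finsupp.mapDomain_of_notMem_range v _ (by simp),
      Finsupp.mapDomain_of_notMem_range w _ (by simp)] at this
    simpa using this
  · have := DFunLike.congr_fun h (.inr (.inl y))
    rw [Finsupp.sub_apply, Finsupp.add_apply, Finsupp.mapDomain_apply i2,
      Finsupp.mapDomain_of_notMem_range u _ (by simp),
      Finsupp.mapDomain_of_notMem_range w _ (by simp)] at this
    simpa using this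
  · have := DFunLike.congr_fun h (.inr (.inr y))
    rw [Finsupp.sub_apply, Finsupp.add_apply, Finsupp.mapDomain_apply i3,
      Finsupp.mapDomain_of_notMem_range u _ (by simp),
      Finsupp.mapDomain_of_notMem_range v _ (by simp)] at this
    simpa using this

theorem bd₂_injective {c : D.Cell₂ →₀ ℤ} (h : bd₂ c = 0) : c = 0 := by
  obtain ⟨Λ⟩ := nonempty_level D ∅
  obtain ⟨h1, h2, h3⟩ := bd₂_components h
  by_contra hc
  obtain ⟨x, hx, hmax⟩ := Finset.exists_max_image c.support (fun x => Λ.lev (.inl x.1.1))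
    (Finsupp.support_nonempty_iff.2 hc)
  rw [Finsupp.mem_support_iff] at hx
  have down : ∀ y : D.Cell₂, y.1.1 = x.1.1 → c y ≠ 0 → ∃ (s : S) (k : ℤ),
      y.1.2.1 = D.line x.1.1 s ∧ k ≠ 0 ∧
        Λ.lev (.inl (x.1.1 * D.gen s ^ k)) ≤ Λ.lev (.inl x.1.1) := by
    intro y e hy
    obtain ⟨z, hz, e', hz0⟩ := exists_ne_of_mapDomain hy (by rw [h2]; rfl)
    obtain ⟨s, hs⟩ := line_eq y.1.2.1 y.2.1
    have e'' : z.1.2 = y.1.2 := e'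
    have hzm := z.2.1
    rw [e'', hs, mem_line_iff, e] at hzm
    obtain ⟨k, hk⟩ := hzm
    refine ⟨s, k, Subtype.ext (by rw [hs, e]; rfl), ?_, ?_⟩
    · rintro rfl
      refine hz (Subtype.ext (Prod.ext ?_ e''))
      rw [hk, e, zpow_zero, mul_one]
    · rw [← hk]
      exact hmax z (Finsupp.mem_support_iff.2 hz0)
  obtain ⟨s, i, ex, hi, hxl⟩ := down x rfl hx
  obtain ⟨y, hy, ey, hy0⟩ := exists_ne_of_mapDomain hx (by rw [h3]; rfl)
  obtain ⟨z, hz, ez, hz0⟩ := exists_ne_of_mapDomain hx (by rw [h1]; rfl)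
  obtain ⟨w, hw, ew, hw0⟩ := exists_ne_of_mapDomain hz0 (by rw [h3]; rfl)
  obtain ⟨ey1, ey2⟩ := Prod.ext_iff.1 ey
  obtain ⟨ez1, ez2⟩ := Prod.ext_iff.1 ez
  obtain ⟨ew1, ew2⟩ := Prod.ext_iff.1 ew
  obtain ⟨t, j, ety, hj, hyl⟩ := down y ey1 hy0
  obtain ⟨r, k, erw, hk, hwl⟩ := down w (ew1.trans ez1) hw0
  have hst : s ≠ t := by
    rintro rfl
    exact hy (Subtype.ext (Prod.ext ey1 (Prod.ext (ety.trans ex.symm) ey2)))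
  have hsr : s ≠ r := by
    rintro rfl
    exact hw (Subtype.ext (Prod.ext ew1 (Prod.ext (erw.trans (ex.symm.trans ez2.symm)) ew2)))
  have htr : t ≠ r := by
    rintro rfl
    have hxB := x.2.2
    have hzB := z.2.2
    have hyB := y.2.2
    have hwB := w.2.2
    have ez2 : z.1.2.1 = x.1.2.1 := ez2
    have ey2 : y.1.2.2 = x.1.2.2 := ey2
    have ew2 : w.1.2.2 = z.1.2.2 := ew2
    rw [ex] at hxB
    rw [ez2, ex] at hzB
    rw [ety, ey2] at hyB
    rw [erw, ew2] at hwB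
    have m1 : ∀ s, x.1.1 ∈ (D.line x.1.1 s).1 := fun s => self_mem_line _ _
    have m2 : ∀ s, x.1.1 * D.gen s ^ (1 : ℤ) ∈ (D.line x.1.1 s).1 :=
      fun s => mem_line_iff.2 ⟨1, rfl⟩
    have := block_unique hst one_ne_zero one_ne_zero (hxB (m1 s)) (hzB (m1 s)) (hxB (m2 s))
      (hzB (m2 s)) (hyB (m2 t)) (hwB (m2 t))
    exact hz (Subtype.ext (Prod.ext ez1 (Prod.ext ez2 this.symm)))
  exact Λ.few_letters hst hsr htr hi hj hk hxl hyl hwl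

end LargeGroup

namespace LargeGroup

variable {G S : Type u} [Group G] {D : LargeGroup G S}

theorem closure_induction {P : G → Prop} (one : P 1) (gen : ∀ s, P (D.gen s))
    (mul : ∀ x y, P x → P y → P (x * y)) (inv : ∀ x, P x → P x⁻¹) (g : G) : P g := by
  have hg : g ∈ Subgroup.closure (Set.range D.gen) := by rw [D.closure_eq]; trivial
  induction hg using Subgroup.closure_induction with
  | mem x hx => obtain ⟨s, rfl⟩ := hx; exact gen s
  | one => exact one
  | mul x y _ _ hx hy => exact mul x y hx hy
  | inv x _ hx => exact inv x hx

theorem commute_of_gen {Ω : Type*} (φ : G →* Equiv.Perm Ω) (f : Ω → Ω)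
    (h : ∀ s ω, φ (D.gen s) (f ω) = f (φ (D.gen s) ω)) (g : G) (ω : Ω) :
    φ g (f ω) = f (φ g ω) := by
  induction g using closure_induction (D := D) generalizing ω with
  | one => simp
  | gen s => exact h s ω
  | mul x y hx hy => rw [map_mul, Equiv.Perm.mul_apply, Equiv.Perm.mul_apply, hy, hx]
  | inv x hx =>
    rw [map_inv, Equiv.Perm.inv_eq_iff_eq, hx, ← Equiv.Perm.mul_apply, mul_inv_cancel,
      Equiv.Perm.one_apply]

theorem invariant_of_gen {Ω X : Type*} (φ : G →* Equiv.Perm Ω) (f : Ω → X)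
    (h : ∀ s ω, f (φ (D.gen s) ω) = f ω) (g : G) (ω : Ω) : f (φ g ω) = f ω := by
  induction g using closure_induction (D := D) generalizing ω with
  | one => simp
  | gen s => exact h s ω
  | mul x y hx hy => rw [map_mul, Equiv.Perm.mul_apply, hx, hy]
  | inv x hx =>
    rw [← hx ((φ x⁻¹) ω), ← Equiv.Perm.mul_apply, ← map_mul, mul_inv_cancel, map_one,
      Equiv.Perm.one_apply]

variable (D) in
/-- Edges modulo boundaries of triangles. -/
abbrev EdgeQuot : Type u := (D.Cell₁ →₀ ℤ) ⧸ (bd₂ (D := D)).range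

/-- The class of an edge. -/
noncomputable def cls (e : D.Cell₁) : D.EdgeQuot :=
  QuotientAddGroup.mk' _ (Finsupp.single e 1)

theorem cls_rel (x : D.Cell₂) : cls (.inl (Cell₂.fst x)) + cls (.inr (.inl (Cell₂.snd x))) =
    cls (.inr (.inr (Cell₂.long x))) := by
  refine sub_eq_zero.1 ?_
  rw [cls, cls, cls, ← map_add, ← map_sub]
  refine (QuotientAddGroup.eq_zero_iff _).2 ⟨Finsupp.single x 1, ?_⟩
  rw [bd₂_apply, Finsupp.mapDomain_single, Finsupp.mapDomain_single, Finsupp.mapDomain_single]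

theorem cls_sub {g h : G} {R : D.Line} {B : D.Block} (hg : g ∈ R.1) (hh : h ∈ R.1)
    (hR : R.1 ⊆ B.1) : cls (.inl (g, R)) - cls (.inl (h, R)) =
      cls (.inr (.inr (g, B))) - cls (.inr (.inr (h, B))) := by
  have h1 := cls_rel (D := D) ⟨(g, R, B), hg, hR⟩
  have h2 := cls_rel (D := D) ⟨(h, R, B), hh, hR⟩
  simp only [Cell₂.fst, Cell₂.snd, Cell₂.long] at h1 h2
  rw [← h1, ← h2]
  abel

variable (D) in
/-- Steps along generators, recording edge paths. -/
noncomputable def stepPerm (s : S) : Equiv.Perm (D.EdgeQuot × G) where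
  toFun ω := (ω.1 + (cls (.inl (ω.2, D.line ω.2 s)) -
    cls (.inl (ω.2 * (D.gen s)⁻¹, D.line ω.2 s))), ω.2 * (D.gen s)⁻¹)
  invFun ω := (ω.1 - (cls (.inl (ω.2 * D.gen s, D.line ω.2 s)) -
    cls (.inl (ω.2, D.line ω.2 s))), ω.2 * D.gen s)
  left_inv ω := by
    have h := line_mul_gen (D := D) ω.2 s (-1)
    rw [zpow_neg_one] at h
    simp [h]
  right_inv ω := by
    have h := line_mul_gen (D := D) ω.2 s 1
    rw [zpow_one] at h
    simp [h]

theorem stepPerm_apply (s : S) (ω : D.EdgeQuot × G) : D.stepPerm s ω =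
    (ω.1 + (cls (.inl (ω.2, D.line ω.2 s)) -
    cls (.inl (ω.2 * (D.gen s)⁻¹, D.line ω.2 s))), ω.2 * (D.gen s)⁻¹) := rfl

theorem stepPerm_symm_apply (s : S) (ω : D.EdgeQuot × G) : (D.stepPerm s).symm ω =
    (ω.1 - (cls (.inl (ω.2 * D.gen s, D.line ω.2 s)) -
    cls (.inl (ω.2, D.line ω.2 s))), ω.2 * D.gen s) := rfl

theorem line_subset_coset {g h : G} {a b s : S} (hs : s = a ∨ s = b)
    (h1 : h ∈ g • (D.H {a, b} : Set G)) : (D.line h s).1 ⊆ g • (D.H {a, b} : Set G) := by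
  rw [coset_eq h1]
  exact Set.smul_set_mono (H_mono (by rintro _ rfl; exact hs))

theorem exists_stepHom :
    ∃ φ : G →* Equiv.Perm (D.EdgeQuot × G), ∀ s, φ (D.gen s) = D.stepPerm s := by
  refine D.exists_hom _ Prod.snd D.stepPerm (fun s ω => rfl) fun a b hab =>
    ⟨fun ω ω' => ω'.2 ∈ (D.blk ω.2 hab).1 ∧ ω'.1 + cls (.inr (.inr (ω'.2, D.blk ω.2 hab))) =
      ω.1 + cls (.inr (.inr (ω.2, D.blk ω.2 hab))), fun ω => ⟨self_mem_coset, rfl⟩, ?_, ?_⟩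
  · rintro ω ω' s hs ⟨h1, h2⟩
    have hl := line_subset_coset (D := D) hs h1
    have m1 : ω'.2 ∈ (D.line ω'.2 s).1 := self_mem_line _ _
    have m2 : ω'.2 * (D.gen s)⁻¹ ∈ (D.line ω'.2 s).1 :=
      mem_line_iff.2 ⟨-1, by rw [zpow_neg_one]⟩
    have m3 : ω'.2 * D.gen s ∈ (D.line ω'.2 s).1 := mem_line_iff.2 ⟨1, by rw [zpow_one]⟩
    rw [stepPerm_apply, stepPerm_symm_apply, cls_sub (B := D.blk ω.2 hab) m1 m2 hl,
      cls_sub (B := D.blk ω.2 hab) m3 m1 hl]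
    refine ⟨⟨hl m2, ?_⟩, hl m3, ?_⟩
    · rw [← h2]; simp only; abel
    · rw [← h2]; simp only; abel
  · rintro ⟨m, g⟩ ⟨m', g'⟩ ⟨h1, h2⟩ (rfl : g = g')
    exact Prod.ext (add_right_cancel h2).symm rfl

/-- The boundary on edge classes. -/
noncomputable def bdQuot : D.EdgeQuot →+ (D.Cell₀ →₀ ℤ) :=
  QuotientAddGroup.lift _ bd₁ (by rintro _ ⟨c, rfl⟩; exact bd₁_bd₂ c)

theorem bdQuot_cls (e : D.Cell₁) :
    bdQuot (cls e) = Finsupp.single (Cell₁.tgt e) 1 - Finsupp.single (Cell₁.src e) 1 := by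
  change bd₁ (Finsupp.single e 1) = _
  rw [bd₁_apply, Finsupp.mapDomain_single, Finsupp.mapDomain_single]

/-- Translation of edge classes. -/
noncomputable def actQuot (g : G) : AddMonoid.End D.EdgeQuot :=
  QuotientAddGroup.map _ _ (pushEnd (act₁ g)) (by
    rintro _ ⟨c, rfl⟩
    exact ⟨pushEnd (act₂ g) c, bd₂_act g c⟩)

theorem actQuot_cls (g : G) (e : D.Cell₁) : actQuot g (cls e) = cls (act₁ g e) := by
  change QuotientAddGroup.mk' _ (pushEnd (act₁ g) (Finsupp.single e 1)) = _
  rw [pushEnd_apply, Finsupp.mapDomain_single]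
  rfl

theorem exists_chain {g : G} {n : ℕ} (hg : g ^ n = 1) : ∃ (c₁ : D.Cell₁ →₀ ℤ) (c₂ : D.Cell₂ →₀ ℤ),
    bd₁ c₁ = Finsupp.single (.inl 1) 1 - pushEnd (act₀ g) (Finsupp.single (.inl 1) 1) ∧
      (∑ i ∈ Finset.range n, pushEnd (act₁ g) ^ i) c₁ = bd₂ c₂ := by
  obtain ⟨φ, hφ⟩ := exists_stepHom (D := D)
  obtain ⟨⟨d, g'⟩, hd⟩ : ∃ ω, φ g⁻¹ (0, 1) = ω := ⟨_, rfl⟩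
  have h2 : ∀ x ω, (φ x ω).2 = ω.2 * x⁻¹ := by
    intro x ω
    induction x using closure_induction (D := D) generalizing ω with
    | one => simp
    | gen s => rw [hφ]; rfl
    | mul x y hx hy => rw [map_mul, Equiv.Perm.mul_apply, hx, hy]; group
    | inv x hx =>
      have := hx (φ x⁻¹ ω)
      rw [← Equiv.Perm.mul_apply, ← map_mul, mul_inv_cancel, map_one, Equiv.Perm.one_apply] at this
      rw [this]; group
  have hg' : g' = g := by
    have := h2 g⁻¹ (0, 1)
    rw [hd] at this
    simpa using this
  rw [hg'] at hd
  have hbd := invariant_of_gen (D := D) φ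
    (fun ω => bdQuot ω.1 - Finsupp.single (.inl ω.2 : D.Cell₀) 1) (fun s ω => by
      rw [hφ, stepPerm_apply]
      simp only [map_add, map_sub, bdQuot_cls]
      simp only [Cell₁.tgt, Cell₁.src, Sum.elim_inl]
      abel) g⁻¹ (0, 1)
  rw [hd] at hbd
  simp only [map_zero, zero_sub] at hbd
  let f : D.EdgeQuot × G → D.EdgeQuot × G := fun ω => (d + actQuot g ω.1, g * ω.2)
  have hf := commute_of_gen (D := D) φ f (fun s ω => by
    have e := actL_line (D := D) g ω.2 s
    rw [hφ, stepPerm_apply, stepPerm_apply]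
    refine Prod.ext ?_ (mul_assoc _ _ _)
    simp only [f, map_add, map_sub, actQuot_cls]
    simp only [act₁, Sum.map_inl, Prod.map_apply, e, mul_assoc]
    abel) g⁻¹
  have hpow : ∀ k : ℕ, ((φ g⁻¹) ^ k) (0, 1) =
      ((∑ i ∈ Finset.range k, actQuot g ^ i) d, g ^ k) := by
    intro k
    induction k with
    | zero => simp
    | succ k ih =>
      have e0 : φ g⁻¹ (0, 1) = f (0, 1) := by
        rw [hd]; simp [f]
      have e1 : ∀ k : ℕ, ((φ g⁻¹) ^ k) (f (0, 1)) = f (((φ g⁻¹) ^ k) (0, 1)) := by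
        intro k
        induction k with
        | zero => rfl
        | succ k ih => rw [pow_succ', Equiv.Perm.mul_apply, Equiv.Perm.mul_apply, ih, hf]
      rw [pow_succ, Equiv.Perm.mul_apply, e0, e1, ih]
      refine Prod.ext ?_ (pow_succ' _ _).symm
      simp only [f, InducedEnd.sum_apply', map_sum]
      rw [Finset.sum_range_succ', add_comm]
      simp only [pow_succ', InducedEnd.mul_apply']
      rfl
  have hN := hpow n
  rw [← map_pow, inv_pow, hg, inv_one, map_one, Equiv.Perm.one_apply] at hN
  have hN := (congrArg Prod.fst hN).symm
  simp only at hN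
  obtain ⟨c, rfl⟩ := QuotientAddGroup.mk'_surjective _ d
  have hpush : ∀ i : ℕ, (actQuot g ^ i) (QuotientAddGroup.mk' _ c) =
      QuotientAddGroup.mk' (bd₂ (D := D)).range ((pushEnd (act₁ g) ^ i) c) := by
    intro i
    induction i with
    | zero => rfl
    | succ i ih => rw [pow_succ', pow_succ', InducedEnd.mul_apply', ih]; rfl
  rw [InducedEnd.sum_apply'] at hN
  simp only [hpush] at hN
  rw [← map_sum, ← InducedEnd.sum_apply'] at hN
  obtain ⟨c₂, hc₂⟩ := (QuotientAddGroup.eq_zero_iff _).1 hN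
  refine ⟨-c, -c₂, ?_, by rw [map_neg, map_neg, hc₂]⟩
  rw [map_neg, pushEnd_apply, Finsupp.mapDomain_single]
  have : bd₁ c - Finsupp.single (.inl g : D.Cell₀) 1 = -Finsupp.single (.inl 1) 1 := hbd
  rw [sub_eq_iff_eq_add] at this
  rw [this]
  simp only [act₀, Sum.map_inl, mul_one]
  abel

/-- There is no torsion. -/
theorem eq_one_of_pow {g : G} {n : ℕ} (hn : n ≠ 0) (hg : g ^ n = 1) (D : LargeGroup G S) :
    g = 1 := by
  have ho : 0 < orderOf g := orderOf_pos_iff.2 (isOfFinOrder_iff_pow_eq_one.2 ⟨n, by omega, hg⟩)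
  by_contra h1
  have hf : ∀ i, 0 < i → i < orderOf g → g ^ i ≠ 1 := fun i h h' h'' =>
    (orderOf_le_of_pow_eq_one h h'').not_gt h'
  obtain ⟨c₁, c₂, h2, h3⟩ := exists_chain (D := D) (pow_orderOf_eq_one g)
  exact InducedEnd.no_acyclic (fun h => h1 (orderOf_eq_one_iff.1 h))
    (inducedEnd_act₀ ho (pow_orderOf_eq_one g) hf) (inducedEnd_act₁ ho (pow_orderOf_eq_one g) hf)
    (inducedEnd_act₂ ho (pow_orderOf_eq_one g) hf) bd₂ bd₁ (augmentation _) (bd₂_act g) (bd₁_act g)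
    (augmentation_mapDomain _) (fun _ => bd₂_injective) bd₁_bd₂ augmentation_bd₁ _ c₁ c₂
    (augmentation_single _ _) h2 h3

end LargeGroup

namespace LargeGroup

variable {G S : Type u} [Group G] {D : LargeGroup G S}

theorem actL_eq_of {p h : G} {t : S} {k : ℤ} {R : D.Line} (hR : R.1 = h • (D.H {t} : Set G))
    (e : p * h = h * D.gen t ^ k) : actL p R = R := by
  have : R = D.line h t := Subtype.ext hR
  rw [this, actL_line, e, line_mul_gen]

theorem exists_of_actL {p h : G} {R : D.Line} (hp : p ≠ 1) (hR : actL p R = R) (hh : h ∈ R.1) :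
    ∃ (t : S) (k : ℤ), k ≠ 0 ∧ R.1 = h • (D.H {t} : Set G) ∧ p * h = h * D.gen t ^ k := by
  obtain ⟨t, ht⟩ := line_eq R hh
  have h1 : p * h ∈ R.1 := by rw [← hR]; exact mul_mem_actL.2 hh
  rw [ht, mem_line_iff] at h1
  obtain ⟨k, hk⟩ := h1
  refine ⟨t, k, ?_, ht, hk⟩
  rintro rfl
  rw [zpow_zero, mul_one] at hk
  exact hp (mul_eq_right.1 hk)

theorem actB_eq_of_actL {p : G} {R : D.Line} {B : D.Block} (hR : actL p R = R) (h : R.1 ⊆ B.1) :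
    actB p B = B := by
  obtain ⟨x, hx⟩ := line_nonempty R
  obtain ⟨a, b, hab, e⟩ := block_eq B (h hx)
  have h1 : p * x ∈ B.1 := h (by rw [← hR]; exact mul_mem_actL.2 hx)
  refine Subtype.ext ?_
  change p • B.1 = B.1
  rw [e] at h1 ⊢
  rw [← mul_smul]
  exact (coset_eq h1).symm

theorem block_not_subset {B : D.Block} {s : S} : ¬ B.1 ⊆ D.H {s} := by
  intro h
  obtain ⟨x, hx⟩ := block_nonempty B
  obtain ⟨a, b, hab, e⟩ := block_eq B hx
  have key : ∀ t, t = a ∨ t = b → t = s := by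
    intro t ht
    have h2 : x * D.gen t ^ (1 : ℤ) ∈ B.1 := by
      rw [e]; exact mul_mem_coset (X := {a, b}) ht 1
    exact letter_mem_of_base (X := {s}) (h hx) one_ne_zero (h h2)
  exact D.fin_ne hab ((key a (Or.inl rfl)).trans (key b (Or.inr rfl)).symm)

namespace Level

variable {s : S} (Λ : Level D {s}) {p : G}

theorem block_pos (B : D.Block) : ∃ m, Λ.lev (.inr B) = m + 1 := by
  refine Nat.exists_eq_succ_of_ne_zero fun h => ?_
  exact block_not_subset ((Λ.zero_iff _).1 h)

theorem line_cases (hp : p ∈ D.H {s}) (h1 : p ≠ 1) {R : D.Line} (hR : actL p R = R) :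
    (R = D.line 1 s ∧ ∀ h ∈ R.1, Λ.lev (.inl h) = 0) ∨
      ∃ B : D.Block, R.1 ⊆ B.1 ∧ ∀ h ∈ R.1, Λ.lev (.inl h) = Λ.lev (.inr B) + 1 := by
  obtain ⟨u, hu, hmin⟩ : ∃ u ∈ R.1, ∀ v ∈ R.1, Λ.lev (.inl u) ≤ Λ.lev (.inl v) := by
    have hne : R.1.Nonempty := line_nonempty R
    let f : G → ℕ := fun v => Λ.lev (.inl v)
    exact ⟨Function.argminOn f R.1 hne, Function.argminOn_mem f R.1 hne,
      fun v hv => Function.argminOn_le f R.1 hv⟩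
  obtain ⟨t, k, hk, e, e'⟩ := exists_of_actL h1 hR hu
  have hl := Λ.lev_mul hp u
  generalize hm : Λ.lev (.inl u) = m at hl hmin
  rcases m with - | m
  · left
    have hu0 : u ∈ D.H {s} := (Λ.zero_iff _).1 hm
    have hu1 : u * D.gen t ^ k ∈ D.H {s} := by rw [← e']; exact mul_mem hp hu0
    have hts : t ∈ ({s} : Set S) := letter_mem_of_base (D := D) hu0 hk hu1
    obtain rfl := Set.mem_singleton_iff.1 hts
    have hR' : R.1 = D.H {t} := by
      rw [e]
      have := coset_eq (D := D) (g := 1) (X := {t}) (h := u) (by rwa [one_smul])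
      rw [← this, one_smul]
    refine ⟨Subtype.ext ?_, fun h hh => (Λ.zero_iff _).2 ?_⟩
    · rw [hR']; exact (one_smul _ _).symm
    · rw [hR'] at hh; exact hh
  · right
    rw [e'] at hl
    obtain ⟨w, hw1, hw2, hw3⟩ := Λ.common (v := .inl u) (w := .inl (u * D.gen t ^ k))
      ⟨t, k, hk, rfl⟩ hm hl
    rcases w with w | B
    · obtain ⟨r, l, hl', rfl⟩ := hw1
      obtain rfl := same_letter hk hl' rfl rfl hw2
      have := hmin (u * D.gen t ^ l) (by rw [e, mem_line_iff]; exact ⟨l, rfl⟩)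
      omega
    · have hRB : R.1 ⊆ B.1 := line_subset_block e hw1 hk hw2
      refine ⟨B, hRB, fun h hh => ?_⟩
      have h2 := hmin h hh
      have h3 := Λ.le_succ (adj_gb.2 (hRB hh))
      omega

theorem block_lower (hp : p ∈ D.H {s}) (h1 : p ≠ 1) {B : D.Block} (hB : actB p B = B) :
    ∃ R : D.Line, actL p R = R ∧ R.1 ⊆ B.1 ∧ ∀ h ∈ R.1, Λ.lev (.inl h) + 1 = Λ.lev (.inr B) := by
  obtain ⟨m, hm⟩ := Λ.block_pos B
  obtain ⟨w, hw1, hw2⟩ := Λ.lower _ _ hm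
  rcases w with u | B'
  swap
  · exact absurd hw1 adj_bb
  have hpu : p * u ∈ B.1 := by rw [← hB]; exact mul_mem_actB.2 hw1
  have hl := Λ.lev_mul hp u
  rcases Λ.lower_unique hw1 (adj_bg.2 hpu) (by omega) (by omega) with h | ⟨t, k, hk, e⟩
  · exact absurd (mul_eq_right.1 (Sum.inl_injective h).symm) h1
  have hR : actL p (D.line u t) = D.line u t := actL_eq_of rfl e
  refine ⟨D.line u t, hR, line_subset_block rfl hw1 hk (by rwa [← e]), fun h hh => ?_⟩
  have key : Λ.lev (.inl h) = Λ.lev (.inl u) := by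
    rcases Λ.line_cases hp h1 hR with ⟨-, h2⟩ | ⟨B', -, h2⟩
    · rw [h2 _ hh, h2 u (self_mem_line u t)]
    · rw [h2 _ hh, h2 u (self_mem_line u t)]
  omega

theorem line_block_lev (hp : p ∈ D.H {s}) (h1 : p ≠ 1) {R : D.Line} {q : D.Block}
    (hR : actL p R = R) (hRq : R.1 ⊆ q.1) {h : G} (hh : h ∈ R.1) :
    Λ.lev (.inl h) = Λ.lev (.inr q) + 1 ∨ Λ.lev (.inr q) = Λ.lev (.inl h) + 1 := by
  have hadj : D.graph.Adj (.inl h) (.inr q) := adj_gb.2 (hRq hh)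
  have l1 := Λ.le_succ hadj
  have l2 := Λ.le_succ hadj.symm
  by_contra hne
  have heq : Λ.lev (.inl h) = Λ.lev (.inr q) := by omega
  obtain ⟨m, hm⟩ := Λ.block_pos q
  rcases Λ.line_cases hp h1 hR with ⟨-, h2⟩ | ⟨B, hRB, h2⟩
  · have := h2 h hh
    omega
  · obtain ⟨w, hw1, hw2, hw3⟩ := Λ.common hadj (heq.trans hm) hm
    rcases w with u | B'
    swap
    · exact adj_bb hw2
    have hB := h2 h hh
    rcases Λ.lower_unique hw1 (adj_gb.2 (hRB hh)) (by omega) (by omega) with h3 | h3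
    · cases h3
    obtain ⟨t, k, hk, e, e'⟩ := exists_of_actL h1 hR hh
    obtain ⟨r, l, hl, rfl⟩ := hw1
    have htr : t ≠ r := by
      rintro rfl
      have := h2 (h * D.gen t ^ l) (by rw [e, mem_line_iff]; exact ⟨l, rfl⟩)
      omega
    have hmem : h * D.gen t ^ k ∈ R.1 := by rw [e, mem_line_iff]; exact ⟨k, rfl⟩
    have := block_unique htr hk hl (hRB hh) (hRq hh) (hRB hmem) (hRq hmem) h3 hw2
    rw [this] at hB
    omega

theorem line_lower_unique {R R' : D.Line} {q : D.Block} (hR : R.1 ⊆ q.1) (hR' : R'.1 ⊆ q.1)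
    (h1 : ∀ h ∈ R.1, Λ.lev (.inr q) = Λ.lev (.inl h) + 1)
    (h2 : ∀ h ∈ R'.1, Λ.lev (.inr q) = Λ.lev (.inl h) + 1) : R = R' := by
  have hadj : ∀ h ∈ R.1, ∀ h' ∈ R'.1, h = h' ∨ D.gAdj h h' := by
    intro h hh h' hh'
    rcases Λ.lower_unique (adj_bg.2 (hR hh)) (adj_bg.2 (hR' hh')) (h1 h hh) (h2 h' hh') with h3 | h3
    · exact Or.inl (Sum.inl_injective h3)
    · exact Or.inr h3
  have letters : ∀ {z : G} {t r : S} {l : ℤ}, l ≠ 0 → (z * D.gen t ^ (1 : ℤ) = z * D.gen r ^ l ∨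
      D.gAdj (z * D.gen t ^ (1 : ℤ)) (z * D.gen r ^ l)) → t = r := by
    rintro z t r l hl (h | h)
    · exact letter_eq (mul_left_cancel h) one_ne_zero
    · exact same_letter one_ne_zero hl rfl rfl h
  obtain ⟨h, hh⟩ := line_nonempty R
  obtain ⟨z, hz'⟩ := line_nonempty R'
  obtain ⟨t, ht⟩ := line_eq R hh
  have mem : ∀ k : ℤ, h * D.gen t ^ k ∈ R.1 := fun k => by rw [ht, mem_line_iff]; exact ⟨k, rfl⟩
  have hz : z ∈ R.1 := by
    rcases hadj h hh z hz' with rfl | ⟨r, l, hl, rfl⟩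
    · exact hh
    · obtain rfl := letters hl (hadj _ (mem 1) _ hz')
      exact mem l
  obtain ⟨a, ha⟩ := line_eq R hz
  obtain ⟨b, hb⟩ := line_eq R' hz'
  have hab : a = b := letters one_ne_zero (hadj (z * D.gen a ^ (1 : ℤ)) (by
    rw [ha, mem_line_iff]; exact ⟨1, rfl⟩) (z * D.gen b ^ (1 : ℤ)) (by
    rw [hb, mem_line_iff]; exact ⟨1, rfl⟩))
  exact Subtype.ext (by rw [ha, hb, hab])

end Level

end LargeGroup

namespace LargeGroup

variable {G S : Type u} [Group G] {D : LargeGroup G S}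

/-- Roots of a translation of a line, when they preserve a block containing the line. -/
theorem actL_eq_of_pow {p g : G} {n i : ℕ} (hn : n ≠ 0) (hp : p ≠ 1) (hg : g ^ n = p ^ i)
    {R : D.Line} {B : D.Block} (hR : actL p R = R) (hB : actB g B = B) (h : R.1 ⊆ B.1) :
    actL g R = R := by
  obtain ⟨x, hx⟩ := line_nonempty R
  obtain ⟨t, k, hk, e, e'⟩ := exists_of_actL hp hR hx
  obtain ⟨a, b, hab, eB⟩ := block_eq B (h hx)
  have ht : t = a ∨ t = b := by
    refine letter_of_mem (D := D) (g := x) (k := k) hk ?_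
    rw [← eB]
    exact h (by rw [e, mem_line_iff]; exact ⟨k, rfl⟩)
  have h1 : g * x ∈ B.1 := by rw [← hB]; exact mul_mem_actB.2 (h hx)
  rw [eB, mem_coset_iff, ← mul_assoc] at h1
  have h2 : (x⁻¹ * g * x) ^ n = D.gen t ^ (k * i) := by
    have c1 := conj_pow (a := x⁻¹) (b := g) (i := n)
    have c2 := conj_pow (a := x⁻¹) (b := p) (i := i)
    rw [inv_inv] at c1 c2
    rw [c1, hg, ← c2, mul_assoc, e', inv_mul_cancel_left, zpow_mul, zpow_natCast]
  have h3 : x⁻¹ * g * x ∈ Subgroup.zpowers (D.gen t) := by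
    have hz : (x⁻¹ * g * x) ^ n ∈ Subgroup.zpowers (D.gen t) := by
      rw [h2]; exact Subgroup.mem_zpowers_iff.2 ⟨_, rfl⟩
    rcases ht with rfl | rfl
    · exact D.pair_root hab h1 hn hz
    · exact D.pair_root (D.fin_symm hab) (by rw [Set.pair_comm]; exact h1) hn hz
  obtain ⟨l, hl⟩ := Subgroup.mem_zpowers_iff.1 h3
  exact actL_eq_of (k := l) e (by rw [hl]; group)

namespace Level

variable {s : S} (Λ : Level D {s}) {p : G}

theorem line_lev_const (hp : p ∈ D.H {s}) (h1 : p ≠ 1) {R : D.Line} (hR : actL p R = R) {h h' : G}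
    (hh : h ∈ R.1) (hh' : h' ∈ R.1) : Λ.lev (.inl h) = Λ.lev (.inl h') := by
  rcases Λ.line_cases hp h1 hR with ⟨-, h2⟩ | ⟨B', -, h2⟩
  · rw [h2 _ hh, h2 _ hh']
  · rw [h2 _ hh, h2 _ hh']

theorem actL_base (Λ : Level D {s}) (hp : p ∈ D.H {s}) (h1 : p ≠ 1) {g : G} {n i : ℕ} (hn : n ≠ 0)
    (hg : g ^ n = p ^ i) {R : D.Line} (hR : actL p R = R) (hgR : actL g R = R) :
    actL g (D.line 1 s) = D.line 1 s := by
  obtain ⟨x, hx⟩ := line_nonempty R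
  generalize hN : Λ.lev (.inl x) = N
  induction N using Nat.strong_induction_on generalizing R x with
  | _ N ih =>
    rcases Λ.line_cases hp h1 hR with ⟨rfl, -⟩ | ⟨B, hRB, hB⟩
    · exact hgR
    · obtain ⟨R', hR', hRB', hB'⟩ := Λ.block_lower hp h1 (actB_eq_of_actL hR hRB)
      obtain ⟨y, hy⟩ := line_nonempty R'
      have e1 := hB x hx
      have e2 := hB' y hy
      exact ih _ (by omega) hR'
        (actL_eq_of_pow hn h1 hg hR' (actB_eq_of_actL hgR hRB) hRB') y hy rfl

theorem actL_base_of_block (Λ : Level D {s}) (hp : p ∈ D.H {s}) (h1 : p ≠ 1) {g : G} {n i : ℕ}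
    (hn : n ≠ 0)
    (hg : g ^ n = p ^ i) {B : D.Block} (hB : actB p B = B) (hgB : actB g B = B) :
    actL g (D.line 1 s) = D.line 1 s := by
  obtain ⟨R', hR', hRB', -⟩ := Λ.block_lower hp h1 hB
  exact Λ.actL_base hp h1 hn hg hR' (actL_eq_of_pow hn h1 hg hR' hgB hRB')

end Level

variable (D) in
/-- Lines invariant under an element. -/
abbrev FixL (p : G) : Type u := {R : D.Line // actL p R = R}

variable (D) in
/-- Blocks invariant under an element. -/
abbrev FixB (p : G) : Type u := {B : D.Block // actB p B = B}

variable (D) in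
/-- Incident pairs of invariant lines and blocks. -/
abbrev FixE (p : G) : Type u := {x : D.FixL p × D.FixB p // x.1.1.1 ⊆ x.2.1.1}

section Fix

variable {p : G}

/-- The action of the centralizer on invariant lines. -/
def actFixL (g : Subgroup.centralizer {p}) (R : D.FixL p) : D.FixL p :=
  ⟨actL g.1 R.1, by
    rw [← actL_mul, (Subgroup.mem_centralizer_iff.1 g.2 p rfl), actL_mul, R.2]⟩

/-- The action of the centralizer on invariant blocks. -/
def actFixB (g : Subgroup.centralizer {p}) (B : D.FixB p) : D.FixB p :=
  ⟨actB g.1 B.1, by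
    rw [← actB_mul, (Subgroup.mem_centralizer_iff.1 g.2 p rfl), actB_mul, B.2]⟩

/-- The action of the centralizer on invariant vertices. -/
def actFixV (g : Subgroup.centralizer {p}) : D.FixL p ⊕ D.FixB p → D.FixL p ⊕ D.FixB p :=
  Sum.map (actFixL g) (actFixB g)

/-- The action of the centralizer on incident pairs. -/
def actFixE (g : Subgroup.centralizer {p}) (x : D.FixE p) : D.FixE p :=
  ⟨(actFixL g x.1.1, actFixB g x.1.2), act_subset_iff.2 x.2⟩

/-- The boundary of incident pairs. -/
noncomputable def bdFix : (D.FixE p →₀ ℤ) →+ (D.FixL p ⊕ D.FixB p →₀ ℤ) :=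
  Finsupp.mapDomain.addMonoidHom (fun x => .inr x.1.2) -
    Finsupp.mapDomain.addMonoidHom (fun x => .inl x.1.1)

theorem bdFix_apply (c : D.FixE p →₀ ℤ) : bdFix c =
    Finsupp.mapDomain (fun x => .inr x.1.2) c - Finsupp.mapDomain (fun x => .inl x.1.1) c := rfl

theorem bdFix_act (g : Subgroup.centralizer {p}) (c : D.FixE p →₀ ℤ) :
    bdFix (pushEnd (actFixE g) c) = pushEnd (actFixV g) (bdFix c) := by
  rw [bdFix_apply, bdFix_apply, map_sub]
  simp only [pushEnd_apply, ← Finsupp.mapDomain_comp]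
  rfl

theorem augmentation_bdFix (c : D.FixE p →₀ ℤ) : augmentation _ (bdFix c) = 0 := by
  rw [bdFix_apply, map_sub, augmentation_mapDomain, augmentation_mapDomain, sub_self]

variable {s : S}

theorem bdFix_injective (hp : p ∈ D.H {s}) (h1 : p ≠ 1) {c : D.FixE p →₀ ℤ} (h : bdFix c = 0) :
    c = 0 := by
  obtain ⟨Λ⟩ := nonempty_level D {s}
  by_contra hc
  let el : D.Line → G := fun R => (line_nonempty R).choose
  have hel : ∀ R, el R ∈ R.1 := fun R => (line_nonempty R).choose_spec
  obtain ⟨⟨⟨R, B⟩, hRB⟩, hx, hmax⟩ := Finset.exists_max_image c.support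
    (fun x => Λ.lev (.inl (el x.1.1.1)) + Λ.lev (.inr x.1.2.1)) (Finsupp.support_nonempty_iff.2 hc)
  rw [Finsupp.mem_support_iff] at hx
  have hL : Finsupp.mapDomain (fun x : D.FixE p => (.inl x.1.1 : D.FixL p ⊕ D.FixB p)) c
      (.inl R) = 0 := by
    have := DFunLike.congr_fun h (.inl R)
    rwa [bdFix_apply, Finsupp.sub_apply, Finsupp.mapDomain_of_notMem_range, zero_sub,
      Finsupp.zero_apply, neg_eq_zero] at this
    rintro ⟨y, hy⟩
    cases hy
  have hB : Finsupp.mapDomain (fun x : D.FixE p => (.inr x.1.2 : D.FixL p ⊕ D.FixB p)) c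
      (.inr B) = 0 := by
    have := DFunLike.congr_fun h (.inr B)
    rwa [bdFix_apply, Finsupp.sub_apply, Finsupp.mapDomain_of_notMem_range c
      (.inr B) (f := fun x : D.FixE p => (.inl x.1.1 : D.FixL p ⊕ D.FixB p)), sub_zero,
      Finsupp.zero_apply] at this
    rintro ⟨y, hy⟩
    cases hy
  rcases Λ.line_block_lev hp h1 R.2 hRB (hel R.1) with hl | hl
  · obtain ⟨⟨⟨R', B'⟩, hRB'⟩, hne, he, hc'⟩ := exists_ne_of_mapDomain
      (f := fun x : D.FixE p => (.inl x.1.1 : D.FixL p ⊕ D.FixB p)) hx hL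
    obtain rfl : R' = R := Sum.inl_injective he
    have hm := hmax _ (Finsupp.mem_support_iff.2 hc')
    simp only at hm
    refine hne ?_
    have hll := Λ.line_block_lev hp h1 R'.2 hRB' (hel R'.1)
    simp only at hl hll
    rcases hll with hl' | hl'
    · have := Λ.lower_block_unique (adj_gb.2 (hRB' (hel _))) (adj_gb.2 (hRB (hel _))) hl' hl
      obtain rfl : B' = B := Subtype.ext this
      rfl
    · omega
  · obtain ⟨⟨⟨R', B'⟩, hRB'⟩, hne, he, hc'⟩ := exists_ne_of_mapDomain
      (f := fun x : D.FixE p => (.inr x.1.2 : D.FixL p ⊕ D.FixB p)) hx hB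
    obtain rfl : B' = B := Sum.inr_injective he
    have hm := hmax _ (Finsupp.mem_support_iff.2 hc')
    simp only at hm
    refine hne ?_
    have hll := Λ.line_block_lev hp h1 R'.2 hRB' (hel R'.1)
    simp only at hl hll
    rcases hll with hl' | hl'
    · omega
    · have := Λ.line_lower_unique hRB' hRB
        (fun x hx => by rw [Λ.line_lev_const hp h1 R'.2 hx (hel _), hl'])
        (fun x hx => by rw [Λ.line_lev_const hp h1 R.2 hx (hel _), hl])
      obtain rfl : R' = R := Subtype.ext this
      rfl

theorem bdFix_single (x : D.FixE p) : bdFix (Finsupp.single x 1) =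
    Finsupp.single (.inr x.1.2) 1 - Finsupp.single (.inl x.1.1) 1 := by
  rw [bdFix_apply, Finsupp.mapDomain_single, Finsupp.mapDomain_single]

theorem exists_bdFix (hp : p ∈ D.H {s}) (h1 : p ≠ 1) {R₀ : D.FixL p} (h₀ : R₀.1 = D.line 1 s)
    (R : D.FixL p) : ∃ c, bdFix c = Finsupp.single (.inl R) 1 - Finsupp.single (.inl R₀) 1 := by
  obtain ⟨Λ⟩ := nonempty_level D {s}
  obtain ⟨x, hx⟩ := line_nonempty R.1
  generalize hN : Λ.lev (.inl x) = N
  induction N using Nat.strong_induction_on generalizing R x with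
  | _ N ih =>
    rcases Λ.line_cases hp h1 R.2 with ⟨e, -⟩ | ⟨B, hRB, hB⟩
    · obtain rfl : R = R₀ := Subtype.ext (e.trans h₀.symm)
      exact ⟨0, by rw [map_zero, sub_self]⟩
    · have hpB := actB_eq_of_actL R.2 hRB
      obtain ⟨R', hR', hRB', hB'⟩ := Λ.block_lower hp h1 hpB
      obtain ⟨y, hy⟩ := line_nonempty R'
      have e1 := hB x hx
      have e2 := hB' y hy
      obtain ⟨c, hc⟩ := ih _ (by omega) ⟨R', hR'⟩ y hy rfl
      refine ⟨c + Finsupp.single ⟨(⟨R', hR'⟩, ⟨B, hpB⟩), hRB'⟩ 1 -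
        Finsupp.single ⟨(R, ⟨B, hpB⟩), hRB⟩ 1, ?_⟩
      rw [map_sub, map_add, hc, bdFix_single, bdFix_single]
      abel

end Fix

/-- Roots of powers of a generator. -/
theorem mem_of_pow_mem_singleton {s : S} {g : G} {n : ℕ} (hn : n ≠ 0) (hg : g ^ n ∈ D.H {s}) :
    g ∈ D.H {s} := by
  induction n using Nat.strong_induction_on with
  | _ n ih =>
    by_cases hn1 : n = 1
    · rwa [hn1, pow_one] at hg
    by_cases hp1 : g ^ n = 1
    · rw [eq_one_of_pow hn hp1 D]
      exact one_mem _
    obtain ⟨p, hp⟩ : ∃ p, g ^ n = p := ⟨_, rfl⟩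
    rw [hp] at hg hp1
    by_cases hf : ∃ i, 0 < i ∧ i < n ∧ actL (g ^ i) (D.line 1 s) = D.line 1 s
    · obtain ⟨i, hi, hin, e⟩ := hf
      refine ih i hin hi.ne' ?_
      have h2 : g ^ i * 1 ∈ (D.line 1 s).1 := by
        rw [← e]; exact mul_mem_actL.2 (self_mem_line _ _)
      rw [mul_one] at h2
      have : g ^ i ∈ (1 : G) • (D.H {s} : Set G) := h2
      rwa [one_smul] at this
    exfalso
    obtain ⟨Λ⟩ := nonempty_level D {s}
    have hgi : ∀ i : ℕ, (g ^ i) ^ n = p ^ i := fun i => by rw [← hp, ← pow_mul, ← pow_mul, mul_comm]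
    let γ : Subgroup.centralizer {p} := ⟨g, Subgroup.mem_centralizer_iff.2 (by
      rintro _ rfl
      rw [← hp, ← pow_succ, ← pow_succ'])⟩
    have freeL : ∀ i, 0 < i → i < n → ∀ R : D.FixL p, actFixL (γ ^ i) R ≠ R := fun i h h' R e =>
      hf ⟨i, h, h', Λ.actL_base hg hp1 hn (hgi i) R.2 (congrArg Subtype.val e)⟩
    have freeB : ∀ i, 0 < i → i < n → ∀ B : D.FixB p, actFixB (γ ^ i) B ≠ B := fun i h h' B e =>
      hf ⟨i, h, h', Λ.actL_base_of_block hg hp1 hn (hgi i) B.2 (congrArg Subtype.val e)⟩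
    have hγ : (γ ^ n).1 = p := hp
    have hL : ∀ R : D.FixL p, actFixL (γ ^ n) R = R := fun R =>
      Subtype.ext (by change actL (γ ^ n).1 R.1 = R.1; rw [hγ, R.2])
    have hB : ∀ B : D.FixB p, actFixB (γ ^ n) B = B := fun B =>
      Subtype.ext (by change actB (γ ^ n).1 B.1 = B.1; rw [hγ, B.2])
    have oneL : ∀ R : D.FixL p, actFixL 1 R = R := fun R => Subtype.ext (actL_one _)
    have oneB : ∀ B : D.FixB p, actFixB 1 B = B := fun R => Subtype.ext (actB_one _)
    have mulL : ∀ x y (R : D.FixL p), actFixL (x * y) R = actFixL x (actFixL y R) :=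
      fun x y R => Subtype.ext (actL_mul _ _ _)
    have mulB : ∀ x y (R : D.FixB p), actFixB (x * y) R = actFixB x (actFixB y R) :=
      fun x y R => Subtype.ext (actB_mul _ _ _)
    have i₀ : InducedEnd (pushEnd (actFixV (D := D) γ)) n := by
      refine .ofAction actFixV ?_ ?_ (Nat.pos_of_ne_zero hn) ?_ ?_
      · rintro (x | x)
        exacts [congrArg Sum.inl (oneL x), congrArg Sum.inr (oneB x)]
      · rintro a b (x | x)
        exacts [congrArg Sum.inl (mulL a b x), congrArg Sum.inr (mulB a b x)]
      · rintro (x | x)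
        exacts [congrArg Sum.inl (hL x), congrArg Sum.inr (hB x)]
      · rintro i h h' (x | x) e
        exacts [freeL i h h' x (Sum.inl_injective e), freeB i h h' x (Sum.inr_injective e)]
    have i₁ : InducedEnd (pushEnd (actFixE (D := D) γ)) n := by
      refine .ofAction actFixE ?_ ?_ (Nat.pos_of_ne_zero hn) ?_ ?_
      · exact fun x => Subtype.ext (Prod.ext (oneL _) (oneB _))
      · exact fun a b x => Subtype.ext (Prod.ext (mulL a b _) (mulB a b _))
      · exact fun x => Subtype.ext (Prod.ext (hL _) (hB _))
      · exact fun i h h' x e => freeL i h h' x.1.1 (congrArg (fun y => y.1.1) e)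
    have i₂ : InducedEnd (1 : AddMonoid.End PUnit.{1}) n :=
      ⟨one_pow _, 0, AddMonoidHom.ext fun _ => rfl⟩
    have hR₀ : actL p (D.line 1 s) = D.line 1 s := by
      obtain ⟨k, rfl⟩ := mem_H_singleton.1 hg
      rw [actL_line, mul_one, ← one_mul (D.gen s ^ k), line_mul_gen]
    let R₀ : D.FixL p := ⟨D.line 1 s, hR₀⟩
    obtain ⟨c, hc⟩ := exists_bdFix hg hp1 (R₀ := R₀) rfl (actFixL γ R₀)
    have hc₁ : bdFix (-c) = Finsupp.single (.inl R₀) 1 -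
        pushEnd (actFixV γ) (Finsupp.single (.inl R₀) 1) := by
      rw [map_neg, hc, pushEnd_apply, Finsupp.mapDomain_single, neg_sub]
      rfl
    have hN : (∑ i ∈ Finset.range n, pushEnd (actFixE (D := D) γ) ^ i) (-c) = 0 := by
      refine bdFix_injective hg hp1 ?_
      have hpow : ∀ (i : ℕ) c, bdFix ((pushEnd (actFixE (D := D) γ) ^ i) c) =
          (pushEnd (actFixV γ) ^ i) (bdFix c) := by
        intro i c
        induction i with
        | zero => rfl
        | succ i ih =>
          rw [pow_succ', pow_succ', InducedEnd.mul_apply', bdFix_act, ih]; rfl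
      rw [InducedEnd.sum_apply', map_sum]
      simp only [hpow]
      rw [← InducedEnd.sum_apply', hc₁]
      have e := geom_sum_mul_neg (pushEnd (actFixV (D := D) γ)) n
      rw [i₀.1, sub_self] at e
      exact congrArg (fun f : AddMonoid.End _ => f (Finsupp.single (.inl R₀) 1)) e
    exact InducedEnd.no_acyclic hn1 i₀ i₁ i₂ 0 bdFix (augmentation _)
      (fun _ => by simp) (bdFix_act γ) (augmentation_mapDomain _) (fun _ _ => rfl)
      (fun _ => map_zero _) augmentation_bdFix (Finsupp.single (.inl R₀) 1) (-c) 0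
      (augmentation_single _ _) hc₁ hN

/-- Standard parabolic subgroups are stable under roots. -/
theorem mem_of_pow_mem {X : Set S} {g : G} {n : ℕ} (hn : n ≠ 0) (hg : g ^ n ∈ D.H X) :
    g ∈ D.H X := by
  by_cases h1 : g ^ n = 1
  · rw [eq_one_of_pow hn h1 D]
    exact one_mem _
  by_contra h
  obtain ⟨a, ha, s, hs, k, e⟩ := Level.conj_of_coset hg h1 h (by
    rwa [mul_assoc, ← pow_succ, pow_succ', inv_mul_cancel_left])
  have h2 : (a⁻¹ * g * a) ^ n ∈ D.H {s} := by
    have c1 := conj_pow (a := a⁻¹) (b := g) (i := n)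
    rw [inv_inv] at c1
    rw [c1, e]
    refine mem_H_singleton.2 ⟨k, ?_⟩
    group
  have h3 := H_mono (D := D) (Set.singleton_subset_iff.2 hs) (mem_of_pow_mem_singleton hn h2)
  have h4 := mul_mem (mul_mem ha h3) (inv_mem ha)
  exact h (by simpa [mul_assoc] using h4)

end LargeGroup

section Dual

variable {Γ : Type*} [Group Γ]

/-- Alternating products. -/
def alt (A B : Γ) (k : ℕ) : Γ := ((List.range k).map fun i => if i % 2 = 0 then A else B).prod

theorem alt_succ (A B : Γ) (k : ℕ) : alt A B (k + 1) = A * alt B A k := by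
  rw [alt, alt, List.range_succ_eq_map, List.map_cons, List.prod_cons, List.map_map]
  congr 2
  refine List.map_congr_left fun i _ => ?_
  simp only [Function.comp_apply, Nat.succ_eq_add_one]
  split_ifs <;> first | rfl | omega

/-- The sequence of conjugates of two elements by powers of their product. -/
def dual (A B : Γ) (i : ℤ) : Γ :=
  (A * B) ^ (-(i / 2)) * (if i % 2 = 0 then A else B) * (A * B) ^ (i / 2)

variable {A B : Γ}

theorem dual_zero : dual A B 0 = A := by simp [dual]

theorem dual_one : dual A B 1 = B := by simp [dual]

theorem dual_mul_zpow (i c : ℤ) :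
    dual A B i * (A * B) ^ c = (A * B) ^ c * dual A B (i + 2 * c) := by
  have h1 : (i + 2 * c) / 2 = i / 2 + c := by omega
  have h2 : (i + 2 * c) % 2 = i % 2 := by omega
  rw [dual, dual, h1, h2]
  group

theorem dual_mul (i : ℤ) : dual A B i * dual A B (i + 1) = A * B := by
  have key : ∀ c : ℤ, (A * B) ^ c * dual A B (i + 2 * c) * dual A B (i + 2 * c + 1) =
      A * B * (A * B) ^ c → dual A B i * dual A B (i + 1) = A * B := by
    intro c h
    rw [← dual_mul_zpow, mul_assoc, show i + 2 * c + 1 = i + 1 + 2 * c by ring] at h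
    have h3 := dual_mul_zpow (A := A) (B := B) (i + 1) c
    have : dual A B (i + 1 + 2 * c) = (A * B) ^ (-c) * (dual A B (i + 1) * (A * B) ^ c) := by
      rw [h3]; group
    rw [this, zpow_neg, mul_inv_cancel_left, ← mul_assoc] at h
    exact mul_right_cancel h
  rcases Int.even_or_odd' i with ⟨k, rfl | rfl⟩
  · refine key (-k) ?_
    rw [show 2 * k + 2 * -k = 0 by ring, zero_add, dual_zero, dual_one, mul_assoc]
    exact ((Commute.refl (A * B)).zpow_left (-k)).eq
  · refine key (-k) ?_
    rw [show 2 * k + 1 + 2 * -k = 1 by ring, dual_one]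
    have : dual A B (1 + 1) = B⁻¹ * A * B := by simp [dual, mul_assoc]
    rw [this, mul_assoc, mul_assoc B⁻¹, mul_inv_cancel_left]
    exact ((Commute.refl (A * B)).zpow_left (-k)).eq

theorem eq_dual {f : ℤ → Γ} (h0 : f 0 = A) (h : ∀ i, f i * f (i + 1) = A * B) (i : ℤ) :
    f i = dual A B i := by
  induction i using Int.induction_on with
  | zero => rw [h0, dual_zero]
  | succ i ih =>
    have := h i
    rw [← dual_mul (A := A) (B := B) i, ih] at this
    exact mul_left_cancel this
  | pred i ih =>
    have := h (-i - 1)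
    rw [← dual_mul (A := A) (B := B) (-i - 1), sub_add_cancel, ih] at this
    exact mul_right_cancel this

theorem dual_neg_mul_alt (k : ℕ) : dual A B (-k) * alt A B k = alt A B (k + 1) := by
  induction k using Nat.twoStepInduction with
  | zero => rw [alt_succ]; simp [alt, dual_zero]
  | one =>
    have : dual A B (-1) = A * B * A⁻¹ := by
      have := dual_mul (A := A) (B := B) (-1)
      rw [neg_add_cancel, dual_zero] at this
      exact eq_mul_inv_of_mul_eq this
    rw [alt_succ A B 1, alt_succ A B 0, alt_succ B A 0, Nat.cast_one, this]
    simp [alt]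
  | more k ih _ =>
    rw [alt_succ A B (k + 2), alt_succ B A (k + 1), alt_succ A B (k + 1), alt_succ B A k, ← ih]
    have := dual_mul_zpow (A := A) (B := B) (-((k + 2 : ℕ) : ℤ)) 1
    rw [zpow_one] at this
    rw [← mul_assoc A B, ← mul_assoc, this, ← mul_assoc A B, mul_assoc]
    congr 3
    push_cast
    ring

theorem alt_comm_iff (k : ℕ) : alt A B (k + 1) = alt B A (k + 1) ↔ dual A B (-k) = B := by
  rw [← dual_neg_mul_alt, alt_succ B A]
  exact mul_left_inj _

theorem dual_add_period {m : ℕ} (hm : m ≠ 0) (h : alt A B m = alt B A m) (i : ℤ) :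
    dual A B (i + m) = dual A B i := by
  obtain ⟨k, rfl⟩ := Nat.exists_eq_succ_of_ne_zero hm
  have h1 := (alt_comm_iff k).1 h
  have key : ∀ i, dual A B (i - (k + 1 : ℕ)) = dual A B i := by
    refine eq_dual ?_ fun i => ?_
    · have := dual_mul (A := A) (B := B) (-k - 1)
      rw [sub_add_cancel, h1] at this
      rw [zero_sub]
      push_cast
      rw [neg_add']
      exact mul_right_cancel this
    · rw [← dual_mul (A := A) (B := B) (i - (k + 1 : ℕ)), sub_add_eq_add_sub]
  rw [← key (i + _), add_sub_cancel_right]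

theorem map_dual {Δ : Type*} [Group Δ] (φ : Γ →* Δ) (i : ℤ) :
    φ (dual A B i) = dual (φ A) (φ B) i := by
  simp only [dual, map_mul, map_zpow, apply_ite φ]

theorem map_alt {Δ : Type*} [Group Δ] (φ : Γ →* Δ) (k : ℕ) :
    φ (alt A B k) = alt (φ A) (φ B) k := by
  simp only [alt, map_list_prod, List.map_map]
  congr 2
  funext i
  simp only [Function.comp_apply, apply_ite φ]

end Dual

/-- Sequences like `k ↦ sin (kπ/m) / sin (π/m)`, with `l = 2 cos (π/m)`. -/
structure SinSeq (m : ℕ) (l : ℝ) (s : ℤ → ℝ) : Prop where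
  zero : s 0 = 0
  one : s 1 = 1
  succ : ∀ k, s (k + 1) = l * s k - s (k - 1)
  period : ∀ k, s (k + m) = -s k
  pos : ∀ k : ℤ, 0 < k → k < m → 0 < s k
  lpos : 0 < l

theorem exists_sinSeq {m : ℕ} (hm : 3 ≤ m) : ∃ s, SinSeq m (2 * Real.cos (Real.pi / m)) s := by
  have hm' : (3 : ℝ) ≤ m := by exact_mod_cast hm
  have hpi := Real.pi_pos
  have h0 : 0 < Real.pi / m := by positivity
  have h1 : Real.pi / m ≤ Real.pi / 3 := div_le_div_of_nonneg_left hpi.le (by norm_num) hm'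
  have hs : 0 < Real.sin (Real.pi / m) := Real.sin_pos_of_pos_of_lt_pi h0 (by linarith)
  refine ⟨fun k => Real.sin (k * (Real.pi / m)) / Real.sin (Real.pi / m), ?_, ?_, ?_, ?_, ?_, ?_⟩
  · simp
  · simp [hs.ne']
  · intro k
    push_cast
    rw [add_mul, sub_mul, one_mul, Real.sin_add, Real.sin_sub]
    field_simp
    ring
  · intro k
    push_cast
    rw [add_mul, mul_div_cancel₀ _ (by linarith), Real.sin_add_pi, neg_div]
  · intro k hk hk'
    have h2 : (0 : ℝ) < k := by exact_mod_cast hk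
    have h3 : (k : ℝ) < m := by exact_mod_cast hk'
    refine div_pos (Real.sin_pos_of_pos_of_lt_pi (by positivity) ?_) hs
    rw [mul_div_assoc', div_lt_iff₀ (by linarith), mul_comm]
    exact mul_lt_mul_of_pos_left h3 hpi
  · have := Real.cos_pos_of_mem_Ioo (x := Real.pi / m) ⟨by linarith, by linarith⟩
    linarith

theorem eq_of_recurrence {l : ℝ} {V : Type*} [AddCommGroup V] [Module ℝ V] {f g : ℤ → V} {i : ℤ}
    (hf : ∀ k, f (k + 1) = l • f k - f (k - 1)) (hg : ∀ k, g (k + 1) = l • g k - g (k - 1))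
    (h0 : f i = g i) (h1 : f (i + 1) = g (i + 1)) (k : ℤ) : f k = g k := by
  have key : ∀ k, f k = g k ∧ f (k + 1) = g (k + 1) := by
    intro k
    induction k using Int.inductionOn' (b := i) with
    | zero => exact ⟨h0, h1⟩
    | succ k _ ih => exact ⟨ih.2, by rw [hf, hg, ih.2, add_sub_cancel_right, ih.1]⟩
    | pred k _ ih =>
      refine ⟨?_, by rw [sub_add_cancel]; exact ih.1⟩
      have h2 := hf k
      have h3 := hg k
      rw [ih.2, ih.1, h3] at h2
      exact (sub_right_inj.1 h2).symm
  exact (key k).1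

namespace SinSeq

variable {m : ℕ} {l : ℝ} {s : ℤ → ℝ}

theorem neg (h : SinSeq m l s) (k : ℤ) : s (-k) = -s k := by
  have h1 : s (-1) = -1 := by
    have := h.succ 0
    rw [zero_add, zero_sub, h.zero, h.one] at this
    linarith
  refine eq_of_recurrence (l := l) (f := fun k => s (-k)) (g := fun k => -s k) (i := 0)
    (fun k => ?_) (fun k => ?_)
    ?_ ?_ k
  · have := h.succ (-k)
    simp only [smul_eq_mul]
    rw [show -(k + 1) = -k - 1 by ring, show -(k - 1) = -k + 1 by ring]
    linarith
  · simp only [smul_eq_mul, h.succ]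
    ring
  · simp [h.zero]
  · simp [h.one, h1]

theorem period_mul (h : SinSeq m l s) (k t : ℤ) :
    s (k + m * t) = s k ∧ Even t ∨ s (k + m * t) = -s k ∧ ¬ Even t := by
  induction t using Int.induction_on with
  | zero => left; simp
  | succ t ih =>
    have := h.period (k + m * t)
    rw [add_assoc, ← mul_add_one] at this
    rw [this, Int.even_add_one]
    rcases ih with ih | ih
    · right; rw [ih.1]; tauto
    · left; rw [ih.1, neg_neg]; tauto
  | pred t ih =>
    have := h.period (k + m * (-t - 1))
    rw [add_assoc, ← mul_add_one, sub_add_cancel] at this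
    have e := neg_eq_iff_eq_neg.1 this.symm
    rw [e, Int.even_sub_one]
    rcases ih with ih | ih
    · right; rw [ih.1]; tauto
    · left; rw [ih.1, neg_neg]; tauto

theorem ratio (h : SinSeq m l s) {e : ℤ} (hm : 0 < m) (he : ¬ (m : ℤ) ∣ e) :
    s e ≠ 0 ∧ 0 ≤ s (e - 1) * s e ∧
    0 ≤ s e * s (e + 1) ∧ 0 ≤ s (e - 1) * s (e + 1) := by
  have hm' : (0 : ℤ) < m := by exact_mod_cast hm
  have hr := Int.emod_add_mul_ediv e m
  have h1 := Int.emod_nonneg e hm'.ne'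
  have h2 := Int.emod_lt_of_pos e hm'
  have h3 : e % m ≠ 0 := fun h0 => he (Int.dvd_of_emod_eq_zero h0)
  generalize e % m = r at *
  generalize e / m = t at *
  have p0 : 0 < s r := h.pos r (by omega) h2
  have p1 : 0 ≤ s (r - 1) := by
    rcases eq_or_ne (r - 1) 0 with e | e
    · rw [e, h.zero]
    · exact (h.pos _ (by omega) (by omega)).le
  have p2 : 0 ≤ s (r + 1) := by
    rcases eq_or_ne (r + 1) m with e | e
    · have := h.period 0
      rw [zero_add, h.zero, neg_zero] at this
      rw [e, this]
    · exact (h.pos _ (by omega) (by omega)).le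
  have q0 := h.period_mul r t
  have q1 := h.period_mul (r - 1) t
  have q2 := h.period_mul (r + 1) t
  rw [← hr, show r + m * t - 1 = r - 1 + m * t by ring, show r + m * t + 1 = r + 1 + m * t by ring]
  rcases q0 with ⟨q0, ht⟩ | ⟨q0, ht⟩ <;> rcases q1 with ⟨q1, ht'⟩ | ⟨q1, ht'⟩ <;>
    rcases q2 with ⟨q2, ht''⟩ | ⟨q2, ht''⟩ <;> first | exact absurd ‹Even t› ‹¬ Even t› | skip
  · rw [q0, q1, q2]
    exact ⟨p0.ne', by positivity, by positivity, by positivity⟩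
  · rw [q0, q1, q2]
    simp only [neg_mul_neg]
    exact ⟨by linarith, by positivity, by positivity, by positivity⟩

theorem eq_zero_iff (h : SinSeq m l s) {e : ℤ} (hm : 0 < m) : s e = 0 ↔ (m : ℤ) ∣ e := by
  refine ⟨fun h0 => by_contra fun he => (h.ratio hm he).1 h0, ?_⟩
  rintro ⟨t, rfl⟩
  have := h.period_mul 0 t
  rw [zero_add, h.zero, neg_zero] at this
  tauto

end SinSeq

/-- Two transvections in a plane generating an image of a dihedral Artin group. -/
structure DihedralPair (V : Type*) [AddCommGroup V] [Module ℝ V] (m : ℕ) where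
  l : ℝ
  s : ℤ → ℝ
  seq : SinSeq m l s
  hm : 3 ≤ m
  e : V
  f : V
  β : V →ₗ[ℝ] ℝ
  γ : V →ₗ[ℝ] ℝ
  he : β e = 0
  hf : γ f = 0
  hef : β f = -l
  hfe : γ e = l

namespace DihedralPair

variable {V : Type*} [AddCommGroup V] [Module ℝ V] {m : ℕ} (P : DihedralPair V m)

/-- The sequence of directions of the transvections. -/
def vec (k : ℤ) : V := -P.s (k - 1) • P.e + P.s k • P.f

/-- The sequence of linear forms of the transvections. -/
def cov (k : ℤ) : V →ₗ[ℝ] ℝ := -P.s (k - 1) • P.β + P.s k • P.γ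

theorem m_pos (P : DihedralPair V m) : 0 < m := by have := P.hm; omega

theorem vec_succ (k : ℤ) : P.vec (k + 1) = P.l • P.vec k - P.vec (k - 1) := by
  have h1 := P.seq.succ k
  have h2 := P.seq.succ (k - 1)
  rw [sub_add_cancel] at h2
  rw [vec, vec, vec, add_sub_cancel_right, h1, h2]
  module

theorem cov_succ (k : ℤ) : P.cov (k + 1) = P.l • P.cov k - P.cov (k - 1) := by
  have h1 := P.seq.succ k
  have h2 := P.seq.succ (k - 1)
  rw [sub_add_cancel] at h2
  rw [cov, cov, cov, add_sub_cancel_right, h1, h2]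
  module

theorem vec_period (k : ℤ) : P.vec (k + m) = -P.vec k := by
  rw [vec, vec, add_sub_right_comm, P.seq.period, P.seq.period]
  module

theorem cov_period (k : ℤ) : P.cov (k + m) = -P.cov k := by
  rw [cov, cov, add_sub_right_comm, P.seq.period, P.seq.period]
  module

theorem cov_vec (i k : ℤ) : P.cov i (P.vec k) = P.l * P.s (i - k) := by
  have h1 : ∀ k, P.β (P.vec k) = -(P.l * P.s k) := fun k => by
    simp [vec, P.he, P.hef, mul_comm]
  have h2 : ∀ k, P.γ (P.vec k) = -(P.l * P.s (k - 1)) := fun k => by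
    simp [vec, P.hf, P.hfe, mul_comm]
  refine eq_of_recurrence (l := P.l) (f := fun i => P.cov i (P.vec k))
    (g := fun i => P.l * P.s (i - k)) (i := 0) (fun j => ?_) (fun j => ?_) ?_ ?_ i
  · simp [cov_succ]
  · have := P.seq.succ (j - k)
    simp only [smul_eq_mul]
    rw [show j + 1 - k = j - k + 1 by ring, show j - 1 - k = j - k - 1 by ring, this]
    ring
  · have := P.seq.neg 1
    simp only [cov, zero_sub, P.seq.zero, this, P.seq.one, P.seq.neg k]
    simp [h1]
  · have := P.seq.neg (k - 1)
    simp only [cov, zero_add, sub_self, P.seq.zero, P.seq.one]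
    rw [show 1 - k = -(k - 1) by ring, this]
    simp [h2]

theorem cov_self (i : ℤ) : P.cov i (P.vec i) = 0 := by
  rw [cov_vec, sub_self, P.seq.zero, mul_zero]

/-- The sequence of transvections. -/
def tau (i : ℤ) : V ≃ₗ[ℝ] V := LinearEquiv.transvection (P.cov_self i)

theorem tau_apply (i : ℤ) (x : V) : P.tau i x = x + P.cov i x • P.vec i := rfl

theorem tau_mul_succ (i : ℤ) : P.tau i * P.tau (i + 1) = P.tau 0 * P.tau 1 := by
  have key : ∀ i, P.tau i * P.tau (i + 1) = P.tau (i + 1) * P.tau (i + 1 + 1) := by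
    intro i
    refine LinearEquiv.ext fun x => ?_
    have h1 := P.vec_succ (i + 1)
    have h2 := P.cov_succ (i + 1)
    have h3 := P.cov_vec i (i + 1)
    have h4 := P.cov_vec (i + 1) (i + 1 + 1)
    have h5 := P.seq.neg 1
    rw [add_sub_cancel_right] at h1 h2
    rw [show i - (i + 1) = -1 by ring, h5, P.seq.one] at h3
    rw [show i + 1 - (i + 1 + 1) = -1 by ring, h5, P.seq.one] at h4
    simp only [LinearEquiv.mul_apply, tau_apply, map_add, map_smul, h3, h4]
    rw [h1, h2]
    simp only [LinearMap.sub_apply, LinearMap.smul_apply, smul_eq_mul]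
    module
  induction i using Int.induction_on with
  | zero => rfl
  | succ i ih => rw [← key, ih]
  | pred i ih => rw [key, sub_add_cancel, ih]

theorem tau_period (i : ℤ) : P.tau (i + m) = P.tau i := by
  refine LinearEquiv.ext fun x => ?_
  rw [tau_apply, tau_apply, cov_period, vec_period]
  simp

theorem tau_eq_dual (i : ℤ) : P.tau i = dual (P.tau 0) (P.tau 1) i :=
  eq_dual rfl P.tau_mul_succ i

theorem alt_tau : alt (P.tau 0) (P.tau 1) m = alt (P.tau 1) (P.tau 0) m := by
  obtain ⟨k, rfl⟩ := Nat.exists_eq_succ_of_ne_zero P.m_pos.ne'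
  refine (alt_comm_iff k).2 ?_
  rw [← tau_eq_dual, ← tau_period]
  congr 1
  push_cast
  ring

theorem vec_eq (i k : ℤ) : P.vec k = P.s (k - i + 1) • P.vec i - P.s (k - i) • P.vec (i - 1) := by
  refine eq_of_recurrence (l := P.l) (f := P.vec)
    (g := fun k => P.s (k - i + 1) • P.vec i - P.s (k - i) • P.vec (i - 1)) (i := i) P.vec_succ
    (fun j => ?_) ?_ ?_ k
  · have h1 := P.seq.succ (j - i)
    have h2 := P.seq.succ (j - i + 1)
    rw [add_sub_cancel_right] at h2
    rw [show j + 1 - i = j - i + 1 by ring, show j - 1 - i = j - i - 1 by ring, sub_add_cancel,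
      h2, h1]
    module
  · simp [P.seq.zero, P.seq.one]
  · have h1 := P.seq.succ 1
    simp only [add_sub_cancel_left, h1, P.seq.one, sub_self, P.seq.zero, P.vec_succ]
    simp

theorem tau_vec (i k : ℤ) :
    P.tau i (P.vec k) = -P.s (k - i - 1) • P.vec i - P.s (k - i) • P.vec (i - 1) := by
  have h1 := P.seq.succ (k - i)
  rw [tau_apply, cov_vec, show i - k = -(k - i) by ring, P.seq.neg]
  nth_rw 1 [P.vec_eq i k]
  rw [h1]
  module

theorem mul_tau_vec (k : ℤ) : (P.tau 0 * P.tau 1) (P.vec k) = -P.vec (k - 2) := by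
  rw [← P.tau_mul_succ (k - 1), sub_add_cancel, LinearEquiv.mul_apply, P.tau_apply k, cov_self,
    zero_smul, add_zero, tau_vec]
  rw [show k - (k - 1) - 1 = 0 by ring, show k - (k - 1) = 1 by ring,
    show k - 1 - 1 = k - 2 by ring, P.seq.zero, P.seq.one]
  module

/-- The open double cones between consecutive directions. -/
def InCone (i : ℤ) (x : V) : Prop := ∃ p q : ℝ, 0 < p * q ∧ x = p • P.vec (i - 1) + q • P.vec i

variable {P}

theorem InCone.tau {i j : ℤ} {x : V} (h : P.InCone j x) (hij : ¬ (m : ℤ) ∣ j - i - 1) :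
    P.InCone i (P.tau i x) := by
  obtain ⟨p, q, hpq, rfl⟩ := h
  obtain ⟨h0, h1, h2, h3⟩ := P.seq.ratio P.m_pos hij
  rw [sub_add_cancel] at h2 h3
  refine ⟨-(p * P.s (j - i - 1) + q * P.s (j - i)),
    -(p * P.s (j - i - 1 - 1) + q * P.s (j - i - 1)), ?_, ?_⟩
  · generalize P.s (j - i - 1) = b at *
    generalize P.s (j - i - 1 - 1) = a at *
    generalize P.s (j - i) = c at *
    have e : -(p * b + q * c) * -(p * a + q * b) =
      p ^ 2 * (a * b) + p * q * b ^ 2 + p * q * (a * c) + q ^ 2 * (b * c) := by ring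
    rw [e]
    positivity
  · rw [map_add, map_smul, map_smul, tau_vec, tau_vec, show j - 1 - i = j - i - 1 by ring]
    module

theorem InCone.zpow {i : ℤ} {x : V} (h : P.InCone i x) (c : ℤ) :
    P.InCone (i - 2 * c) (((P.tau 0 * P.tau 1) ^ c) x) := by
  have h1 : ∀ k, ((P.tau 0 * P.tau 1)⁻¹) (P.vec k) = -P.vec (k + 2) := by
    intro k
    have e : (P.tau 0 * P.tau 1) (-P.vec (k + 2)) = P.vec k := by
      rw [map_neg, mul_tau_vec, neg_neg, add_sub_cancel_right]
    rw [← e, ← LinearEquiv.mul_apply, inv_mul_cancel, LinearEquiv.coe_one, id]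
  induction c using Int.induction_on with
  | zero => simpa using h
  | succ c ih =>
    obtain ⟨p, q, hpq, e⟩ := ih
    refine ⟨-p, -q, by linarith, ?_⟩
    rw [add_comm (c : ℤ) 1, zpow_add, zpow_one, LinearEquiv.mul_apply, e, map_add, map_smul,
      map_smul, mul_tau_vec, mul_tau_vec]
    rw [show i - 2 * (c : ℤ) - 1 - 2 = i - 2 * (1 + c) - 1 by ring,
      show i - 2 * (c : ℤ) - 2 = i - 2 * (1 + c) by ring]
    module
  | pred c ih =>
    obtain ⟨p, q, hpq, e⟩ := ih
    refine ⟨-p, -q, by linarith, ?_⟩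
    rw [sub_eq_neg_add, zpow_add, zpow_neg_one, LinearEquiv.mul_apply, e, map_add, map_smul,
      map_smul, h1, h1]
    rw [show i - 2 * (-c : ℤ) - 1 + 2 = i - 2 * (-1 + -c) - 1 by ring,
      show i - 2 * (-c : ℤ) + 2 = i - 2 * (-1 + -c) by ring]
    module

theorem InCone.cov_ne_zero {i : ℤ} {x : V} (h : P.InCone i x) (k : ℤ) : P.cov k x ≠ 0 := by
  obtain ⟨p, q, hpq, rfl⟩ := h
  have hm := P.hm
  intro h0
  rw [map_add, map_smul, map_smul, cov_vec, cov_vec, show k - (i - 1) = k - i + 1 by ring] at h0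
  have h1 : p * P.s (k - i + 1) + q * P.s (k - i) = 0 := by
    have : P.l * (p * P.s (k - i + 1) + q * P.s (k - i)) = 0 := by
      rw [← h0]; simp only [smul_eq_mul]; ring
    exact (mul_eq_zero.1 this).resolve_left P.seq.lpos.ne'
  by_cases hd : (m : ℤ) ∣ k - i
  · rw [(P.seq.eq_zero_iff P.m_pos).2 hd, mul_zero, add_zero] at h1
    rcases mul_eq_zero.1 h1 with rfl | h2
    · simp at hpq
    · have := (Int.dvd_add_right hd).1 ((P.seq.eq_zero_iff P.m_pos).1 h2)
      have := Int.le_of_dvd one_pos this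
      omega
  · obtain ⟨h0, -, h2, -⟩ := P.seq.ratio P.m_pos hd
    generalize P.s (k - i) = a at *
    generalize P.s (k - i + 1) = b at *
    have : p ^ 2 * (a * b) + p * q * a ^ 2 = 0 := by
      have : p * a * (p * b + q * a) = 0 := by rw [h1, mul_zero]
      linarith
    have h3 : 0 < p * q * a ^ 2 := by positivity
    have h4 : 0 ≤ p ^ 2 * (a * b) := by positivity
    linarith

theorem inCone_tau_vec_one {i : ℤ} (h0 : ¬ (m : ℤ) ∣ i) (h1 : ¬ (m : ℤ) ∣ i - 1) :
    P.InCone i (P.tau i (P.vec 1)) := by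
  obtain ⟨h2, -, h3, -⟩ := P.seq.ratio (e := -i) P.m_pos (by rwa [dvd_neg])
  have h4 : P.s (-i + 1) ≠ 0 := fun h => h1 (by
    have := (P.seq.eq_zero_iff P.m_pos).1 h
    rwa [neg_add_eq_sub, dvd_sub_comm] at this)
  refine ⟨-P.s (-i + 1), -P.s (-i), ?_, ?_⟩
  · rw [neg_mul_neg, mul_comm]
    exact lt_of_le_of_ne h3 (mul_ne_zero h2 h4).symm
  · rw [tau_vec, show 1 - i - 1 = -i by ring, show 1 - i = -i + 1 by ring]
    module

theorem inCone_tau_vec (i : ℤ) : P.InCone i (P.tau i (P.vec (i - 1))) := by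
  have h2 := P.seq.neg 2
  have h1 := P.seq.neg 1
  have h3 := P.seq.succ 1
  rw [sub_self, P.seq.zero, P.seq.one, mul_one, sub_zero, one_add_one_eq_two] at h3
  refine ⟨1, P.l, by rw [one_mul]; exact P.seq.lpos, ?_⟩
  rw [tau_vec, show i - 1 - i - 1 = -2 by ring, show i - 1 - i = -1 by ring, h1, h2, h3, P.seq.one]
  module

end DihedralPair

theorem transvection_zpow_apply {V : Type*} [AddCommGroup V] [Module ℝ V] {f : V →ₗ[ℝ] ℝ} {v : V}
    (h : f v = 0) (k : ℤ) (x : V) :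
    (LinearEquiv.transvection h ^ k) x = x + (k * f x) • v := by
  have h1 : ∀ x, LinearEquiv.transvection h x = x + f x • v := fun _ => rfl
  have h2 : ∀ x, (LinearEquiv.transvection h)⁻¹ x = x - f x • v := fun x => by
    have e : LinearEquiv.transvection h (x - f x • v) = x := by
      rw [h1, map_sub, map_smul, h, smul_zero, sub_zero, sub_add_cancel]
    nth_rw 1 [← e]
    rw [← LinearEquiv.mul_apply, inv_mul_cancel, LinearEquiv.coe_one, id]
  induction k using Int.induction_on with
  | zero => simp
  | succ k ih =>
    rw [add_comm (k : ℤ) 1, zpow_add, zpow_one, LinearEquiv.mul_apply, ih, h1, map_add, map_smul, h]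
    push_cast
    module
  | pred k ih =>
    rw [sub_eq_neg_add, zpow_add, zpow_neg_one, LinearEquiv.mul_apply, ih, h2, map_add, map_smul, h]
    push_cast
    module

/-- Products of dual generators. -/
def dualProd {Γ : Type*} [Group Γ] (A B : Γ) (l : List ℤ) : Γ := (l.map (dual A B)).prod

section DualProd

variable {Γ : Type*} [Group Γ] {A B : Γ}

theorem dualProd_append (l l' : List ℤ) :
    dualProd A B (l ++ l') = dualProd A B l * dualProd A B l' := by simp [dualProd]

theorem dualProd_cons (i : ℤ) (l : List ℤ) :
    dualProd A B (i :: l) = dual A B i * dualProd A B l := by simp [dualProd]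

theorem dualProd_singleton (i : ℤ) : dualProd A B [i] = dual A B i := by simp [dualProd]

theorem dualProd_nil : dualProd A B [] = 1 := by simp [dualProd]

theorem dualProd_mul_zpow (l : List ℤ) (c : ℤ) :
    dualProd A B l * (A * B) ^ c = (A * B) ^ c * dualProd A B (l.map (· + 2 * c)) := by
  induction l with
  | nil => simp [dualProd]
  | cons i l ih =>
    rw [List.map_cons, dualProd_cons, dualProd_cons, mul_assoc, ih, ← mul_assoc, dual_mul_zpow,
      mul_assoc]

theorem dual_inv (i : ℤ) : (dual A B i)⁻¹ = dual A B (i + 1) * (A * B)⁻¹ := by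
  rw [← dual_mul (A := A) (B := B) i, mul_inv_rev, mul_inv_cancel_left]

theorem exists_zpow_mul_dualProd {g : Γ} (hg : g ∈ Subgroup.closure {A, B}) :
    ∃ c l, g = (A * B) ^ (c : ℤ) * dualProd A B l := by
  have key : ∀ y ∈ ({A, B} : Set Γ), ∃ i, y = dual A B i := by
    rintro y (rfl | rfl)
    · exact ⟨0, dual_zero.symm⟩
    · exact ⟨1, dual_one.symm⟩
  induction hg using Subgroup.closure_induction_right with
  | one => exact ⟨0, [], by simp [dualProd]⟩
  | mul_right x _ y hy ih =>
    obtain ⟨c, l, rfl⟩ := ih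
    obtain ⟨i, rfl⟩ := key y hy
    exact ⟨c, l ++ [i], by rw [dualProd_append, dualProd_singleton, mul_assoc]⟩
  | mul_inv_cancel x _ y hy ih =>
    obtain ⟨c, l, rfl⟩ := ih
    obtain ⟨i, rfl⟩ := key y hy
    refine ⟨c + -1, (l ++ [i + 1]).map (· + 2 * -1), ?_⟩
    rw [zpow_add, mul_assoc _ _ (dualProd A B _), ← dualProd_mul_zpow, dualProd_append,
      dualProd_singleton, dual_inv, zpow_neg_one]
    simp only [mul_assoc]

/-- No two consecutive letters multiply to the product of the two generators. -/
def NoCancel (m : ℕ) (l : List ℤ) : Prop := l.IsChain fun i j => ¬ (m : ℤ) ∣ j - i - 1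

theorem dual_eq_of_dvd {m : ℕ} (hm : m ≠ 0) (h : alt A B m = alt B A m) {i j : ℤ}
    (hij : (m : ℤ) ∣ i - j) : dual A B i = dual A B j := by
  obtain ⟨k, hk⟩ := hij
  have key : ∀ k : ℤ, dual A B (j + m * k) = dual A B j := by
    intro k
    induction k using Int.induction_on with
    | zero => simp
    | succ k ih => rw [mul_add, mul_one, ← add_assoc, dual_add_period hm h, ih]
    | pred k ih =>
      rw [← dual_add_period hm h, ← ih]
      congr 1
      ring
  rw [← key k, ← hk, add_sub_cancel]

theorem exists_shorter {m : ℕ} (hm : m ≠ 0) (h : alt A B m = alt B A m) {l : List ℤ}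
    (hl : ¬ NoCancel m l) :
    ∃ l' : List ℤ, l'.length < l.length ∧ dualProd A B l = A * B * dualProd A B l' := by
  rw [NoCancel, List.isChain_iff_forall_rel_of_append_cons_cons] at hl
  push Not at hl
  obtain ⟨x, y, l1, l2, rfl, hxy⟩ := hl
  refine ⟨l1.map (· + 2 * 1) ++ l2, by simp, ?_⟩
  have := dualProd_mul_zpow (A := A) (B := B) l1 1
  rw [zpow_one] at this
  rw [dualProd_append, dualProd_append, ← mul_assoc, ← this, dualProd_cons, dualProd_cons,
    dual_eq_of_dvd (i := y) (j := x + 1) hm h (by rwa [← sub_sub]), ← mul_assoc (dual A B x),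
    dual_mul]
  simp only [mul_assoc]

theorem exists_reduced {m : ℕ} (hm : m ≠ 0) (h : alt A B m = alt B A m) (l : List ℤ) (c e : ℤ) :
    ∃ (c' : ℤ) (l' : List ℤ) (e' : ℤ),
      (A * B) ^ c * dualProd A B l * B ^ e = (A * B) ^ c' * dualProd A B l' * B ^ e' ∧
      NoCancel m l' ∧ ∀ l'' x, l' = l'' ++ [x] → ¬ (m : ℤ) ∣ x ∧ ¬ (m : ℤ) ∣ x - 1 := by
  induction hN : l.length using Nat.strong_induction_on generalizing l c e with
  | _ N ih =>
  by_cases hl : NoCancel m l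
  swap
  · obtain ⟨l', hlen, hl'⟩ := exists_shorter hm h hl
    obtain ⟨c', l1, e', h1, h2⟩ := ih _ (hN ▸ hlen) l' (c + 1) e rfl
    refine ⟨c', l1, e', ?_, h2⟩
    rw [← h1, hl', zpow_add_one]
    simp only [mul_assoc]
  by_cases hx : ∀ l'' x, l = l'' ++ [x] → ¬ (m : ℤ) ∣ x ∧ ¬ (m : ℤ) ∣ x - 1
  · exact ⟨c, l, e, rfl, hl, hx⟩
  push Not at hx
  obtain ⟨l1, x, rfl, hx⟩ := hx
  by_cases hx0 : (m : ℤ) ∣ x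
  · obtain ⟨c', l2, e', h1, h2⟩ := ih _ (by simp [← hN]) (l1.map (· + 2 * 1)) (c + 1) (e - 1) rfl
    refine ⟨c', l2, e', ?_, h2⟩
    have h3 := dualProd_mul_zpow (A := A) (B := B) l1 1
    rw [zpow_one] at h3
    rw [← h1, dualProd_append, dualProd_singleton,
      dual_eq_of_dvd (j := 0) hm h (by rwa [sub_zero]), dual_zero, zpow_add_one, zpow_sub_one,
      mul_assoc ((A * B) ^ c) (A * B), ← h3]
    group
  · have hx1 := hx hx0
    obtain ⟨c', l2, e', h1, h2⟩ := ih _ (by simp [← hN]) l1 c (e + 1) rfl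
    refine ⟨c', l2, e', ?_, h2⟩
    rw [← h1, dualProd_append, dualProd_singleton, dual_eq_of_dvd (j := 1) hm h hx1, dual_one]
    group

end DualProd

/-- A group with two elements satisfying a braid relation, acting on a space through a
dihedral pair of transvections. -/
structure DihedralAction {Γ : Type*} [Group Γ] (A B : Γ) (V : Type*) [AddCommGroup V] [Module ℝ V]
    (m : ℕ) extends DihedralPair V m where
  braid : alt A B m = alt B A m
  ρ : Γ →* (V ≃ₗ[ℝ] V)
  ρA : ρ A = toDihedralPair.tau 0
  ρB : ρ B = toDihedralPair.tau 1
  deg : Γ →* Multiplicative ℤ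
  degA : deg A = Multiplicative.ofAdd 1
  degB : deg B = Multiplicative.ofAdd 1

namespace DihedralPair

variable {V : Type*} [AddCommGroup V] [Module ℝ V] {m : ℕ} (P : DihedralPair V m)

theorem zpow_vec (c k : ℤ) :
    ∃ ε : ℝ, ε ≠ 0 ∧ ((P.tau 0 * P.tau 1) ^ c) (P.vec k) = ε • P.vec (k - 2 * c) := by
  have h1 : ∀ k, ((P.tau 0 * P.tau 1)⁻¹) (P.vec k) = -P.vec (k + 2) := by
    intro k
    have e : (P.tau 0 * P.tau 1) (-P.vec (k + 2)) = P.vec k := by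
      rw [map_neg, mul_tau_vec, neg_neg, add_sub_cancel_right]
    rw [← e, ← LinearEquiv.mul_apply, inv_mul_cancel, LinearEquiv.coe_one, id]
  induction c using Int.induction_on with
  | zero => exact ⟨1, one_ne_zero, by simp⟩
  | succ c ih =>
    obtain ⟨ε, hε, ih⟩ := ih
    refine ⟨-ε, neg_ne_zero.2 hε, ?_⟩
    rw [add_comm (c : ℤ) 1, zpow_add, zpow_one, LinearEquiv.mul_apply, ih, map_smul, mul_tau_vec,
      show k - 2 * (c : ℤ) - 2 = k - 2 * (1 + c) by ring]
    module
  | pred c ih =>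
    obtain ⟨ε, hε, ih⟩ := ih
    refine ⟨-ε, neg_ne_zero.2 hε, ?_⟩
    rw [sub_eq_neg_add, zpow_add, zpow_neg_one, LinearEquiv.mul_apply, ih, map_smul, h1,
      show k - 2 * (-c : ℤ) + 2 = k - 2 * (-1 + -c) by ring]
    module

theorem cov_zpow_vec_eq_zero (c j k : ℤ) :
    P.cov j (((P.tau 0 * P.tau 1) ^ c) (P.vec k)) = 0 ↔ (m : ℤ) ∣ j - k + 2 * c := by
  obtain ⟨ε, hε, h⟩ := P.zpow_vec c k
  rw [h, map_smul, cov_vec, smul_eq_mul, mul_eq_zero, mul_eq_zero,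
    or_iff_right hε, or_iff_right P.seq.lpos.ne', P.seq.eq_zero_iff P.m_pos, ← sub_add]

end DihedralPair

namespace DihedralAction

variable {Γ : Type*} [Group Γ] {A B : Γ} {V : Type*} [AddCommGroup V] [Module ℝ V] {m : ℕ}
  (D : DihedralAction A B V m)

theorem map_dual (i : ℤ) : D.ρ (dual A B i) = D.tau i := by
  rw [_root_.map_dual, D.ρA, D.ρB, ← D.tau_eq_dual]

theorem map_zpow_mul (c : ℤ) : D.ρ ((A * B) ^ c) = (D.tau 0 * D.tau 1) ^ c := by
  rw [map_zpow, map_mul, D.ρA, D.ρB]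

theorem deg_dual (i : ℤ) : D.deg (dual A B i) = Multiplicative.ofAdd 1 := by
  rw [_root_.map_dual, D.degA, D.degB]
  exact (eq_dual (f := fun _ => Multiplicative.ofAdd (1 : ℤ)) rfl (fun _ => rfl) i).symm

theorem deg_dualProd (l : List ℤ) :
    D.deg (dualProd A B l) = Multiplicative.ofAdd (l.length : ℤ) := by
  induction l with
  | nil => simp [dualProd]
  | cons i l ih =>
    rw [dualProd_cons, map_mul, ih, deg_dual, ← ofAdd_add, List.length_cons, Nat.cast_succ,
      add_comm]

theorem deg_zpow_mul (c : ℤ) : D.deg ((A * B) ^ c) = Multiplicative.ofAdd (2 * c) := by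
  rw [map_zpow, map_mul, D.degA, D.degB, ← ofAdd_add, ← ofAdd_zsmul, smul_eq_mul, mul_comm,
    one_add_one_eq_two]

theorem inCone_dualProd {l : List ℤ} {j : ℤ} {x : V} (hl : NoCancel m (l ++ [j]))
    (hx : D.InCone j x) : ∃ k ∈ (l ++ [j]).head?, D.InCone k (D.ρ (dualProd A B l) x) := by
  induction l with
  | nil => exact ⟨j, by simp, by simpa [dualProd] using hx⟩
  | cons a l ih =>
    rw [NoCancel, List.cons_append, List.isChain_cons] at hl
    obtain ⟨k, hk, hc⟩ := ih hl.2
    refine ⟨a, by simp, ?_⟩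
    rw [dualProd_cons, map_mul, LinearEquiv.mul_apply, D.map_dual]
    exact hc.tau (hl.1 k hk)

theorem eq_one_of_pow_eq_one (D : DihedralAction A B V m) {n : ℕ} (hn : n ≠ 0) (l : List ℤ) (c : ℤ)
    (h : ((A * B) ^ c * dualProd A B l) ^ n = 1) : (A * B) ^ c * dualProd A B l = 1 := by
  induction hN : l.length using Nat.strong_induction_on generalizing l c with
  | _ N ih =>
  have hm := D.toDihedralPair.m_pos.ne'
  by_cases hl : NoCancel m l
  swap
  · obtain ⟨l', hlen, hl'⟩ := exists_shorter hm D.braid hl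
    have e : (A * B) ^ c * dualProd A B l = (A * B) ^ (c + 1) * dualProd A B l' := by
      rw [hl', zpow_add_one, mul_assoc, mul_assoc, mul_assoc]
    rw [e] at h ⊢
    exact ih _ (hN ▸ hlen) _ _ h rfl
  have hdeg : 2 * c + l.length = 0 := by
    have := congrArg D.deg h
    rw [map_pow, map_mul, D.deg_dualProd, D.deg_zpow_mul, map_one, ← ofAdd_add, ← ofAdd_nsmul,
      ofAdd_eq_one, smul_eq_zero] at this
    exact this.resolve_left hn
  rcases l.eq_nil_or_concat' with rfl | ⟨l1, j, rfl⟩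
  · have : c = 0 := by simpa using hdeg
    simp [this, dualProd]
  rcases l1 with _ | ⟨i, l1⟩
  · simp only [List.nil_append, List.length_singleton, Nat.cast_one] at hdeg
    omega
  by_cases hR : (m : ℤ) ∣ i - (j + 2 * c) - 1
  · have e : dual A B j * ((A * B) ^ c * dualProd A B (i :: l1 ++ [j])) * (dual A B j)⁻¹ =
        (A * B) ^ (c + 1) * dualProd A B l1 := by
      rw [dualProd_append, dualProd_cons, dualProd_singleton,
        dual_eq_of_dvd (i := i) (j := j + 2 * c + 1) hm D.braid (by rwa [← sub_sub]), ← mul_assoc,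
        ← mul_assoc, ← mul_assoc, mul_inv_cancel_right, dual_mul_zpow,
        mul_assoc ((A * B) ^ c), dual_mul, zpow_add_one]
    have h1 : ((A * B) ^ (c + 1) * dualProd A B l1) ^ n = 1 := by
      rw [← e, conj_pow, h, mul_one, mul_inv_cancel]
    have h2 := ih _ (by simp [← hN]) _ _ h1 rfl
    rwa [← e, conj_eq_one_iff] at h2
  exfalso
  have step : ∀ x, D.InCone j (D.ρ (dual A B j) x) →
      D.InCone (i - 2 * c) (D.ρ ((A * B) ^ c * dualProd A B (i :: l1 ++ [j])) x) := by
    intro x hx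
    obtain ⟨k, hk, hc⟩ := D.inCone_dualProd hl hx
    rw [List.cons_append, List.head?_cons, Option.mem_some_iff] at hk
    subst hk
    rw [map_mul, dualProd_append, dualProd_singleton, map_mul, LinearEquiv.mul_apply,
      LinearEquiv.mul_apply, D.map_zpow_mul]
    exact hc.zpow c
  have key : ∀ k, D.InCone (i - 2 * c)
      (D.ρ (((A * B) ^ c * dualProd A B (i :: l1 ++ [j])) ^ (k + 1)) (D.vec (j - 1))) := by
    intro k
    induction k with
    | zero =>
      rw [zero_add, pow_one]
      refine step _ ?_
      rw [D.map_dual]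
      exact DihedralPair.inCone_tau_vec j
    | succ k ih =>
      rw [pow_succ', map_mul, LinearEquiv.mul_apply]
      refine step _ ?_
      rw [D.map_dual]
      refine ih.tau ?_
      rwa [show i - 2 * c - j - 1 = i - (j + 2 * c) - 1 by ring]
  obtain ⟨k, rfl⟩ := Nat.exists_eq_succ_of_ne_zero hn
  have := key k
  rw [← Nat.succ_eq_add_one, h, map_one, LinearEquiv.coe_one, id] at this
  exact this.cov_ne_zero (j - 1) (D.cov_self _)

theorem map_zpow_right (k : ℤ) (x : V) : D.ρ (B ^ k) x = x + (k * D.cov 1 x) • D.vec 1 := by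
  rw [map_zpow, D.ρB, DihedralPair.tau, transvection_zpow_apply]

theorem vec_one_ne_zero : D.vec 1 ≠ 0 := by
  intro h
  have := (D.cov_vec 0 1).symm
  have h1 := D.seq.neg 1
  rw [h, map_zero, zero_sub, h1, D.seq.one, mul_neg_one, neg_eq_zero] at this
  exact D.seq.lpos.ne' this

/-- Roots of powers of a generator of a dihedral Artin group. -/
theorem mem_zpowers_of_pow_mem (D : DihedralAction A B V m) {g : Γ}
    (hg : g ∈ Subgroup.closure {A, B}) {n : ℕ} (hn : n ≠ 0)
    (h : g ^ n ∈ Subgroup.zpowers B) : g ∈ Subgroup.zpowers B := by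
  have hm := D.toDihedralPair.m_pos.ne'
  obtain ⟨j, hj⟩ := Subgroup.mem_zpowers_iff.1 h
  obtain ⟨c, l, hgl⟩ := exists_zpow_mul_dualProd hg
  rcases eq_or_ne j 0 with rfl | hj0
  · rw [zpow_zero] at hj
    rw [hgl] at hj ⊢
    rw [D.eq_one_of_pow_eq_one hn l c hj.symm]
    exact one_mem _
  obtain ⟨c', l', e, h1, h2, h3⟩ := exists_reduced (c := c) (l := l) (e := 0) hm D.braid
  rw [zpow_zero, mul_one, ← hgl] at h1
  clear hgl
  have hvec : D.ρ g (D.vec 1) = D.ρ ((A * B) ^ c') (D.ρ (dualProd A B l') (D.vec 1)) := by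
    rw [h1, map_mul, map_mul, LinearEquiv.mul_apply, LinearEquiv.mul_apply, D.map_zpow_right,
      D.cov_self, mul_zero, zero_smul, add_zero]
  have hcov : D.cov 1 (D.ρ g (D.vec 1)) = 0 := by
    have hc : B ^ j * g = g * B ^ j := by rw [hj, ← pow_succ, ← pow_succ']
    have := congrArg (fun y => D.ρ y (D.vec 1)) hc
    simp only [map_mul, LinearEquiv.mul_apply, D.map_zpow_right, D.cov_self, mul_zero, zero_smul,
      add_zero, add_eq_left, smul_eq_zero, mul_eq_zero, D.vec_one_ne_zero, or_false,
      Int.cast_eq_zero, hj0, false_or] at this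
    exact this
  rcases l'.eq_nil_or_concat' with rfl | ⟨l1, x, rfl⟩
  · rw [dualProd_nil, mul_one] at h1
    rw [dualProd_nil, map_one, LinearEquiv.coe_one, id, D.map_zpow_mul] at hvec
    rw [hvec, D.cov_zpow_vec_eq_zero, sub_self, zero_add] at hcov
    have hcomm : Commute ((A * B) ^ c') (B ^ e) := by
      refine Commute.zpow_right ?_ _
      have := dual_mul_zpow (A := A) (B := B) 1 c'
      rw [dual_eq_of_dvd hm D.braid (i := 1 + 2 * c') (j := 1) (by simpa using hcov),
        dual_one] at this
      exact this.symm
    have hn' : (A * B) ^ (c' * n) = B ^ (j - e * n) := by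
      rw [h1, hcomm.mul_pow] at hj
      rw [zpow_sub, hj, zpow_mul, zpow_mul, zpow_natCast, zpow_natCast, mul_inv_cancel_right]
    have hq : j - e * n = 0 := by
      have h5 := (D.cov_zpow_vec_eq_zero (c' * n) 0 0).2 (by
        rw [sub_self, zero_add, ← mul_assoc]
        exact hcov.mul_right _)
      have h6 := D.seq.neg 1
      rw [← D.map_zpow_mul, hn', D.map_zpow_right, map_add, D.cov_self, map_smul, D.cov_vec,
        D.cov_vec, zero_sub, sub_zero, h6, D.seq.one] at h5
      have h7 : ((j - e * n : ℤ) : ℝ) = 0 := by simpa [D.seq.lpos.ne'] using h5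
      exact_mod_cast h7
    have hdeg := congrArg D.deg hn'
    rw [hq, zpow_zero, map_one, D.deg_zpow_mul, ofAdd_eq_one] at hdeg
    have hc0 : c' = 0 := by
      simpa [hn] using hdeg
    rw [h1, hc0, zpow_zero, one_mul]
    exact Subgroup.zpow_mem_zpowers _ _
  · exfalso
    obtain ⟨hx0, hx1⟩ := h3 _ _ rfl
    have hc : D.InCone x (D.ρ (dual A B x) (D.vec 1)) := by
      rw [D.map_dual]
      exact DihedralPair.inCone_tau_vec_one hx0 hx1
    obtain ⟨k, -, hc⟩ := D.inCone_dualProd h2 hc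
    refine (hc.zpow c').cov_ne_zero 1 ?_
    rw [← hcov, hvec, dualProd_append, dualProd_singleton, map_mul, LinearEquiv.mul_apply,
      D.map_zpow_mul]

end DihedralAction

namespace ArtinGroup

variable {S : Type u} (M : S → S → ℕ∞)

/-- Twice the cosine of `π / M a b`, which is `2` when `M a b = ⊤`. -/
noncomputable def weight (a b : S) : ℝ := 2 * Real.cos (Real.pi / (M a b).toNat)

open Classical in
/-- The sign making the form of the linear representation antisymmetric. -/
noncomputable def orient (a b : S) : ℝ := if WellOrderingRel a b then 1 else -1

open Classical in
/-- The coefficients of the linear forms of the transvections. -/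
noncomputable def coeff (a : S) : Option S → ℝ
  | none => 1
  | some b => if a = b then 0 else -(orient a b * weight M a b)

/-- The linear form of the transvection of a generator. -/
noncomputable def form (a : S) : (Option S →₀ ℝ) →ₗ[ℝ] ℝ :=
  Finsupp.linearCombination ℝ (coeff M a)

/-- The direction of the transvection of a generator. -/
noncomputable def root (a : S) : Option S →₀ ℝ := Finsupp.single (some a) 1

theorem orient_mul_self (a b : S) : orient a b * orient a b = 1 := by
  unfold orient
  split_ifs <;> norm_num

theorem orient_swap {a b : S} (h : a ≠ b) : orient b a = -orient a b := by
  unfold orient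
  rcases trichotomous_of WellOrderingRel a b with h1 | h1 | h1
  · rw [if_pos h1, if_neg (asymm h1)]
  · exact absurd h1 h
  · rw [if_pos h1, if_neg (asymm h1), neg_neg]

variable {M}

theorem weight_pos {a b : S} (h : 3 ≤ M a b) : 0 < weight M a b := by
  have hpi := Real.pi_pos
  refine mul_pos two_pos (Real.cos_pos_of_mem_Ioo ⟨?_, ?_⟩)
  · have : 0 ≤ Real.pi / (M a b).toNat := by positivity
    linarith
  · cases hk : M a b with
    | top => simpa using hpi
    | coe k =>
      rw [hk] at h
      have : (3 : ℝ) ≤ k := by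
        have h' : 3 ≤ k := by exact_mod_cast h
        exact_mod_cast h'
      have h1 : Real.pi / k ≤ Real.pi / 3 := div_le_div_of_nonneg_left hpi.le (by norm_num) this
      rw [ENat.toNat_natCast]
      linarith

theorem form_root_self (a : S) : form M a (root a) = 0 := by
  simp [form, root, coeff]

theorem form_root {a b : S} (h : a ≠ b) : form M a (root b) = -(orient a b * weight M a b) := by
  simp [form, root, coeff, h]

theorem form_none (a : S) : form M a (Finsupp.single none 1) = 1 := by
  simp [form, coeff]

variable (M) in
/-- The transvection of a generator. -/
noncomputable def transv (a : S) : (Option S →₀ ℝ) ≃ₗ[ℝ] (Option S →₀ ℝ) :=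
  LinearEquiv.transvection (form_root_self (M := M) a)

theorem transv_apply (a : S) (x : Option S →₀ ℝ) :
    transv M a x = x + form M a x • root a := rfl

theorem transv_zpow_apply (a : S) (k : ℤ) (x : Option S →₀ ℝ) :
    (transv M a ^ k) x = x + (k * form M a x) • root a :=
  transvection_zpow_apply _ k x

theorem exists_dihedralPair (hsymm : ∀ s t, M s t = M t s) (hlarge : ∀ s t, s ≠ t → 3 ≤ M s t)
    {a b : S} (h : a ≠ b) {k : ℕ} (hk : M a b = k) :
    ∃ P : DihedralPair (Option S →₀ ℝ) k, P.tau 0 = transv M a ∧ P.tau 1 = transv M b := by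
  have hk3 : 3 ≤ k := by
    have := hlarge a b h
    rw [hk] at this
    exact_mod_cast this
  obtain ⟨s, hs⟩ := exists_sinSeq hk3
  have hab : weight M a b = 2 * Real.cos (Real.pi / k) := by rw [weight, hk, ENat.toNat_natCast]
  have hba : weight M b a = 2 * Real.cos (Real.pi / k) := by
    rw [weight, ← hsymm, hk, ENat.toNat_natCast]
  have ho := orient_mul_self a b
  let P : DihedralPair (Option S →₀ ℝ) k :=
    { l := 2 * Real.cos (Real.pi / k)
      s := s
      seq := hs
      hm := hk3
      e := root a
      f := orient a b • root b
      β := form M a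
      γ := orient a b • form M b
      he := form_root_self a
      hf := by simp [form_root_self]
      hef := by
        rw [map_smul, form_root h, hab, smul_eq_mul, mul_neg, ← mul_assoc, ho, one_mul]
      hfe := by
        rw [LinearMap.smul_apply, form_root h.symm, hba, orient_swap h, neg_mul, neg_neg,
          smul_eq_mul, ← mul_assoc, ho, one_mul] }
  refine ⟨P, LinearEquiv.ext fun x => ?_, LinearEquiv.ext fun x => ?_⟩
  · have h1 := hs.neg 1
    rw [hs.one] at h1
    rw [P.tau_apply, transv_apply]
    simp [DihedralPair.cov, DihedralPair.vec, P, hs.zero, h1]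
  · rw [P.tau_apply, transv_apply]
    simp [DihedralPair.cov, DihedralPair.vec, P, hs.zero, hs.one, smul_smul, mul_right_comm, ho]

theorem braidWord_eq_alt (k : ℕ) (s t : S) :
    braidWord k s t = alt (FreeGroup.of s) (FreeGroup.of t) k := by
  simp only [braidWord, alt, apply_ite FreeGroup.of]

variable (M) in
/-- The generators of an Artin group. -/
def gen (s : S) : ArtinGroup M := PresentedGroup.of s

theorem alt_gen {s t : S} (h : s ≠ t) {k : ℕ} (hk : M s t = k) :
    alt (gen M s) (gen M t) k = alt (gen M t) (gen M s) k := by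
  have h1 : PresentedGroup.mk (artinRels M) (braidWord k s t * (braidWord k t s)⁻¹) = 1 :=
    PresentedGroup.one_of_mem ⟨s, t, h, k, hk, rfl⟩
  rwa [map_mul, map_inv, mul_inv_eq_one, braidWord_eq_alt, braidWord_eq_alt, map_alt,
    map_alt] at h1

theorem exists_lift {Γ : Type*} [Group Γ] (f : S → Γ)
    (h : ∀ s t (k : ℕ), s ≠ t → M s t = k → alt (f s) (f t) k = alt (f t) (f s) k) :
    ∃ φ : ArtinGroup M →* Γ, ∀ s, φ (gen M s) = f s := by
  refine ⟨PresentedGroup.toGroup (f := f) ?_, fun s => PresentedGroup.toGroup.of _⟩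
  rintro _ ⟨s, t, hst, k, hk, rfl⟩
  rw [map_mul, map_inv, mul_inv_eq_one, braidWord_eq_alt, braidWord_eq_alt, map_alt, map_alt]
  simpa using h s t k hst hk

variable (M) in
theorem exists_degree :
    ∃ d : ArtinGroup M →* Multiplicative ℤ, ∀ s, d (gen M s) = Multiplicative.ofAdd 1 :=
  exists_lift _ fun _ _ _ _ _ => rfl

theorem exists_representation (hsymm : ∀ s t, M s t = M t s)
    (hlarge : ∀ s t, s ≠ t → 3 ≤ M s t) :
    ∃ ρ : ArtinGroup M →* ((Option S →₀ ℝ) ≃ₗ[ℝ] (Option S →₀ ℝ)), ∀ s, ρ (gen M s) = transv M s :=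
  exists_lift _ fun s t k hst hk => by
    obtain ⟨P, h0, h1⟩ := exists_dihedralPair hsymm hlarge hst hk
    rw [← h0, ← h1, P.alt_tau]

theorem pair_root (hsymm : ∀ s t, M s t = M t s) (hlarge : ∀ s t, s ≠ t → 3 ≤ M s t)
    {a b : S} (hab : a ≠ b) (ht : M a b ≠ ⊤) {g : ArtinGroup M} {n : ℕ}
    (hg : g ∈ Subgroup.closure (gen M '' {a, b})) (hn : n ≠ 0)
    (h : g ^ n ∈ Subgroup.zpowers (gen M a)) : g ∈ Subgroup.zpowers (gen M a) := by
  obtain ⟨k, hk⟩ := ENat.ne_top_iff_exists.1 ht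
  have hk' : M b a = k := by rw [← hsymm, hk]
  obtain ⟨P, h0, h1⟩ := exists_dihedralPair hsymm hlarge hab.symm hk'
  obtain ⟨d, hd⟩ := exists_degree M
  obtain ⟨ρ, hρ⟩ := exists_representation hsymm hlarge
  rw [Set.pair_comm, Set.image_pair] at hg
  exact DihedralAction.mem_zpowers_of_pow_mem
    { toDihedralPair := P, braid := alt_gen hab.symm hk', ρ := ρ, ρA := by rw [hρ, h0],
      ρB := by rw [hρ, h1], deg := d, degA := hd b, degB := hd a } hg hn h

theorem pow_mem (hsymm : ∀ s t, M s t = M t s) (hlarge : ∀ s t, s ≠ t → 3 ≤ M s t)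
    {a : S} {X : Set S} {k : ℤ} (h : gen M a ^ k ∈ Subgroup.closure (gen M '' X)) (hk : k ≠ 0) :
    a ∈ X := by
  obtain ⟨ρ, hρ⟩ := exists_representation hsymm hlarge
  by_contra ha
  have key : ∀ g ∈ Subgroup.closure (gen M '' X), ∀ x, ρ g x (some a) = x (some a) := by
    intro g hg
    induction hg using Subgroup.closure_induction with
    | mem g hg =>
      obtain ⟨b, hb, rfl⟩ := hg
      intro x
      have hba : b ≠ a := fun e => ha (e ▸ hb)
      rw [hρ, transv_apply]
      simp [root, hba]
    | one => simp
    | mul g g' _ _ h1 h2 => intro x; rw [map_mul, LinearEquiv.mul_apply, h1, h2]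
    | inv g _ h1 =>
      intro x
      rw [← h1, ← LinearEquiv.mul_apply, ← map_mul, mul_inv_cancel, map_one,
        LinearEquiv.coe_one, id]
  have := key _ h (Finsupp.single none 1)
  rw [map_zpow, hρ, transv_zpow_apply, form_none] at this
  simp [root, hk] at this

theorem alternating (hsymm : ∀ s t, M s t = M t s) (hlarge : ∀ s t, s ≠ t → 3 ≤ M s t)
    {a b : S} {i j k l : ℤ} (hab : a ≠ b)
    (h : gen M a ^ i * gen M b ^ j * gen M a ^ k * gen M b ^ l = 1) :
    i = 0 ∨ j = 0 ∨ k = 0 ∨ l = 0 := by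
  obtain ⟨ρ, hρ⟩ := exists_representation hsymm hlarge
  have h1 : gen M a ^ i * gen M b ^ j = gen M b ^ (-l) * gen M a ^ (-k) := by
    rw [mul_assoc, mul_eq_one_iff_eq_inv] at h
    rw [h]
    group
  have h2 := DFunLike.congr_fun (congrArg (fun g => ρ g (root b)) h1) (some b)
  simp only [map_mul, map_zpow, hρ, LinearEquiv.mul_apply, transv_zpow_apply, map_add, map_smul,
    form_root_self, form_root hab, form_root hab.symm, orient_swap hab] at h2
  have ho := orient_mul_self a b
  have w1 := (weight_pos (hlarge a b hab)).ne'
  have w2 := (weight_pos (hlarge b a hab.symm)).ne'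
  have o1 : orient a b ≠ 0 := left_ne_zero_of_mul_eq_one ho
  simp [root, hab, w1, w2, o1] at h2
  tauto

theorem exists_hom (Ω : Type u) (π : Ω → ArtinGroup M) (τ : S → Equiv.Perm Ω)
    (hπ : ∀ s ω, π (τ s ω) = π ω * (gen M s)⁻¹)
    (hE : ∀ a b, a ≠ b ∧ M a b ≠ ⊤ → ∃ E : Ω → Ω → Prop, (∀ ω, E ω ω) ∧
      (∀ ω ω' s, s = a ∨ s = b → E ω ω' → E ω (τ s ω') ∧ E ω ((τ s).symm ω')) ∧
      (∀ ω ω', E ω ω' → π ω = π ω' → ω = ω')) :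
    ∃ φ : ArtinGroup M →* Equiv.Perm Ω, ∀ s, φ (gen M s) = τ s := by
  refine ⟨PresentedGroup.toGroup (f := τ) ?_, fun s => PresentedGroup.toGroup.of _⟩
  intro r hr
  have hr1 := PresentedGroup.one_of_mem hr
  obtain ⟨s, t, hst, k, hk, rfl⟩ := hr
  obtain ⟨E, E0, E1, E2⟩ := hE s t ⟨hst, by simp [hk]⟩
  have hsymm' : ∀ s ω, π ((τ s)⁻¹ ω) = π ω * gen M s := fun s ω => by
    have := hπ s ((τ s)⁻¹ ω)
    rw [← Equiv.Perm.mul_apply, mul_inv_cancel, Equiv.Perm.one_apply] at this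
    rw [this, inv_mul_cancel_right]
  have key : ∀ w ∈ Subgroup.closure {FreeGroup.of s, FreeGroup.of t}, ∀ ω,
      E ω (FreeGroup.lift τ w ω) ∧
        π (FreeGroup.lift τ w ω) = π ω * (PresentedGroup.mk (artinRels M) w)⁻¹ := by
    intro w hw ω
    have hgen : ∀ y ∈ ({FreeGroup.of s, FreeGroup.of t} : Set (FreeGroup S)),
        ∃ u, (u = s ∨ u = t) ∧ y = FreeGroup.of u := by
      rintro y (rfl | rfl)
      exacts [⟨s, .inl rfl, rfl⟩, ⟨t, .inr rfl, rfl⟩]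
    induction hw using Subgroup.closure_induction_left with
    | one => simp [E0]
    | mul_left y hy w _ ih =>
      obtain ⟨u, hu, rfl⟩ := hgen y hy
      rw [map_mul, Equiv.Perm.mul_apply, FreeGroup.lift_apply_of, hπ, ih.2, map_mul, mul_inv_rev,
        mul_assoc]
      exact ⟨(E1 _ _ u hu ih.1).1, rfl⟩
    | inv_mul_cancel y hy w _ ih =>
      obtain ⟨u, hu, rfl⟩ := hgen y hy
      rw [map_mul, map_inv, Equiv.Perm.mul_apply, FreeGroup.lift_apply_of, hsymm', ih.2, map_mul,
        map_inv, mul_inv_rev, inv_inv, mul_assoc]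
      exact ⟨(E1 _ _ u hu ih.1).2, rfl⟩
  have hword : ∀ (u v : S), (u = s ∨ u = t) → (v = s ∨ v = t) →
      braidWord k u v ∈ Subgroup.closure {FreeGroup.of s, FreeGroup.of t} := by
    intro u v hu hv
    refine Subgroup.list_prod_mem _ fun x hx => ?_
    obtain ⟨i, -, rfl⟩ := List.mem_map.1 hx
    refine Subgroup.subset_closure ?_
    split_ifs
    · rcases hu with rfl | rfl <;> simp
    · rcases hv with rfl | rfl <;> simp
  ext ω
  obtain ⟨h1, h2⟩ := key _ (mul_mem (hword s t (.inl rfl) (.inr rfl))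
    (inv_mem (hword t s (.inr rfl) (.inl rfl)))) ω
  rw [hr1, inv_one, mul_one] at h2
  exact (E2 _ _ h1 h2.symm).symm

/-- Artin groups of large type have the properties collected in `LargeGroup`. -/
def largeGroup (hsymm : ∀ s t, M s t = M t s) (hlarge : ∀ s t, s ≠ t → 3 ≤ M s t) :
    LargeGroup (ArtinGroup M) S where
  gen := gen M
  fin a b := a ≠ b ∧ M a b ≠ ⊤
  fin_symm h := ⟨h.1.symm, hsymm _ _ ▸ h.2⟩
  fin_ne h := h.1
  closure_eq := PresentedGroup.closure_range_of _
  pow_mem := pow_mem hsymm hlarge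
  alternating := alternating hsymm hlarge
  pair_root h := pair_root hsymm hlarge h.1 h.2
  exists_degree := exists_degree M
  exists_hom := exists_hom

end ArtinGroup

/-- Parabolic subgroups of a large-type Artin group are stable under taking roots:
if `g ^ n ∈ P` for some non-zero integer `n`, then `g ∈ P`. -/
theorem parabolic_root_stable {S : Type*} [Finite S] (M : S → S → ℕ∞)
    (hsymm : ∀ s t : S, M s t = M t s)
    (hlarge : ∀ s t : S, s ≠ t → 3 ≤ M s t)
    (P : Subgroup (ArtinGroup M)) (hP : IsParabolic M P)
    (g : ArtinGroup M) (n : ℤ) (hn : n ≠ 0) (hg : g ^ n ∈ P) :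
    g ∈ P := by
  obtain ⟨h, X, rfl⟩ := hP
  have hmem : ∀ x, x ∈ conjSubgroup h (StandardParabolic M X) ↔
      h⁻¹ * x * h ∈ (ArtinGroup.largeGroup hsymm hlarge).H X := by
    intro x
    rw [conjSubgroup, Subgroup.mem_map]
    constructor
    · rintro ⟨y, hy, rfl⟩
      have e : h⁻¹ * (h * y * h⁻¹) * h = y := by group
      exact (congrArg (· ∈ (ArtinGroup.largeGroup hsymm hlarge).H X) e).mpr hy
    · exact fun hx => ⟨_, hx, by simp [mul_assoc]⟩
  rw [hmem] at hg ⊢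
  refine LargeGroup.mem_of_pow_mem (Int.natAbs_ne_zero.2 hn) ?_
  have e : (h⁻¹ * g * h) ^ n = h⁻¹ * g ^ n * h := by
    have := conj_zpow (a := h⁻¹) (b := g) (i := n)
    rwa [inv_inv] at this
  rw [← e] at hg
  rcases Int.natAbs_eq n with hn' | hn'
  · rwa [hn', zpow_natCast] at hg
  · rw [hn', zpow_neg, zpow_natCast] at hg
    exact inv_mem_iff.1 hg
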